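/- arXiv:1902.09273 — 4 statements merged into one kernel-verified Lean document; each statement's English description precedes it below -/
import Mathlib

section
/- If R₁ and R₂ are two admissible trapezoids in the weighted homogeneous tree with R₁ ∩ R₂ ≠ ∅ and w(R₁) ≥ w(R₂), then R₂ is contained in the envelope R̃₁ of R₁. -/
open scoped ENNReal NNReal
open MeasureTheory Filter

/-- An infinite homogeneous tree of order `q+1`: a connected acyclic graph in which
every vertex has exactly `q+1` neighbours, equipped with a doubly-infinite geodesic
`geo : ℤ → V` (the labelling `N` is the inverse of `geo`) and the associated level
function `lev`, satisfying `lev (geo i) = i`, changing by `±1` along edges, and such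
that every vertex has exactly one neighbour lying directly above it. -/
structure HomTree (q : ℕ) where
  V : Type
  G : SimpleGraph V
  conn : G.Connected
  acyclic : G.IsAcyclic
  degree : ∀ v : V, (G.neighborSet v).ncard = q + 1
  lev : V → ℤ
  geo : ℤ → V
  geo_dist : ∀ i j : ℤ, G.dist (geo i) (geo j) = (i - j).natAbs
  lev_geo : ∀ i : ℤ, lev (geo i) = i
  lev_adj : ∀ v w : V, G.Adj v w → lev w = lev v + 1 ∨ lev w = lev v - 1
  unique_above : ∀ v : V, ∃! w : V, G.Adj v w ∧ lev w = lev v + 1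

namespace HomTree

variable {q : ℕ}

/-- Graph distance on the tree. -/
noncomputable def dist (T : HomTree q) (x y : T.V) : ℕ := T.G.dist x y

/-- `x` lies below `y`. -/
def below (T : HomTree q) (x y : T.V) : Prop := T.lev x = T.lev y - T.dist x y

/-- The weighted measure `μ(A) = ∑_{x ∈ A} q^{ℓ(x)}`. -/
noncomputable def mu (T : HomTree q) (A : Set T.V) : ℝ≥0∞ :=
  ∑' x : A, (q : ℝ≥0∞) ^ (T.lev x.1)

def sphere (T : HomTree q) (x₀ : T.V) (r : ℕ) : Set T.V := {x | T.dist x x₀ = r}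

def ball (T : HomTree q) (x₀ : T.V) (r : ℕ) : Set T.V := {x | T.dist x x₀ ≤ r}

/-- An admissible trapezoid: either a degenerate singleton `{root}` (with height 1), or
the set of vertices below the root spanning levels `[h, 2h)` under it. -/
structure Trapezoid (T : HomTree q) where
  root : T.V
  height : ℕ
  degenerate : Bool
  height_pos : 1 ≤ height
  deg_height : degenerate = true → height = 1

namespace Trapezoid

variable {T : HomTree q}

/-- The vertex set of the admissible trapezoid. -/
def set (R : T.Trapezoid) : Set T.V :=
  if R.degenerate then {R.root}
  else {x | T.below x R.root ∧ (R.height : ℤ) ≤ T.lev R.root - T.lev x ∧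
        T.lev R.root - T.lev x < 2 * (R.height : ℤ)}

/-- The envelope (Calderón–Zygmund set) of the admissible trapezoid:
vertices below the root with `h/2 ≤ ℓ(x_R) - ℓ(x) < 4h`. -/
def envelope (R : T.Trapezoid) : Set T.V :=
  if R.degenerate then {R.root}
  else {x | T.below x R.root ∧ (R.height : ℤ) ≤ 2 * (T.lev R.root - T.lev x) ∧
        T.lev R.root - T.lev x < 4 * (R.height : ℤ)}

/-- The width `w(R) = q^{ℓ(x_R)}`. -/
noncomputable def width (R : T.Trapezoid) : ℝ≥0∞ := (q : ℝ≥0∞) ^ (T.lev R.root)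

/-- The dilated set `R̃* = {x : d(x, R̃) < h(R̃)/4}`. -/
def dilate (R : T.Trapezoid) : Set T.V :=
  {x | ∃ y ∈ R.envelope, 4 * T.dist x y < R.height}

end Trapezoid

/-- `‖f‖_{L^p(μ)}^p = ∑_x |f(x)|^p q^{ℓ(x)}`. -/
noncomputable def lpPow (T : HomTree q) (f : T.V → ℂ) (p : ℝ) : ℝ≥0∞ :=
  ∑' x : T.V, (‖f x‖₊ : ℝ≥0∞) ^ p * (q : ℝ≥0∞) ^ (T.lev x)

/-- `∫_A |f|^p dμ`. -/
noncomputable def setIntPow (T : HomTree q) (f : T.V → ℂ) (p : ℝ) (A : Set T.V) : ℝ≥0∞ :=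
  ∑' x : A, (‖f x.1‖₊ : ℝ≥0∞) ^ p * (q : ℝ≥0∞) ^ (T.lev x.1)

/-- `‖f‖_{L¹(μ)}`. -/
noncomputable def l1Norm (T : HomTree q) (f : T.V → ℂ) : ℝ≥0∞ :=
  ∑' x : T.V, (‖f x‖₊ : ℝ≥0∞) * (q : ℝ≥0∞) ^ (T.lev x)

/-- `‖f‖_{L²(μ)}`. -/
noncomputable def l2Norm (T : HomTree q) (f : T.V → ℂ) : ℝ≥0∞ :=
  (T.lpPow f 2) ^ (2⁻¹ : ℝ)

/-- `‖f‖_{L^{p}(μ)}` for `p ∈ ℝ≥0∞`, including `p = ∞`. -/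
noncomputable def lpNormE (T : HomTree q) (p : ℝ≥0∞) (f : T.V → ℂ) : ℝ≥0∞ :=
  if p = ⊤ then ⨆ x, (‖f x‖₊ : ℝ≥0∞) else (T.lpPow f p.toReal) ^ (p.toReal)⁻¹

/-- The trapezoidal maximal function of a nonnegative density `g`. -/
noncomputable def maxFn (T : HomTree q) (g : T.V → ℝ≥0∞) (x : T.V) : ℝ≥0∞ :=
  ⨆ (R : T.Trapezoid) (_ : x ∈ R.set),
    (∑' y : R.set, g y.1 * (q : ℝ≥0∞) ^ (T.lev y.1)) / T.mu R.set

/-- `a` is a `(1,∞)`-atom associated with the Calderón–Zygmund set `R̃`. -/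
def IsInftyAtomOn (T : HomTree q) (R : T.Trapezoid) (a : T.V → ℂ) : Prop :=
  Function.support a ⊆ R.envelope ∧
  (∀ x, (‖a x‖₊ : ℝ≥0∞) ≤ (T.mu R.envelope)⁻¹) ∧
  ∑' x : T.V, a x * (q : ℂ) ^ (T.lev x) = 0

/-- `a` is a `(1,∞)`-atom. -/
def IsInftyAtom (T : HomTree q) (a : T.V → ℂ) : Prop :=
  ∃ R : T.Trapezoid, T.IsInftyAtomOn R a

/-- `a` is a `(1,p)`-atom, `1 < p < ∞`: supported in a Calderón–Zygmund set `R̃`,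
`‖a‖_{L^p} ≤ μ(R̃)^{1/p-1}` (equivalently `‖a‖_{L^p}^p ≤ μ(R̃)^{1-p}`), vanishing integral. -/
def IspAtom (T : HomTree q) (p : ℝ) (a : T.V → ℂ) : Prop :=
  ∃ R : T.Trapezoid, Function.support a ⊆ R.envelope ∧
    T.lpPow a p ≤ (T.mu R.envelope) ^ (1 - p) ∧
    ∑' x : T.V, a x * (q : ℂ) ^ (T.lev x) = 0

/-- `h` belongs to the atomic Hardy space `H^{1,∞}(μ)`. -/
def InH1 (T : HomTree q) (h : T.V → ℂ) : Prop :=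
  ∃ (c : ℕ → ℂ) (a : ℕ → T.V → ℂ), (∀ n, T.IsInftyAtom (a n)) ∧
    Summable (fun n => ‖c n‖) ∧ ∀ x, HasSum (fun n => c n * a n x) (h x)

/-- The `H^{1,∞}(μ)` norm: infimum of `∑ |λ_j|` over atomic decompositions. -/
noncomputable def H1Norm (T : HomTree q) (h : T.V → ℂ) : ℝ≥0∞ :=
  ⨅ (c : ℕ → ℂ) (a : ℕ → T.V → ℂ)
    (_ : (∀ n, T.IsInftyAtom (a n)) ∧ ∀ x, HasSum (fun n => c n * a n x) (h x)),
    ∑' n, (‖c n‖₊ : ℝ≥0∞)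

/-- `h` belongs to the atomic Hardy space `H^{1,p}(μ)`. -/
def InH1p (T : HomTree q) (p : ℝ) (h : T.V → ℂ) : Prop :=
  ∃ (c : ℕ → ℂ) (a : ℕ → T.V → ℂ), (∀ n, T.IspAtom p (a n)) ∧
    Summable (fun n => ‖c n‖) ∧ ∀ x, HasSum (fun n => c n * a n x) (h x)

/-- The `H^{1,p}(μ)` norm. -/
noncomputable def H1pNorm (T : HomTree q) (p : ℝ) (h : T.V → ℂ) : ℝ≥0∞ :=
  ⨅ (c : ℕ → ℂ) (a : ℕ → T.V → ℂ)
    (_ : (∀ n, T.IspAtom p (a n)) ∧ ∀ x, HasSum (fun n => c n * a n x) (h x)),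
    ∑' n, (‖c n‖₊ : ℝ≥0∞)

/-- The K-functional for the couple `(H¹(μ), L^{p₁}(μ))`. -/
noncomputable def KH1Lp (T : HomTree q) (p₁ : ℝ≥0∞) (t : ℝ≥0∞) (f : T.V → ℂ) : ℝ≥0∞ :=
  ⨅ (b : T.V → ℂ) (g : T.V → ℂ) (_ : ∀ x, f x = b x + g x),
    T.H1Norm b + t * T.lpNormE p₁ g

/-- The real interpolation norm `‖f‖_{θ,pr}` for the couple `(H¹(μ), L^{p₁}(μ))`. -/
noncomputable def interpNorm (T : HomTree q) (p₁ : ℝ≥0∞) (θ pr : ℝ) (f : T.V → ℂ) : ℝ≥0∞ :=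
  (∫⁻ t in Set.Ioi (0 : ℝ),
      (T.KH1Lp p₁ (ENNReal.ofReal t) f / (ENNReal.ofReal t) ^ θ) ^ pr *
        (ENNReal.ofReal t)⁻¹) ^ (1 / pr)

/-- The distinguished Laplacian `ℒ`. -/
noncomputable def lap (T : HomTree q) (f : T.V → ℂ) (x : T.V) : ℂ :=
  f x - (1 / (2 * ((Real.sqrt q : ℝ) : ℂ))) *
    ∑' y : T.G.neighborSet x, ((Real.sqrt q : ℝ) : ℂ) ^ (T.lev y.1 - T.lev x) * f y.1

end HomTree

open HomTree

namespace HomTree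

theorem walk_lev_le {q : ℕ} (T : HomTree q) {x y : T.V} (p : T.G.Walk x y) :
    T.lev y - T.lev x ≤ p.length := by
  induction p with
  | nil => simp
  | cons h p ih =>
    have := T.lev_adj _ _ h
    simp only [SimpleGraph.Walk.length_cons]
    push_cast
    omega

theorem lev_le_dist {q : ℕ} (T : HomTree q) (x y : T.V) :
    T.lev y - T.lev x ≤ T.dist x y := by
  obtain ⟨p, hp⟩ := T.conn.exists_walk_length_eq_dist x y
  have := T.walk_lev_le p
  unfold dist
  omega

theorem below_trans {q : ℕ} (T : HomTree q) {x y z : T.V} (h₁ : T.below x y)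
    (h₂ : T.below y z) : T.below x z := by
  have h3 : T.dist x z ≤ T.dist x y + T.dist y z := T.conn.dist_triangle
  have h4 := T.lev_le_dist x z
  unfold below at *
  omega

/-- Ascending walks from a common vertex are comparable. -/
theorem walk_comparable {q : ℕ} (T : HomTree q) {z y : T.V} (p : T.G.Walk z y) :
    ∀ {w : T.V} (r : T.G.Walk z w), T.lev y - T.lev z = p.length →
      T.lev w - T.lev z = r.length → T.lev y ≤ T.lev w → T.below y w := by
  induction p with
  | @nil u =>
    intro w r _ hr _
    have h1 := T.lev_le_dist u w
    have h2 := SimpleGraph.dist_le r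
    unfold below
    unfold dist at *
    omega
  | @cons a b c h p ih =>
    intro w r hp hr hle
    have hb := T.walk_lev_le p
    simp only [SimpleGraph.Walk.length_cons] at hp
    push_cast at hp
    have hab := T.lev_adj _ _ h
    cases r with
    | nil => omega
    | @cons _ d _ h' r =>
      have hd := T.walk_lev_le r
      simp only [SimpleGraph.Walk.length_cons] at hr
      push_cast at hr
      have had := T.lev_adj _ _ h'
      have hbd : d = b := (T.unique_above a).unique ⟨h', by omega⟩ ⟨h, by omega⟩
      subst hbd
      exact ih r (by omega) (by omega) hle

theorem below_comparable {q : ℕ} (T : HomTree q) {z y w : T.V} (h₁ : T.below z y)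
    (h₂ : T.below z w) (hle : T.lev y ≤ T.lev w) : T.below y w := by
  obtain ⟨p, hp⟩ := T.conn.exists_walk_length_eq_dist z y
  obtain ⟨r, hr⟩ := T.conn.exists_walk_length_eq_dist z w
  unfold below dist at h₁ h₂
  exact T.walk_comparable p r (by omega) (by omega) hle

end HomTree

/-- if two admissible trapezoids meet and `w(R₁) ≥ w(R₂)`, then
`R₂ ⊆ R̃₁`. -/
theorem trapezoid_subset_envelope {q : ℕ} (hq : 2 ≤ q) (T : HomTree q)
    (R₁ R₂ : T.Trapezoid) (hmeet : (R₁.set ∩ R₂.set).Nonempty)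
    (hw : R₂.width ≤ R₁.width) :
    R₂.set ⊆ R₁.envelope := by
  have hlev : T.lev R₂.root ≤ T.lev R₁.root := by
    by_contra hlt
    push Not at hlt
    refine absurd hw (not_le.mpr ?_)
    unfold Trapezoid.width
    have hq0 : (q : ℝ≥0∞) ≠ 0 := by
      have : q ≠ 0 := by omega
      exact_mod_cast this
    have hqt : (q : ℝ≥0∞) ≠ ⊤ := ENNReal.natCast_ne_top q
    obtain ⟨n, hn⟩ : ∃ n : ℕ, T.lev R₂.root = T.lev R₁.root + ((n + 1 : ℕ) : ℤ) :=
      ⟨(T.lev R₂.root - T.lev R₁.root - 1).toNat, by omega⟩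
    rw [hn, ENNReal.zpow_add hq0 hqt, zpow_natCast]
    have hpos : (q : ℝ≥0∞) ^ (T.lev R₁.root) ≠ 0 := (ENNReal.zpow_pos hq0 hqt _).ne'
    have htop : (q : ℝ≥0∞) ^ (T.lev R₁.root) ≠ ⊤ := (ENNReal.zpow_lt_top hq0 hqt _).ne
    have h1 : (1 : ℝ≥0∞) < (q : ℝ≥0∞) ^ (n + 1) := by
      have : 1 < q ^ (n + 1) := Nat.one_lt_pow (by omega) (by omega)
      exact_mod_cast this
    calc (q : ℝ≥0∞) ^ (T.lev R₁.root) = (q : ℝ≥0∞) ^ (T.lev R₁.root) * 1 := (mul_one _).symm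
      _ < _ := (ENNReal.mul_lt_mul_iff_right hpos htop).mpr h1
  obtain ⟨z, hz1, hz2⟩ := hmeet
  have hp1 := R₁.height_pos
  have hp2 := R₂.height_pos
  intro x hx
  unfold Trapezoid.set at hz1 hz2 hx
  unfold Trapezoid.envelope
  by_cases d1 : R₁.degenerate = true <;> by_cases d2 : R₂.degenerate = true <;>
    simp only [d1, d2, if_true, if_false, Set.mem_singleton_iff, Set.mem_ofPred_eq,
      Bool.false_eq_true] at hz1 hz2 hx ⊢
  · rw [hx, ← hz1, hz2]
  · subst hz1
    omega
  · rw [hx, ← hz2]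
    exact ⟨hz1.1, by omega, by omega⟩
  · have hb := T.below_comparable hz2.1 hz1.1 hlev
    exact ⟨T.below_trans hx.1 hb, by omega, by omega⟩
end

section
/- For each p ∈ (1,∞), there is a constant C_p (depending only on p and q) such that every (1,p)-atom a on the weighted homogeneous tree belongs to the atomic Hardy space H^{1,∞}(μ) with ‖a‖_{H^{1,∞}} ≤ C_p. -/
open scoped ENNReal NNReal
open MeasureTheory Filter

open HomTree

section CZ

lemma cz_holder {ι : Type} (s : Finset ι) (u v : ι → ℝ) (hu : ∀ i ∈ s, 0 ≤ u i)
    (hv : ∀ i ∈ s, 0 ≤ v i) (p : ℝ) (hp : 1 < p) :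
    ∑ i ∈ s, u i ^ (1 - 1/p) * v i ^ (1/p) ≤ (∑ i ∈ s, u i) ^ (1 - 1/p) * (∑ i ∈ s, v i) ^ (1/p) := by
  have hp0 : 0 < p := by linarith
  have h1 : 0 < 1 - 1/p := by
    have : 1/p < 1 := by rw [div_lt_one hp0]; exact hp
    linarith
  have hpq : (1/(1 - 1/p)).HolderConjugate p := by
    rw [Real.holderConjugate_iff]
    refine ⟨?_, ?_⟩
    · rw [lt_div_iff₀ h1]
      have : 0 < 1/p := by positivity
      linarith
    · simp
  have := Real.inner_le_Lp_mul_Lq_of_nonneg s (f := fun i => u i ^ (1 - 1/p))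
    (g := fun i => v i ^ (1/p)) hpq
    (fun i hi => Real.rpow_nonneg (hu i hi) _) (fun i hi => Real.rpow_nonneg (hv i hi) _)
  refine this.trans (le_of_eq ?_)
  have e1 : ∑ i ∈ s, (u i ^ (1 - 1/p)) ^ (1/(1 - 1/p)) = ∑ i ∈ s, u i := by
    refine Finset.sum_congr rfl fun i hi => ?_
    rw [← Real.rpow_mul (hu i hi), mul_one_div_cancel h1.ne', Real.rpow_one]
  have e2 : ∑ i ∈ s, (v i ^ (1/p)) ^ p = ∑ i ∈ s, v i := by
    refine Finset.sum_congr rfl fun i hi => ?_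
    rw [← Real.rpow_mul (hv i hi), one_div_mul_cancel hp0.ne', Real.rpow_one]
  simp only [e1, e2, one_div_one_div]

lemma cz_A_sum {V ι : Type} (A : (V → ℂ) → ℝ → Prop) (A0 : A 0 0)
    (Aadd : ∀ f g c d, A f c → A g d → A (f + g) (c + d)) (s : Finset ι) (F : ι → V → ℂ)
    (c : ι → ℝ) (h : ∀ i ∈ s, A (F i) (c i)) : A (∑ i ∈ s, F i) (∑ i ∈ s, c i) := by
  classical
  induction s using Finset.induction_on with
  | empty => simpa using A0
  | insert i s hi ih =>
    rw [Finset.sum_insert hi, Finset.sum_insert hi]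
    exact Aadd _ _ _ _ (h i (by simp)) (ih fun j hj => h j (by simp [hj]))

lemma cz_select {V : Type} [DecidableEq V] (w : V → ℝ) (hw : ∀ x, 0 < w x) (D : Finset V → Prop)
    (K : ℝ) (hK : 1 ≤ K) (A : (V → ℂ) → ℝ → Prop) (A0 : A 0 0)
    (Aadd : ∀ f g c d, A f c → A g d → A (f + g) (c + d))
    (Amono : ∀ f c d, A f c → c ≤ d → A f d)
    (hne : ∀ Q, D Q → Q.Nonempty)
    (hsplit : ∀ Q, D Q → (∃ x, Q = {x}) ∨ ∃ (ι : Type) (s : Finset ι) (P : ι → Finset V),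
      (s : Set ι).PairwiseDisjoint P ∧ s.biUnion P = Q ∧ ∀ i ∈ s, D (P i) ∧
        (P i).card < Q.card ∧ ∑ x ∈ Q, w x ≤ K * ∑ x ∈ P i, w x)
    (p : ℝ) (hp : 1 < p) (f : V → ℂ) (l : ℝ) (hl : 0 ≤ l) (C : ℝ) (hC : 0 ≤ C) (N : ℕ)
    (IH : ∀ Q, D Q → Q.card < N → A (fun x => if x ∈ Q then
        f x - (∑ y ∈ Q, f y * (w y : ℂ)) / ((∑ y ∈ Q, w y : ℝ) : ℂ) else 0)
      (C * ((∑ x ∈ Q, w x) ^ (1 - 1/p) * (∑ x ∈ Q, ‖f x‖ ^ p * w x) ^ (1/p)))) :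
    ∀ n, ∀ Q, D Q → Q.card ≤ N → Q.card = n → ∑ x ∈ Q, ‖f x‖ * w x ≤ l * ∑ x ∈ Q, w x →
      ∃ (b : V → ℂ) (E : Finset V), E ⊆ Q ∧ (∀ x ∉ Q, b x = 0) ∧ (∀ x ∈ Q, ‖f x - b x‖ ≤ K * l) ∧
        ∑ x ∈ Q, b x * (w x : ℂ) = 0 ∧ l * ∑ x ∈ E, w x ≤ ∑ x ∈ E, ‖f x‖ * w x ∧
        A b (C * ((∑ x ∈ E, w x) ^ (1 - 1/p) * (∑ x ∈ E, ‖f x‖ ^ p * w x) ^ (1/p))) := by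
  intro n
  induction n using Nat.strong_induction_on with
  | _ n ih =>
  intro Q hQ hQN hQn hav
  rcases hsplit Q hQ with ⟨x, rfl⟩ | ⟨ι, s, P, hdisj, hun, hP⟩
  · refine ⟨0, ∅, by simp, by simp, ?_, by simp, by simp, ?_⟩
    · intro y hy
      simp only [Finset.mem_singleton] at hy
      subst hy
      simp only [Finset.sum_singleton] at hav
      have := le_of_mul_le_mul_right hav (hw y)
      simp only [Pi.zero_apply, sub_zero]
      nlinarith
    · refine Amono _ _ _ A0 ?_
      positivity
  · have key : ∀ i ∈ s, ∃ (b : V → ℂ) (E : Finset V), E ⊆ P i ∧ (∀ x ∉ P i, b x = 0) ∧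
        (∀ x ∈ P i, ‖f x - b x‖ ≤ K * l) ∧
        ∑ x ∈ P i, b x * (w x : ℂ) = 0 ∧ l * ∑ x ∈ E, w x ≤ ∑ x ∈ E, ‖f x‖ * w x ∧
        A b (C * ((∑ x ∈ E, w x) ^ (1 - 1/p) * (∑ x ∈ E, ‖f x‖ ^ p * w x) ^ (1/p))) := by
      intro i hi
      obtain ⟨hD, hcard, hm⟩ := hP i hi
      by_cases h : ∑ x ∈ P i, ‖f x‖ * w x ≤ l * ∑ x ∈ P i, w x
      · exact ih _ (hQn ▸ hcard) (P i) hD (by omega) rfl h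
      · push Not at h
        have hmpos : 0 < ∑ x ∈ P i, w x := Finset.sum_pos (fun x _ => hw x) (hne _ hD)
        refine ⟨_, P i, subset_rfl, ?_, ?_, ?_, h.le, IH (P i) hD (by omega)⟩
        · intro x hx; simp [hx]
        · intro x hx
          simp only [hx, if_true, sub_sub_cancel]
          rw [norm_div, Complex.norm_real, Real.norm_of_nonneg hmpos.le, div_le_iff₀ hmpos]
          calc ‖∑ y ∈ P i, f y * (w y : ℂ)‖ ≤ ∑ y ∈ P i, ‖f y‖ * w y := by
                refine (norm_sum_le _ _).trans (le_of_eq ?_)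
                refine Finset.sum_congr rfl fun y _ => ?_
                rw [norm_mul, Complex.norm_real, Real.norm_of_nonneg (hw y).le]
            _ ≤ ∑ y ∈ Q, ‖f y‖ * w y := by
                refine Finset.sum_le_sum_of_subset_of_nonneg ?_ ?_
                · rw [← hun]; exact Finset.subset_biUnion_of_mem P hi
                · intro y _ _; have := (hw y).le; positivity
            _ ≤ l * ∑ x ∈ Q, w x := hav
            _ ≤ l * (K * ∑ x ∈ P i, w x) := by gcongr
            _ = _ := by ring
        · have : ∀ x ∈ P i, (if x ∈ P i then
            f x - (∑ y ∈ P i, f y * (w y : ℂ)) / ((∑ y ∈ P i, w y : ℝ) : ℂ) else 0) * (w x : ℂ)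
            = f x * w x - ((∑ y ∈ P i, f y * (w y : ℂ)) / ((∑ y ∈ P i, w y : ℝ) : ℂ)) * w x := by
            intro x hx; simp only [hx, if_true]; ring
          rw [Finset.sum_congr rfl this, Finset.sum_sub_distrib, ← Finset.mul_sum,
            ← Complex.ofReal_sum, div_mul_cancel₀, sub_self]
          exact_mod_cast hmpos.ne'
    choose! b E hEP hb0 hfb hbm hlE hAb using key
    have hEdisj : (s : Set ι).PairwiseDisjoint E := fun i hi j hj hij =>
      Finset.disjoint_of_subset_left (hEP i hi)
        (Finset.disjoint_of_subset_right (hEP j hj) (hdisj hi hj hij))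
    have hbx : ∀ i ∈ s, ∀ x ∈ P i, (∑ j ∈ s, b j) x = b i x := by
      intro i hi x hx
      rw [Finset.sum_apply]
      refine Finset.sum_eq_single_of_mem i hi ?_
      intro j hj hji
      apply hb0 j hj
      intro hxj
      exact Finset.disjoint_left.1 (hdisj hj hi hji) hxj hx
    refine ⟨∑ i ∈ s, b i, s.biUnion E, ?_, ?_, ?_, ?_, ?_, ?_⟩
    · rw [← hun]
      exact Finset.biUnion_mono hEP
    · intro x hx
      rw [Finset.sum_apply]
      refine Finset.sum_eq_zero fun i hi => hb0 i hi x ?_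
      intro hxi
      exact hx (hun ▸ Finset.mem_biUnion.2 ⟨i, hi, hxi⟩)
    · intro x hx
      rw [← hun, Finset.mem_biUnion] at hx
      obtain ⟨i, hi, hxi⟩ := hx
      rw [hbx i hi x hxi]
      exact hfb i hi x hxi
    · rw [← hun, Finset.sum_biUnion hdisj]
      refine Finset.sum_eq_zero fun i hi => ?_
      rw [← hbm i hi]
      exact Finset.sum_congr rfl fun x hx => by rw [hbx i hi x hx]
    · rw [Finset.sum_biUnion hEdisj, Finset.sum_biUnion hEdisj, Finset.mul_sum]
      exact Finset.sum_le_sum fun i hi => hlE i hi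
    · refine Amono _ _ _ (cz_A_sum A A0 Aadd s b _ hAb) ?_
      rw [← Finset.mul_sum, Finset.sum_biUnion hEdisj, Finset.sum_biUnion hEdisj]
      refine mul_le_mul_of_nonneg_left ?_ hC
      refine cz_holder s _ _ ?_ ?_ p hp
      · intro i _; exact Finset.sum_nonneg fun x _ => (hw x).le
      · intro i _; exact Finset.sum_nonneg fun x _ => by have := (hw x).le; positivity

lemma cz_main {V : Type} [DecidableEq V] (w : V → ℝ) (hw : ∀ x, 0 < w x) (D : Finset V → Prop)
    (K : ℝ) (hK : 1 ≤ K) (B : ℝ) (hB : 0 ≤ B) (A : (V → ℂ) → ℝ → Prop) (A0 : A 0 0)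
    (Aadd : ∀ f g c d, A f c → A g d → A (f + g) (c + d))
    (Amono : ∀ f c d, A f c → c ≤ d → A f d)
    (hne : ∀ Q, D Q → Q.Nonempty)
    (hsplit : ∀ Q, D Q → (∃ x, Q = {x}) ∨ ∃ (ι : Type) (s : Finset ι) (P : ι → Finset V),
      (s : Set ι).PairwiseDisjoint P ∧ s.biUnion P = Q ∧ ∀ i ∈ s, D (P i) ∧
        (P i).card < Q.card ∧ ∑ x ∈ Q, w x ≤ K * ∑ x ∈ P i, w x)
    (hbase : ∀ Q, D Q → ∀ (g : V → ℂ) (M : ℝ), 0 ≤ M → (∀ x ∉ Q, g x = 0) → (∀ x, ‖g x‖ ≤ M) →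
      ∑ x ∈ Q, g x * (w x : ℂ) = 0 → A g (B * (M * ∑ x ∈ Q, w x)))
    (p : ℝ) (hp : 1 < p) (f : V → ℂ) (C : ℝ) (hC : 0 ≤ C)
    (hCe : B * (2 * K + 1) + C * (1/2) ^ (1 - 1/p) ≤ C) :
    ∀ n, ∀ Q, D Q → Q.card = n → A (fun x => if x ∈ Q then
        f x - (∑ y ∈ Q, f y * (w y : ℂ)) / ((∑ y ∈ Q, w y : ℝ) : ℂ) else 0)
      (C * ((∑ x ∈ Q, w x) ^ (1 - 1/p) * (∑ x ∈ Q, ‖f x‖ ^ p * w x) ^ (1/p))) := by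
  intro n
  induction n using Nat.strong_induction_on with
  | _ n ih =>
  intro Q hQ hQn
  have hp0 : 0 < p := by linarith
  have hmpos : 0 < ∑ x ∈ Q, w x := Finset.sum_pos (fun x _ => hw x) (hne _ hQ)
  set m := ∑ x ∈ Q, w x with hm
  set I := ∑ x ∈ Q, ‖f x‖ * w x with hI
  have hI0 : 0 ≤ I := Finset.sum_nonneg fun x _ => by have := (hw x).le; positivity
  have hterm : ∀ x, 0 ≤ ‖f x‖ ^ p * w x := fun x => by have := (hw x).le; positivity
  set J := ∑ x ∈ Q, ‖f x‖ ^ p * w x with hJ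
  have hJ0 : 0 ≤ J := Finset.sum_nonneg fun x _ => hterm x
  have hIJ : I ≤ m ^ (1 - 1/p) * J ^ (1/p) := by
    refine le_trans (le_of_eq ?_) (cz_holder Q w (fun x => ‖f x‖ ^ p * w x)
      (fun x _ => (hw x).le) (fun x _ => hterm x) p hp)
    refine Finset.sum_congr rfl fun x _ => ?_
    rw [Real.mul_rpow (by positivity) (hw x).le, ← Real.rpow_mul (norm_nonneg _),
      mul_one_div_cancel hp0.ne', Real.rpow_one, mul_left_comm, ← Real.rpow_add (hw x)]
    simp
  have hsumI : ‖∑ y ∈ Q, f y * (w y : ℂ)‖ ≤ I := by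
    refine (norm_sum_le _ _).trans (le_of_eq ?_)
    refine Finset.sum_congr rfl fun y _ => ?_
    rw [norm_mul, Complex.norm_real, Real.norm_of_nonneg (hw y).le]
  set av : ℂ := (∑ y ∈ Q, f y * (w y : ℂ)) / (m : ℂ) with hav
  have havn : ‖av‖ ≤ I / m := by
    rw [hav, norm_div, Complex.norm_real, Real.norm_of_nonneg hmpos.le]
    gcongr
  have havm : av * (m : ℂ) = ∑ y ∈ Q, f y * (w y : ℂ) := by
    rw [hav, div_mul_cancel₀]
    exact_mod_cast hmpos.ne'
  obtain ⟨b, E, hEQ, hb0, hfb, hbm, hlE, hAb⟩ := cz_select w hw D K hK A A0 Aadd Amono hne hsplit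
    p hp f (2 * (I / m)) (by positivity) C hC n
    (fun Q' hQ' hc => ih _ hc Q' hQ' rfl) n Q hQ hQn.le hQn (by
      rw [← hm, ← hI]
      have : 2 * (I / m) * m = 2 * I := by field_simp
      rw [this]; linarith)
  have hg := hbase Q hQ (fun x => if x ∈ Q then f x - b x - av else 0) ((2 * K + 1) * (I / m))
    (by positivity) (fun x hx => by simp [hx]) (by
      intro x
      by_cases hx : x ∈ Q
      · simp only [hx, if_true]
        refine (norm_sub_le _ _).trans ?_
        have := hfb x hx
        nlinarith
      · simp only [hx, if_false, norm_zero]; positivity) (by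
      have : ∀ x ∈ Q, (if x ∈ Q then f x - b x - av else 0) * (w x : ℂ)
          = f x * w x - b x * w x - av * w x := by
        intro x hx; simp only [hx, if_true]; ring
      rw [Finset.sum_congr rfl this, Finset.sum_sub_distrib, Finset.sum_sub_distrib, hbm,
        ← Finset.mul_sum, ← Complex.ofReal_sum, ← hm, havm]
      ring)
  have hsum := Aadd _ _ _ _ hg hAb
  have heq : (fun x => if x ∈ Q then f x - b x - av else 0) + b
      = fun x => if x ∈ Q then f x - av else 0 := by
    funext x
    by_cases hx : x ∈ Q
    · simp only [Pi.add_apply, hx, if_true]; ring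
    · simp [hx, hb0 x hx]
  rw [heq] at hsum
  refine Amono _ _ _ hsum ?_
  rw [← hm]
  have e1 : B * ((2 * K + 1) * (I / m) * m) = B * (2 * K + 1) * I := by field_simp
  rw [e1]
  have hE0 : 0 ≤ ∑ x ∈ E, w x := Finset.sum_nonneg fun x _ => (hw x).le
  have hEJ : ∑ x ∈ E, ‖f x‖ ^ p * w x ≤ J :=
    Finset.sum_le_sum_of_subset_of_nonneg hEQ fun x _ _ => hterm x
  have hEJ0 : 0 ≤ ∑ x ∈ E, ‖f x‖ ^ p * w x := Finset.sum_nonneg fun x _ => hterm x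
  have h1p : 0 ≤ 1 - 1/p := by
    have : 1/p ≤ 1 := by rw [div_le_one hp0]; exact hp.le
    linarith
  have hE : (∑ x ∈ E, w x) ^ (1 - 1/p) * (∑ x ∈ E, ‖f x‖ ^ p * w x) ^ (1/p)
      ≤ (1/2) ^ (1 - 1/p) * (m ^ (1 - 1/p) * J ^ (1/p)) := by
    rcases hI0.eq_or_lt with h0 | hpos
    · have : ∀ x ∈ E, ‖f x‖ ^ p * w x = 0 := by
        intro x hx
        have h3 := (Finset.sum_eq_zero_iff_of_nonneg (fun x _ => by
          have := (hw x).le; positivity)).1 (hI.symm.trans h0.symm) x (hEQ hx)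
        have h2 : ‖f x‖ = 0 := by
          rcases mul_eq_zero.1 h3 with h | h
          · exact h
          · exact absurd h (hw x).ne'
        rw [h2, Real.zero_rpow hp0.ne', zero_mul]
      rw [Finset.sum_eq_zero this, Real.zero_rpow (by positivity), mul_zero]
      positivity
    · have hEm : ∑ x ∈ E, w x ≤ 1/2 * m := by
        have hEI : ∑ x ∈ E, ‖f x‖ * w x ≤ I :=
          Finset.sum_le_sum_of_subset_of_nonneg hEQ fun x _ _ => by
            have := (hw x).le; positivity
        have h4 := hlE.trans hEI
        have h5 : 2 * (I / m) * ∑ x ∈ E, w x = I * (2 * (∑ x ∈ E, w x) / m) := by ring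
        rw [h5] at h4
        have h6 : 2 * (∑ x ∈ E, w x) / m ≤ 1 := by
          by_contra hcon
          push Not at hcon
          nlinarith
        rw [div_le_one hmpos] at h6
        linarith
      rw [← mul_assoc, ← Real.mul_rpow (by norm_num) hmpos.le]
      gcongr
  have hX0 : 0 ≤ m ^ (1 - 1/p) * J ^ (1/p) := by positivity
  calc _ ≤ B * (2 * K + 1) * (m ^ (1 - 1/p) * J ^ (1/p))
        + C * ((1/2) ^ (1 - 1/p) * (m ^ (1 - 1/p) * J ^ (1/p))) := by gcongr
    _ = (B * (2 * K + 1) + C * (1/2) ^ (1 - 1/p)) * (m ^ (1 - 1/p) * J ^ (1/p)) := by ring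
    _ ≤ _ := by gcongr

end CZ
namespace HomTree

variable {q : ℕ}

noncomputable def par (T : HomTree q) (v : T.V) : T.V := (T.unique_above v).choose

lemma par_adj (T : HomTree q) (v : T.V) : T.G.Adj v (T.par v) := (T.unique_above v).choose_spec.1.1

lemma par_lev (T : HomTree q) (v : T.V) : T.lev (T.par v) = T.lev v + 1 :=
  (T.unique_above v).choose_spec.1.2

lemma par_eq (T : HomTree q) {v w : T.V} (h : T.G.Adj v w) (h2 : T.lev w = T.lev v + 1) :
    T.par v = w := ((T.unique_above v).choose_spec.2 w ⟨h, h2⟩).symm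

lemma par_iter_lev (T : HomTree q) (d : ℕ) (v : T.V) : T.lev (T.par^[d] v) = T.lev v + d := by
  induction d with
  | zero => simp
  | succ d ih => rw [Function.iterate_succ_apply', par_lev, ih]; push_cast; ring

lemma walk_lev (T : HomTree q) {x y : T.V} (W : T.G.Walk x y) :
    T.lev y ≤ T.lev x + W.length ∧ (T.lev y = T.lev x + W.length → T.par^[W.length] x = y) := by
  induction W with
  | nil => simp
  | @cons u v z h W ih =>
    rw [SimpleGraph.Walk.length_cons]
    push_cast
    have := T.lev_adj u v h
    refine ⟨by rcases this with h | h <;> omega, fun he => ?_⟩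
    have h1 : T.lev v = T.lev u + 1 := by rcases this with h | h <;> omega
    rw [Function.iterate_succ_apply, T.par_eq h h1]
    exact ih.2 (by omega)

lemma dist_iter_le (T : HomTree q) (d : ℕ) (x : T.V) : T.G.dist x (T.par^[d] x) ≤ d := by
  induction d with
  | zero => simp
  | succ d ih =>
    rw [Function.iterate_succ_apply']
    have h1 := T.conn.dist_triangle (u := x) (v := T.par^[d] x) (w := T.par (T.par^[d] x))
    have h2 : T.G.dist (T.par^[d] x) (T.par (T.par^[d] x)) = 1 :=
      SimpleGraph.dist_eq_one_iff_adj.2 (T.par_adj _)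
    omega

lemma below_iff (T : HomTree q) (x v : T.V) : T.below x v ↔ ∃ d : ℕ, T.par^[d] x = v := by
  unfold below dist
  obtain ⟨W, hW⟩ := T.conn.exists_walk_length_eq_dist x v
  have h := T.walk_lev W
  rw [hW] at h
  constructor
  · intro hb
    exact ⟨_, h.2 (by omega)⟩
  · rintro ⟨d, rfl⟩
    have h1 := T.dist_iter_le d x
    have h2 := T.par_iter_lev d x
    omega

lemma children_finite (T : HomTree q) (v : T.V) : {x | T.par x = v}.Finite := by
  have : (T.G.neighborSet v).Finite := Set.finite_of_ncard_ne_zero (by rw [T.degree]; omega)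
  refine this.subset ?_
  rintro x rfl
  exact (T.par_adj x).symm

noncomputable def children (T : HomTree q) (v : T.V) : Finset T.V := (T.children_finite v).toFinset

lemma mem_children (T : HomTree q) (v x : T.V) : x ∈ T.children v ↔ T.par x = v := by
  simp [children]

lemma children_card (T : HomTree q) (v : T.V) : (T.children v).card = q := by
  classical
  have h1 : T.G.neighborSet v = insert (T.par v) (T.children v : Set T.V) := by
    ext x
    simp only [SimpleGraph.mem_neighborSet, Set.mem_insert_iff, Finset.mem_coe, mem_children]
    constructor
    · intro h
      rcases T.lev_adj v x h with h' | h'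
      · left; exact (T.par_eq h h').symm
      · right; exact T.par_eq h.symm (by omega)
    · rintro (rfl | rfl)
      · exact T.par_adj v
      · exact (T.par_adj x).symm
  have h2 := T.degree v
  rw [h1, ← Finset.coe_insert, Set.ncard_coe_finset, Finset.card_insert_of_notMem] at h2
  · omega
  · rw [mem_children]
    intro h
    have h3 := T.par_lev (T.par v)
    have h4 := T.par_lev v
    rw [h] at h3
    omega

noncomputable def wt (T : HomTree q) (x : T.V) : ℝ := (q : ℝ) ^ (T.lev x)

open Classical in
noncomputable def desc (T : HomTree q) : ℕ → T.V → Finset T.V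
  | 0, v => {v}
  | d + 1, v => (T.children v).biUnion (fun w => T.desc d w)

lemma mem_desc (T : HomTree q) (d : ℕ) (v x : T.V) : x ∈ T.desc d v ↔ T.par^[d] x = v := by
  induction d generalizing v with
  | zero => simp [desc]
  | succ d ih =>
    simp only [desc, Finset.mem_biUnion, ih, Function.iterate_succ_apply', mem_children]
    simp

open Classical in
noncomputable def trap (T : HomTree q) (v : T.V) (a b : ℕ) : Finset T.V :=
  (Finset.Ico a b).biUnion (fun d => T.desc d v)

lemma mem_trap (T : HomTree q) (v x : T.V) (a b : ℕ) :
    x ∈ T.trap v a b ↔ ∃ d, (a ≤ d ∧ d < b) ∧ T.par^[d] x = v := by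
  simp [trap, mem_desc]

lemma desc_disj (T : HomTree q) (d : ℕ) (s : Set T.V) : s.PairwiseDisjoint (fun w => T.desc d w) := by
  intro i _ j _ hij
  refine Finset.disjoint_left.2 fun x hx hx' => hij ?_
  rw [mem_desc] at hx hx'
  rw [← hx, hx']

lemma wt_sum_desc (hq : 2 ≤ q) (T : HomTree q) (d : ℕ) (v : T.V) :
    ∑ x ∈ T.desc d v, T.wt x = (q : ℝ) ^ (T.lev v) := by
  classical
  have hq0 : (q : ℝ) ≠ 0 := by positivity
  induction d generalizing v with
  | zero => simp [desc, wt]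
  | succ d ih =>
    have : T.desc (d + 1) v = (T.children v).biUnion (fun w => T.desc d w) := by
      ext x; simp [desc]
    rw [this, Finset.sum_biUnion (T.desc_disj d _)]
    have h2 : ∀ x ∈ T.children v, ∑ y ∈ T.desc d x, T.wt y = (q : ℝ) ^ (T.lev v - 1) := by
      intro x hx
      rw [mem_children] at hx
      rw [ih, ← hx, par_lev]; simp
    rw [Finset.sum_congr rfl h2, Finset.sum_const, children_card, nsmul_eq_mul,
      zpow_sub_one₀ hq0]
    field_simp

lemma wt_sum_trap (hq : 2 ≤ q) (T : HomTree q) (v : T.V) (a b : ℕ) (hab : a ≤ b) :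
    ∑ x ∈ T.trap v a b, T.wt x = ((b : ℝ) - a) * (q : ℝ) ^ (T.lev v) := by
  classical
  have : T.trap v a b = (Finset.Ico a b).biUnion (fun d => T.desc d v) := by
    ext x; simp [trap]
  rw [this, Finset.sum_biUnion]
  · simp only [wt_sum_desc hq, Finset.sum_const, Nat.card_Ico, nsmul_eq_mul, Nat.cast_sub hab]
  · intro i _ j _ hij
    refine Finset.disjoint_left.2 fun x hx hx' => hij ?_
    rw [mem_desc] at hx hx'
    have h1 := T.par_iter_lev i x
    have h2 := T.par_iter_lev j x
    rw [hx] at h1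
    rw [hx'] at h2
    omega

/-- the dyadic family -/
def DD (T : HomTree q) (Q : Finset T.V) : Prop :=
  (∃ x, Q = {x}) ∨ ∃ (v : T.V) (a b : ℕ), 1 ≤ a ∧ 2 * a ≤ b ∧ b ≤ 8 * a ∧ Q = T.trap v a b

lemma wt_pos (hq : 2 ≤ q) (T : HomTree q) (x : T.V) : 0 < T.wt x := by
  unfold wt; positivity

lemma DD_ne (hq : 2 ≤ q) (T : HomTree q) (Q : Finset T.V) (h : T.DD Q) : Q.Nonempty := by
  rcases h with ⟨x, rfl⟩ | ⟨v, a, b, h1, h2, h3, rfl⟩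
  · simp
  · rw [Finset.nonempty_iff_ne_empty]
    intro h
    have := wt_sum_trap hq T v a b (by omega)
    rw [h, Finset.sum_empty] at this
    have hb : (a : ℝ) < b := by exact_mod_cast (by omega : a < b)
    have hl : (0 : ℝ) < (q : ℝ) ^ (T.lev v) := by positivity
    nlinarith

lemma card_lt_of_wt (hq : 2 ≤ q) (T : HomTree q) (Q Q' : Finset T.V) (h : Q' ⊆ Q)
    (hlt : ∑ x ∈ Q', T.wt x < ∑ x ∈ Q, T.wt x) : Q'.card < Q.card := by
  refine Finset.card_lt_card (h.ssubset_of_ne ?_)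
  rintro rfl
  exact lt_irrefl _ hlt

lemma DD_split (hq : 2 ≤ q) (T : HomTree q) [DecidableEq T.V] (Q : Finset T.V) (h : T.DD Q) :
    (∃ x, Q = {x}) ∨ ∃ (ι : Type) (s : Finset ι) (P : ι → Finset T.V),
      (s : Set ι).PairwiseDisjoint P ∧ s.biUnion P = Q ∧ ∀ i ∈ s, T.DD (P i) ∧
        (P i).card < Q.card ∧ ∑ x ∈ Q, T.wt x ≤ (7 * (q : ℝ) ^ 2) * ∑ x ∈ P i, T.wt x := by
  rcases h with h | ⟨v, a, b, h1, h2, h3, rfl⟩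
  · exact Or.inl h
  right
  have hq2 : (2 : ℝ) ≤ q := by exact_mod_cast hq
  have hq0 : (q : ℝ) ≠ 0 := by positivity
  have hl : (0 : ℝ) < (q : ℝ) ^ (T.lev v) := by positivity
  have hm := wt_sum_trap hq T v a b (by omega)
  have ha1 : (1 : ℝ) ≤ a := by exact_mod_cast h1
  have hb2 : 2 * (a : ℝ) ≤ b := by exact_mod_cast h2
  have hb8 : (b : ℝ) ≤ 8 * a := by exact_mod_cast h3
  have hqq : (4 : ℝ) ≤ (q : ℝ) ^ 2 := by nlinarith
  suffices H : ∃ (ι : Type) (s : Finset ι) (P : ι → Finset T.V),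
      (s : Set ι).PairwiseDisjoint P ∧ s.biUnion P = T.trap v a b ∧ ∀ i ∈ s, T.DD (P i) ∧
        ∑ x ∈ P i, T.wt x < ∑ x ∈ T.trap v a b, T.wt x ∧
        ∑ x ∈ T.trap v a b, T.wt x ≤ (7 * (q : ℝ) ^ 2) * ∑ x ∈ P i, T.wt x by
    obtain ⟨ι, s, P, hd, hu, hP⟩ := H
    refine ⟨ι, s, P, hd, hu, fun i hi => ⟨(hP i hi).1, ?_, (hP i hi).2.2⟩⟩
    exact card_lt_of_wt hq T _ _ (hu ▸ Finset.subset_biUnion_of_mem P hi) (hP i hi).2.1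
  by_cases h4 : 4 * a ≤ b
  · -- vertical split
    have hb4 : 4 * (a : ℝ) ≤ b := by exact_mod_cast h4
    refine ⟨Bool, Finset.univ, fun i => if i then T.trap v a (2 * a) else T.trap v (2 * a) b,
      ?_, ?_, ?_⟩
    · have hdis : Disjoint (T.trap v a (2 * a)) (T.trap v (2 * a) b) := by
        refine Finset.disjoint_left.2 fun x hx hx' => ?_
        rw [mem_trap] at hx hx'
        obtain ⟨i, hi, hix⟩ := hx
        obtain ⟨j, hj, hjx⟩ := hx'
        have e1 := T.par_iter_lev i x
        have e2 := T.par_iter_lev j x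
        rw [hix] at e1
        rw [hjx] at e2
        omega
      intro i _ j _ hij
      cases i <;> cases j <;> simp_all [Function.onFun]
      exact hdis.symm
    · ext x
      simp only [Finset.mem_biUnion, Finset.mem_univ, true_and, Bool.exists_bool, if_true,
        Bool.false_eq_true, if_false, mem_trap]
      constructor
      · rintro (⟨d, hd, hx⟩ | ⟨d, hd, hx⟩)
        · exact ⟨d, by omega, hx⟩
        · exact ⟨d, by omega, hx⟩
      · rintro ⟨d, hd, hx⟩
        by_cases hh : d < 2 * a
        · right; exact ⟨d, by omega, hx⟩
        · left; exact ⟨d, by omega, hx⟩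
    · intro i _
      rw [hm]
      cases i
      · simp only [Bool.false_eq_true, if_false]
        rw [wt_sum_trap hq T v (2 * a) b (by omega)]
        push_cast
        refine ⟨Or.inr ⟨v, 2 * a, b, by omega, by omega, by omega, rfl⟩, ?_, ?_⟩
        · nlinarith
        · rw [← mul_assoc]
          refine mul_le_mul_of_nonneg_right ?_ hl.le
          nlinarith
      · simp only [if_true]
        rw [wt_sum_trap hq T v a (2 * a) (by omega)]
        push_cast
        refine ⟨Or.inr ⟨v, a, 2 * a, by omega, by omega, by omega, rfl⟩, ?_, ?_⟩
        · nlinarith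
        · rw [← mul_assoc]
          refine mul_le_mul_of_nonneg_right ?_ hl.le
          nlinarith
  · by_cases ha : 2 ≤ a
    · -- horizontal split
      refine ⟨T.V, T.children v, fun u => T.trap u (a - 1) (b - 1), ?_, ?_, ?_⟩
      · intro i hi j hj hij
        refine Finset.disjoint_left.2 fun x hx hx' => hij ?_
        rw [mem_trap] at hx hx'
        obtain ⟨d, hd, hix⟩ := hx
        obtain ⟨e, he, hjx⟩ := hx'
        have e1 := T.par_iter_lev d x
        have e2 := T.par_iter_lev e x
        rw [Finset.mem_coe, mem_children] at hi hj
        have e3 := T.par_lev i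
        have e4 := T.par_lev j
        rw [hi] at e3
        rw [hj] at e4
        rw [hix] at e1
        rw [hjx] at e2
        have : d = e := by omega
        subst this
        rw [← hix, hjx]
      · ext x
        simp only [Finset.mem_biUnion, mem_children, mem_trap]
        constructor
        · rintro ⟨u, hu, d, hd, hx⟩
          refine ⟨d + 1, by omega, ?_⟩
          rw [Function.iterate_succ_apply', hx, hu]
        · rintro ⟨d, hd, hx⟩
          obtain ⟨d, rfl⟩ : ∃ e, d = e + 1 := ⟨d - 1, by omega⟩
          rw [Function.iterate_succ_apply'] at hx
          exact ⟨_, hx, d, by omega, rfl⟩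
      · intro u hu
        rw [mem_children] at hu
        have e3 := T.par_lev u
        rw [hu] at e3
        refine ⟨Or.inr ⟨u, a - 1, b - 1, by omega, by omega, by omega, rfl⟩, ?_⟩
        rw [hm, wt_sum_trap hq T u (a - 1) (b - 1) (by omega), Nat.cast_sub (by omega),
          Nat.cast_sub (by omega), e3, zpow_add_one₀ hq0]
        have hu0 : (0 : ℝ) < (q : ℝ) ^ (T.lev u) := by positivity
        have hX : (0 : ℝ) < ((b : ℝ) - a) * (q : ℝ) ^ (T.lev u) := by
          apply mul_pos _ hu0; linarith
        have e5 : ((b : ℝ) - (1 : ℕ) - (a - (1 : ℕ))) = b - a := by push_cast; ring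
        rw [e5]
        set X := ((b : ℝ) - a) * (q : ℝ) ^ (T.lev u)
        have e6 : ((b : ℝ) - a) * ((q : ℝ) ^ (T.lev u) * q) = q * X := by ring
        rw [e6]
        exact ⟨by nlinarith, mul_le_mul_of_nonneg_right (by nlinarith) hX.le⟩
    · have ha' : a = 1 := by omega
      subst ha'
      refine ⟨T.V, T.trap v 1 b, fun x => {x}, ?_, ?_, ?_⟩
      · intro i _ j _ hij
        simpa [Function.onFun] using hij
      · ext x; simp
      · intro x hx
        refine ⟨Or.inl ⟨x, rfl⟩, ?_⟩
        rw [hm, Finset.sum_singleton]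
        rw [mem_trap] at hx
        obtain ⟨d, hd, hx⟩ := hx
        have e1 := T.par_iter_lev d x
        rw [hx] at e1
        have hb3 : (b : ℝ) ≤ 3 := by exact_mod_cast (by omega : b ≤ 3)
        have hw := wt_pos hq T x
        have hd12 : d = 1 ∨ d = 2 := by omega
        have e7 : (q : ℝ) ^ (T.lev v) = T.wt x * q ^ d := by
          rw [e1, zpow_add₀ hq0, wt, zpow_natCast]
        rw [e7]
        push_cast at *
        set W := T.wt x
        have hd1 : (2 : ℝ) ≤ (q : ℝ) ^ d ∧ (q : ℝ) ^ d ≤ (q : ℝ) ^ 2 := by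
          rcases hd12 with rfl | rfl
          · constructor <;> nlinarith
          · constructor <;> nlinarith
        obtain ⟨hd1, hd2⟩ := hd1
        set Z := (q : ℝ) ^ d
        constructor
        · have : 2 * W ≤ W * Z := by nlinarith
          nlinarith
        · have : W * Z ≤ W * q ^ 2 := by nlinarith
          nlinarith

end HomTree
namespace HomTree

variable {q : ℕ}

lemma env_eq (T : HomTree q) (R : T.Trapezoid) (h : R.degenerate = false) :
    R.envelope = (T.trap R.root ((R.height + 1) / 2) (4 * R.height) : Set T.V) := by
  ext x
  simp only [Trapezoid.envelope, h, Bool.false_eq_true, if_false, Set.mem_ofPred_eq, Finset.mem_coe,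
    mem_trap, below_iff]
  constructor
  · rintro ⟨⟨d, hd⟩, h1, h2⟩
    have e := T.par_iter_lev d x
    rw [hd] at e
    exact ⟨d, by omega, hd⟩
  · rintro ⟨d, h1, hd⟩
    have e := T.par_iter_lev d x
    rw [hd] at e
    exact ⟨⟨d, hd⟩, by omega, by omega⟩

lemma env_deg (T : HomTree q) (R : T.Trapezoid) (h : R.degenerate = true) :
    R.envelope = (({R.root} : Finset T.V) : Set T.V) := by
  simp [Trapezoid.envelope, h]

lemma env_DD (T : HomTree q) (R : T.Trapezoid) : ∃ Q : Finset T.V, R.envelope = (Q : Set T.V) ∧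
    T.DD Q := by
  cases h : R.degenerate
  · have := R.height_pos
    exact ⟨_, T.env_eq R h, Or.inr ⟨_, _, _, by omega, by omega, by omega, rfl⟩⟩
  · exact ⟨_, T.env_deg R h, Or.inl ⟨_, rfl⟩⟩

lemma DD_env (hq : 2 ≤ q) (T : HomTree q) (Q : Finset T.V) (hQ : T.DD Q) :
    ∃ (R : T.Trapezoid) (Q' : Finset T.V), R.envelope = (Q' : Set T.V) ∧ T.DD Q' ∧ Q ⊆ Q' ∧
      ∑ x ∈ Q', T.wt x ≤ 7 * ∑ x ∈ Q, T.wt x := by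
  rcases hQ with ⟨x, rfl⟩ | ⟨v, a, b, h1, h2, h3, rfl⟩
  · refine ⟨⟨x, 1, true, le_rfl, fun _ => rfl⟩, {x}, T.env_deg _ rfl, Or.inl ⟨x, rfl⟩,
      subset_rfl, ?_⟩
    have := wt_pos hq T x
    simp only [Finset.sum_singleton]
    linarith
  · refine ⟨⟨v, 2 * a, false, by omega, fun h => by simp at h⟩, T.trap v a (8 * a), ?_,
      Or.inr ⟨v, a, 8 * a, by omega, by omega, by omega, rfl⟩, ?_, ?_⟩
    · rw [T.env_eq _ rfl]
      simp only
      congr 2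
      · omega
      · omega
    · intro x
      simp only [mem_trap]
      rintro ⟨d, hd, hx⟩
      exact ⟨d, by omega, hx⟩
    · rw [wt_sum_trap hq T v a b (by omega), wt_sum_trap hq T v a (8 * a) (by omega), ← mul_assoc]
      refine mul_le_mul_of_nonneg_right ?_ (by positivity)
      have hb2 : 2 * (a : ℝ) ≤ b := by exact_mod_cast h2
      push_cast
      linarith

lemma ofReal_wt (hq : 2 ≤ q) (T : HomTree q) (x : T.V) :
    (q : ℝ≥0∞) ^ (T.lev x) = ENNReal.ofReal (T.wt x) := by
  have h : (0 : ℝ) < (q : ℝ) := by positivity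
  have h' : (q : ℝ≥0∞) = ENNReal.ofReal (q : ℝ) := (ENNReal.ofReal_natCast q).symm
  unfold wt
  rw [h']
  cases T.lev x with
  | ofNat n => simp [ENNReal.ofReal_pow]
  | negSucc n =>
    rw [zpow_negSucc, zpow_negSucc, ENNReal.ofReal_inv_of_pos (by positivity),
      ENNReal.ofReal_pow h.le]

lemma mu_finset (hq : 2 ≤ q) (T : HomTree q) (Q : Finset T.V) :
    T.mu (Q : Set T.V) = ENNReal.ofReal (∑ x ∈ Q, T.wt x) := by
  unfold mu
  rw [ENNReal.ofReal_sum_of_nonneg fun x _ => (wt_pos hq T x).le]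
  simp only [ofReal_wt hq]
  exact Finset.tsum_subtype' Q (fun x => ENNReal.ofReal (T.wt x))

lemma cwt (T : HomTree q) (x : T.V) : (q : ℂ) ^ (T.lev x) = ((T.wt x : ℝ) : ℂ) := by
  simp [wt]

lemma int_finset (T : HomTree q) (Q : Finset T.V) (a : T.V → ℂ) (h : ∀ x ∉ Q, a x = 0) :
    ∑' x : T.V, a x * (q : ℂ) ^ (T.lev x) = ∑ x ∈ Q, a x * ((T.wt x : ℝ) : ℂ) := by
  simp only [cwt]
  exact tsum_eq_sum fun x hx => by simp [h x hx]

lemma lpPow_finset (hq : 2 ≤ q) (T : HomTree q) (Q : Finset T.V) (a : T.V → ℂ)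
    (h : ∀ x ∉ Q, a x = 0) (p : ℝ) (hp : 1 < p) :
    T.lpPow a p = ENNReal.ofReal (∑ x ∈ Q, ‖a x‖ ^ p * T.wt x) := by
  unfold lpPow
  rw [ENNReal.ofReal_sum_of_nonneg fun x _ => by have := (wt_pos hq T x).le; positivity]
  rw [tsum_eq_sum (s := Q)]
  · refine Finset.sum_congr rfl fun x _ => ?_
    rw [ofReal_wt hq, ENNReal.ofReal_mul (by positivity), ← ENNReal.ofReal_rpow_of_nonneg
      (norm_nonneg _) (by linarith), ofReal_norm]
    rfl
  · intro x hx
    rw [h x hx]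
    simp [show 0 < p by linarith]

def Dec (T : HomTree q) (f : T.V → ℂ) (C : ℝ) : Prop :=
  ∃ (n : ℕ) (c : Fin n → ℂ) (a : Fin n → T.V → ℂ), (∀ i, T.IsInftyAtom (a i)) ∧
    (∀ x, f x = ∑ i, c i * a i x) ∧ ∑ i, ‖c i‖ ≤ C

lemma Dec_zero (T : HomTree q) : T.Dec 0 0 :=
  ⟨0, fun _ => 0, fun _ _ => 0, fun i => i.elim0, by simp, by simp⟩

lemma Dec_add (T : HomTree q) (f g : T.V → ℂ) (c d : ℝ) (hf : T.Dec f c) (hg : T.Dec g d) :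
    T.Dec (f + g) (c + d) := by
  obtain ⟨n, c1, a1, h1, h2, h3⟩ := hf
  obtain ⟨m, c2, a2, k1, k2, k3⟩ := hg
  refine ⟨n + m, Fin.append c1 c2, Fin.append a1 a2, ?_, ?_, ?_⟩
  · intro i
    refine Fin.addCases (fun i => ?_) (fun i => ?_) i
    · rw [Fin.append_left]; exact h1 i
    · rw [Fin.append_right]; exact k1 i
  · intro x
    rw [Fin.sum_univ_add]
    simp only [Fin.append_left, Fin.append_right, Pi.add_apply, h2, k2]
  · rw [Fin.sum_univ_add]
    simp only [Fin.append_left, Fin.append_right]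
    linarith

lemma zero_atom (T : HomTree q) : T.IsInftyAtom 0 :=
  ⟨⟨T.geo 0, 1, true, le_rfl, fun _ => rfl⟩, by simp, by simp, by simp⟩

lemma Dec_base (hq : 2 ≤ q) (T : HomTree q) (Q : Finset T.V) (hQ : T.DD Q) (g : T.V → ℂ) (M : ℝ)
    (hM : 0 ≤ M) (hs : ∀ x ∉ Q, g x = 0) (hb : ∀ x, ‖g x‖ ≤ M)
    (hi : ∑ x ∈ Q, g x * ((T.wt x : ℝ) : ℂ) = 0) : T.Dec g (7 * (M * ∑ x ∈ Q, T.wt x)) := by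
  rcases hM.eq_or_lt with h0 | hpos
  · have : g = 0 := by
      funext x
      have := hb x
      rw [← h0] at this
      simpa using this
    rw [this, ← h0]
    simpa using T.Dec_zero
  obtain ⟨R, Q', hR, hQ', hsub, hm⟩ := DD_env hq T Q hQ
  have hm0 : 0 < ∑ x ∈ Q', T.wt x := Finset.sum_pos (fun x _ => wt_pos hq T x) (DD_ne hq T Q' hQ')
  set m := ∑ x ∈ Q', T.wt x with hmdef
  have hMm : 0 < M * m := by positivity
  have hMmc : ((M * m : ℝ) : ℂ) ≠ 0 := by exact_mod_cast hMm.ne'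
  refine ⟨1, fun _ => ((M * m : ℝ) : ℂ), fun _ x => ((M * m : ℝ) : ℂ)⁻¹ * g x, ?_, ?_, ?_⟩
  · intro _
    refine ⟨R, ?_, ?_, ?_⟩
    · intro x hx
      rw [hR]
      rw [Function.mem_support] at hx
      by_contra hx'
      apply hx
      simp [hs x (fun h => hx' (hsub h))]
    · intro x
      rw [hR, mu_finset hq, ← hmdef, ← ENNReal.ofReal_inv_of_pos hm0]
      change ‖((M * m : ℝ) : ℂ)⁻¹ * g x‖ₑ ≤ _
      rw [← ofReal_norm]
      apply ENNReal.ofReal_le_ofReal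
      rw [norm_mul, norm_inv, Complex.norm_real, Real.norm_of_nonneg hMm.le]
      calc (M * m)⁻¹ * ‖g x‖ ≤ (M * m)⁻¹ * M := by gcongr; exact hb x
        _ = m⁻¹ := by field_simp
    · rw [T.int_finset Q _ (fun x hx => by simp [hs x hx])]
      simp only [mul_assoc]
      rw [← Finset.mul_sum, hi, mul_zero]
  · intro x
    simp only [Finset.univ_unique, Finset.sum_const, Finset.card_singleton, one_smul]
    rw [mul_inv_cancel_left₀ hMmc]
  · simp only [Finset.univ_unique, Finset.sum_const, Finset.card_singleton, one_smul]
    rw [Complex.norm_real, Real.norm_of_nonneg hMm.le]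
    nlinarith

lemma Dec_H1 (T : HomTree q) (f : T.V → ℂ) (C : ℝ) (h : T.Dec f C) :
    T.InH1 f ∧ T.H1Norm f ≤ ENNReal.ofReal C := by
  obtain ⟨n, c, a, h1, h2, h3⟩ := h
  let c' : ℕ → ℂ := fun k => if h : k < n then c ⟨k, h⟩ else 0
  let a' : ℕ → T.V → ℂ := fun k => if h : k < n then a ⟨k, h⟩ else 0
  have hc0 : ∀ k ∉ Finset.range n, c' k = 0 := by
    intro k hk
    simp only [Finset.mem_range] at hk
    simp [c', hk]
  have ha' : ∀ k, T.IsInftyAtom (a' k) := by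
    intro k
    by_cases hk : k < n
    · simp only [a', hk, dif_pos]; exact h1 _
    · simp only [a', hk, dif_neg, not_false_iff]; exact T.zero_atom
  have hs : ∀ x, HasSum (fun k => c' k * a' k x) (f x) := by
    intro x
    have : HasSum (fun k => c' k * a' k x) (∑ k ∈ Finset.range n, c' k * a' k x) :=
      hasSum_sum_of_ne_finset_zero (fun k hk => by rw [hc0 k hk, zero_mul])
    convert this using 1
    rw [h2, Finset.sum_range]
    refine Finset.sum_congr rfl fun i _ => ?_
    simp [c', a']
  refine ⟨⟨c', a', ha', ?_, hs⟩, ?_⟩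
  · exact summable_of_ne_finset_zero (s := Finset.range n) fun k hk => by rw [hc0 k hk, norm_zero]
  · unfold H1Norm
    refine iInf_le_of_le c' (iInf_le_of_le a' (iInf_le_of_le ⟨ha', hs⟩ ?_))
    rw [tsum_eq_sum (s := Finset.range n) fun k hk => by rw [hc0 k hk]; simp]
    refine le_trans (le_of_eq ?_) (ENNReal.ofReal_le_ofReal h3)
    rw [ENNReal.ofReal_sum_of_nonneg fun _ _ => norm_nonneg _, Finset.sum_range]
    refine Finset.sum_congr rfl fun i _ => ?_
    rw [ofReal_norm]
    simp [c']
    rfl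

end HomTree

/-- for each `p ∈ (1,∞)` there is a constant `C_p`, depending only on
`p` and `q`, such that every `(1,p)`-atom belongs to `H^{1,∞}(μ)` with
`‖a‖_{H^{1,∞}} ≤ C_p`. -/
theorem atom_in_H1infty {q : ℕ} (hq : 2 ≤ q) (p : ℝ) (hp : 1 < p) :
    ∃ C : ℝ≥0, 0 < C ∧ ∀ (T : HomTree q) (a : T.V → ℂ), T.IspAtom p a →
      T.InH1 a ∧ T.H1Norm a ≤ (C : ℝ≥0∞) := by
  classical
  have hp0 : 0 < p := by linarith
  have h1p : 0 < 1 - 1/p := by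
    have : 1/p < 1 := by rw [div_lt_one hp0]; exact hp
    linarith
  set θ : ℝ := (1/2 : ℝ) ^ (1 - 1/p) with hθ
  have hθ1 : θ < 1 := Real.rpow_lt_one (by norm_num) (by norm_num) h1p
  set K : ℝ := 7 * (q : ℝ) ^ 2 with hK
  have hq2 : (2 : ℝ) ≤ q := by exact_mod_cast hq
  have hK1 : 1 ≤ K := by nlinarith
  set C : ℝ := 7 * (2 * K + 1) / (1 - θ) with hC
  have h1θ : 0 < 1 - θ := by linarith
  have hC0 : 0 < C := by positivity
  have hCe : 7 * (2 * K + 1) + C * θ ≤ C := by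
    have : C * (1 - θ) = 7 * (2 * K + 1) := by rw [hC]; field_simp
    linarith
  refine ⟨C.toNNReal, Real.toNNReal_pos.2 hC0, fun T a ha => ?_⟩
  obtain ⟨R, hsupp, hlp, hmean⟩ := ha
  obtain ⟨Q, hRQ, hQ⟩ := T.env_DD R
  have hs : ∀ x ∉ Q, a x = 0 := by
    intro x hx
    by_contra h
    exact hx (by simpa [hRQ] using hsupp (Function.mem_support.2 h))
  rw [T.int_finset Q a hs] at hmean
  have hm0 : 0 < ∑ x ∈ Q, T.wt x := Finset.sum_pos (fun x _ => wt_pos hq T x) (DD_ne hq T Q hQ)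
  have hJ0 : 0 ≤ ∑ x ∈ Q, ‖a x‖ ^ p * T.wt x :=
    Finset.sum_nonneg fun x _ => by have := (wt_pos hq T x).le; positivity
  rw [lpPow_finset hq T Q a hs p hp, hRQ, mu_finset hq, ENNReal.ofReal_rpow_of_pos hm0,
    ENNReal.ofReal_le_ofReal_iff (by positivity)] at hlp
  have key := cz_main T.wt (wt_pos hq T) T.DD K hK1 7 (by norm_num) T.Dec T.Dec_zero T.Dec_add
    (fun f c d ⟨n, c', a', h1, h2, h3⟩ hcd => ⟨n, c', a', h1, h2, h3.trans hcd⟩)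
    (DD_ne hq T) (DD_split hq T) (Dec_base hq T) p hp a C hC0.le hCe _ Q hQ rfl
  rw [hmean] at key
  have heq : (fun x => if x ∈ Q then a x - 0 / ((∑ y ∈ Q, T.wt y : ℝ) : ℂ) else 0) = a := by
    funext x
    by_cases hx : x ∈ Q
    · simp [hx]
    · simp [hx, hs x hx]
  rw [heq] at key
  have hfin := T.Dec_H1 _ _ key
  refine ⟨hfin.1, hfin.2.trans ?_⟩
  change _ ≤ ENNReal.ofReal C
  apply ENNReal.ofReal_le_ofReal
  set m := ∑ x ∈ Q, T.wt x
  have h5 : (∑ x ∈ Q, ‖a x‖ ^ p * T.wt x) ^ (1/p) ≤ (m ^ (1 - p)) ^ (1/p) :=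
    Real.rpow_le_rpow hJ0 hlp (by positivity)
  have h6 : m ^ (1 - 1/p) * (m ^ (1 - p)) ^ (1/p) = 1 := by
    rw [← Real.rpow_mul hm0.le, ← Real.rpow_add hm0]
    have : 1 - 1/p + (1 - p) * (1/p) = 0 := by field_simp; ring
    rw [this, Real.rpow_zero]
  have h7 : m ^ (1 - 1/p) * (∑ x ∈ Q, ‖a x‖ ^ p * T.wt x) ^ (1/p) ≤ 1 := by
    refine le_trans ?_ h6.le
    exact mul_le_mul_of_nonneg_left h5 (by positivity)
  nlinarith
end

section
/- For every p ∈ (1,∞), the atomic Hardy spaces H^{1,p}(μ) and H^{1,∞}(μ) on the weighted homogeneous tree coincide, and the norms ‖·‖_{H^{1,p}} and ‖·‖_{H^{1,∞}} are equivalent. -/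
open scoped ENNReal NNReal
open MeasureTheory Filter

open HomTree

namespace HTP

open scoped Classical
noncomputable section

variable {q : ℕ}

/-- The weight of a vertex. -/
def w (T : HomTree q) (x : T.V) : ℝ := (q : ℝ) ^ (T.lev x)

/-- The mass of a finite set. -/
def m (T : HomTree q) (Q : Finset T.V) : ℝ := ∑ x ∈ Q, w T x

/-- The parent. -/
def par (T : HomTree q) (x : T.V) : T.V := (T.unique_above x).choose

theorem par_adj (T : HomTree q) (x : T.V) : T.G.Adj x (par T x) :=
  (T.unique_above x).choose_spec.1.1

theorem par_lev (T : HomTree q) (x : T.V) : T.lev (par T x) = T.lev x + 1 :=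
  (T.unique_above x).choose_spec.1.2

theorem par_unique (T : HomTree q) (x y : T.V) (h : T.G.Adj x y) (hl : T.lev y = T.lev x + 1) :
    y = par T x :=
  (T.unique_above x).choose_spec.2 y ⟨h, hl⟩

theorem par_iter_lev (T : HomTree q) (n : ℕ) (x : T.V) :
    T.lev ((par T)^[n] x) = T.lev x + n := by
  induction n generalizing x with
  | zero => simp
  | succ n ih => rw [Function.iterate_succ_apply, ih, par_lev]; push_cast; ring

theorem par_iter_dist (T : HomTree q) (n : ℕ) (x : T.V) :
    T.G.dist x ((par T)^[n] x) ≤ n := by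
  induction n generalizing x with
  | zero => simp
  | succ n ih =>
    rw [Function.iterate_succ_apply]
    have h1 := T.conn.dist_triangle (u := x) (v := par T x) (w := (par T)^[n] (par T x))
    have h2 := ih (par T x)
    have h3 : T.G.dist x (par T x) = 1 := SimpleGraph.dist_eq_one_iff_adj.2 (par_adj T x)
    omega

theorem walk_lev (T : HomTree q) {x y : T.V} (W : T.G.Walk x y) :
    T.lev y ≤ T.lev x + W.length ∧
      (T.lev y = T.lev x + W.length → (par T)^[W.length] x = y) := by
  induction W with
  | nil => simp
  | @cons u v y h W ih =>
    have hl := T.lev_adj _ _ h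
    rw [SimpleGraph.Walk.length_cons]
    push_cast
    refine ⟨by omega, fun he => ?_⟩
    rw [Function.iterate_succ_apply]
    have hv : v = par T u := par_unique T u v h (by omega)
    rw [← hv]
    exact ih.2 (by omega)

theorem below_iff (T : HomTree q) (x y : T.V) :
    T.below x y ↔ ∃ n : ℕ, (par T)^[n] x = y := by
  unfold HomTree.below HomTree.dist
  constructor
  · intro h
    obtain ⟨W, hW⟩ := T.conn.exists_walk_length_eq_dist x y
    exact ⟨W.length, (walk_lev T W).2 (by rw [hW]; omega)⟩
  · rintro ⟨n, rfl⟩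
    obtain ⟨W, hW⟩ := T.conn.exists_walk_length_eq_dist x ((par T)^[n] x)
    have h1 := (walk_lev T W).1
    have h2 := par_iter_lev T n x
    have h3 := par_iter_dist T n x
    omega

theorem children_finite (T : HomTree q) (v : T.V) : {x | par T x = v}.Finite := by
  have h : (T.G.neighborSet v).Finite := by
    apply Set.finite_of_ncard_ne_zero
    rw [T.degree]; omega
  apply h.subset
  rintro x rfl
  exact (par_adj T x).symm

def children (T : HomTree q) (v : T.V) : Finset T.V := (children_finite T v).toFinset

theorem mem_children (T : HomTree q) (v x : T.V) : x ∈ children T v ↔ par T x = v := by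
  simp [children]

theorem card_children (T : HomTree q) (v : T.V) : (children T v).card = q := by
  have h : T.G.neighborSet v = insert (par T v) (children T v : Set T.V) := by
    ext x
    simp only [SimpleGraph.mem_neighborSet, Set.mem_insert_iff, Finset.mem_coe, mem_children]
    constructor
    · intro h
      rcases T.lev_adj _ _ h with h1 | h1
      · exact Or.inl (par_unique T _ _ h h1)
      · exact Or.inr (par_unique T _ _ h.symm (by omega)).symm
    · rintro (rfl | rfl)
      · exact par_adj T v
      · exact (par_adj T x).symm
  have h2 := T.degree v
  have hn : par T v ∉ children T v := by
    rw [mem_children]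
    intro h
    have h1 := par_lev T v
    have h2 := par_lev T (par T v)
    rw [h] at h2
    omega
  rw [h, Set.ncard_insert_of_notMem (by simpa using hn), Set.ncard_coe_finset] at h2
  omega

/-- Descendants at depth `n`. -/
def desc (T : HomTree q) : ℕ → T.V → Finset T.V
  | 0, v => {v}
  | n + 1, v => (children T v).biUnion (desc T n)

theorem mem_desc (T : HomTree q) (n : ℕ) (v x : T.V) :
    x ∈ desc T n v ↔ (par T)^[n] x = v := by
  induction n generalizing v with
  | zero => simp [desc]
  | succ n ih =>
    simp only [desc, Finset.mem_biUnion, mem_children, ih, Function.iterate_succ_apply']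
    simp

theorem m_desc (hq : 2 ≤ q) (T : HomTree q) (n : ℕ) (v : T.V) :
    m T (desc T n v) = w T v := by
  have hq0 : (q : ℝ) ≠ 0 := by positivity
  induction n generalizing v with
  | zero => simp [desc, m]
  | succ n ih =>
    have h : m T (desc T (n + 1) v) = ∑ u ∈ children T v, m T (desc T n u) := by
      unfold m
      rw [desc, Finset.sum_biUnion]
      intro a _ b _ hab
      rw [Function.onFun, Finset.disjoint_left]
      intro x hx hy
      rw [mem_desc] at hx hy
      exact hab (hx.symm.trans hy)
    rw [h]
    have h2 : ∀ u ∈ children T v, m T (desc T n u) = (q : ℝ)⁻¹ * w T v := by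
      intro u hu
      rw [mem_children] at hu
      subst hu
      rw [ih, w, w, par_lev, zpow_add_one₀ hq0]
      field_simp
    rw [Finset.sum_congr rfl h2, Finset.sum_const, card_children, nsmul_eq_mul]
    field_simp

/-- Descendants with depth in `[a,b)`. -/
def trap (T : HomTree q) (v : T.V) (a b : ℕ) : Finset T.V :=
  (Finset.Ico a b).biUnion (fun n => desc T n v)

theorem mem_trap (T : HomTree q) (v x : T.V) (a b : ℕ) :
    x ∈ trap T v a b ↔ ∃ n, (a ≤ n ∧ n < b) ∧ (par T)^[n] x = v := by
  simp [trap, mem_desc]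

theorem m_trap (hq : 2 ≤ q) (T : HomTree q) (v : T.V) (a b : ℕ) :
    m T (trap T v a b) = ((b - a : ℕ) : ℝ) * w T v := by
  have h : m T (trap T v a b) = ∑ n ∈ Finset.Ico a b, m T (desc T n v) := by
    unfold m trap
    rw [Finset.sum_biUnion]
    intro i _ j _ hij
    rw [Function.onFun, Finset.disjoint_left]
    intro x hx hy
    rw [mem_desc] at hx hy
    have h1 := par_iter_lev T i x
    have h2 := par_iter_lev T j x
    rw [hx] at h1
    rw [hy] at h2
    omega
  rw [h, Finset.sum_congr rfl (fun n _ => m_desc hq T n v), Finset.sum_const, Nat.card_Ico,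
    nsmul_eq_mul]

/-- The envelope as a finite set. -/
theorem envelope_nondeg (T : HomTree q) (R : T.Trapezoid) (hR : R.degenerate = false) :
    R.envelope = (trap T R.root ((R.height + 1) / 2) (4 * R.height) : Set T.V) := by
  ext x
  simp only [Trapezoid.envelope, hR, Bool.false_eq_true, if_false, Set.mem_ofPred_eq,
    Finset.mem_coe, mem_trap, below_iff]
  constructor
  · rintro ⟨⟨n, hn⟩, h1, h2⟩
    have h3 := par_iter_lev T n x
    rw [hn] at h3
    exact ⟨n, ⟨by omega, by omega⟩, hn⟩
  · rintro ⟨n, ⟨h1, h2⟩, hn⟩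
    have h3 := par_iter_lev T n x
    rw [hn] at h3
    exact ⟨⟨n, hn⟩, by omega, by omega⟩

theorem w_pos (hq : 2 ≤ q) (T : HomTree q) (x : T.V) : 0 < w T x := by
  unfold w
  have : (0 : ℝ) < q := by positivity
  positivity

/-- `Q` is contained in an envelope of comparable mass. -/
def Env (T : HomTree q) (D : ℝ) (Q : Finset T.V) : Prop :=
  ∃ (R : T.Trapezoid) (S : Finset T.V), R.envelope = (S : Set T.V) ∧ Q ⊆ S ∧ m T S ≤ D * m T Q

/-- Dyadic-type sets. -/
inductive Good (T : HomTree q) (D : ℝ) : Finset T.V → Prop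
  | single (x : T.V) : Good T D {x}
  | split (Q : Finset T.V) (P : Finset (Finset T.V)) (hE : Env T D Q)
      (hG : ∀ R ∈ P, Good T D R)
      (hd : ∀ R ∈ P, ∀ S ∈ P, R ≠ S → Disjoint R S)
      (hU : ∀ x, x ∈ Q ↔ ∃ R ∈ P, x ∈ R)
      (hm : ∀ R ∈ P, m T Q ≤ D * m T R) : Good T D Q

theorem Good.env {T : HomTree q} {D : ℝ} (hD : 1 ≤ D) (hq : 2 ≤ q)
    {Q : Finset T.V} (h : Good T D Q) : Env T D Q := by
  cases h with
  | single x =>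
    refine ⟨⟨x, 1, true, le_rfl, fun _ => rfl⟩, {x}, by simp [Trapezoid.envelope], subset_rfl, ?_⟩
    have : 0 < m T {x} := by simpa [m] using w_pos hq T x
    nlinarith
  | split Q P hE => exact hE

def DD (q : ℕ) : ℝ := 7 * (q : ℝ) ^ 7

theorem DD_ge (hq : 2 ≤ q) : 7 ≤ DD q := by
  unfold DD
  have : (1 : ℝ) ≤ (q : ℝ) ^ 7 := one_le_pow₀ (by exact_mod_cast (by omega : 1 ≤ q))
  linarith

theorem DD_ge' (hq : 2 ≤ q) : (q : ℝ) ≤ DD q := by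
  unfold DD
  have h1 : (1 : ℝ) ≤ (q : ℝ) := by exact_mod_cast (by omega : 1 ≤ q)
  have : (q : ℝ) ^ 1 ≤ (q : ℝ) ^ 7 := pow_le_pow_right₀ h1 (by norm_num)
  linarith

theorem env_trap (hq : 2 ≤ q) (T : HomTree q) (v : T.V) (a b : ℕ) (ha : 1 ≤ a)
    (h1 : 2 * a ≤ b) (h2 : b ≤ 8 * a) : Env T (DD q) (trap T v a b) := by
  refine ⟨⟨v, 2 * a, false, by omega, by simp⟩, trap T v ((2 * a + 1) / 2) (4 * (2 * a)),
    envelope_nondeg T _ rfl, ?_, ?_⟩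
  · intro x
    rw [mem_trap, mem_trap]
    rintro ⟨n, hn, hx⟩
    exact ⟨n, by omega, hx⟩
  · rw [m_trap hq, m_trap hq, ← mul_assoc (DD q)]
    apply mul_le_mul_of_nonneg_right _ (w_pos hq T v).le
    have h3 : ((4 * (2 * a) - (2 * a + 1) / 2 : ℕ) : ℝ) ≤ 7 * ((b - a : ℕ) : ℝ) := by
      exact_mod_cast (by omega : 4 * (2 * a) - (2 * a + 1) / 2 ≤ 7 * (b - a))
    have h4 := DD_ge hq
    have h5 : (0 : ℝ) ≤ ((b - a : ℕ) : ℝ) := by positivity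
    nlinarith

theorem disj_trap (T : HomTree q) {v u : T.V} {a b : ℕ} (h : v ≠ u) (hl : T.lev v = T.lev u) :
    Disjoint (trap T v a b) (trap T u a b) := by
  rw [Finset.disjoint_left]
  intro x hx hy
  rw [mem_trap] at hx hy
  obtain ⟨n, _, hn⟩ := hx
  obtain ⟨k, _, hk⟩ := hy
  have h1 := par_iter_lev T n x
  have h2 := par_iter_lev T k x
  rw [hn] at h1
  rw [hk] at h2
  have : n = k := by omega
  subst this
  exact h (hn.symm.trans hk)

theorem good_trap (hq : 2 ≤ q) (T : HomTree q) (N : ℕ) : ∀ (v : T.V) (a b : ℕ), 2 * b - a ≤ N →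
    1 ≤ a → 2 * a ≤ b → b ≤ 8 * a → Good T (DD q) (trap T v a b) := by
  have hq0 : (q : ℝ) ≠ 0 := by positivity
  have hq1 : (1 : ℝ) ≤ q := by exact_mod_cast (by omega : 1 ≤ q)
  induction N with
  | zero => intros; omega
  | succ N ih =>
    intro v a b hN ha h1 h2
    have hE := env_trap hq T v a b ha h1 h2
    have hv := w_pos hq T v
    by_cases ha1 : a = 1
    · subst ha1
      refine Good.split _ ((trap T v 1 b).image (fun x => {x})) hE ?_ ?_ ?_ ?_
      · intro R hR
        obtain ⟨x, _, rfl⟩ := Finset.mem_image.1 hR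
        exact Good.single x
      · intro R hR S hS hne
        obtain ⟨x, _, rfl⟩ := Finset.mem_image.1 hR
        obtain ⟨y, _, rfl⟩ := Finset.mem_image.1 hS
        rw [Finset.disjoint_singleton]
        rintro rfl
        exact hne rfl
      · intro x; simp
      · intro R hR
        obtain ⟨x, hx, rfl⟩ := Finset.mem_image.1 hR
        obtain ⟨n, hn, hxv⟩ := (mem_trap T v x 1 b).1 hx
        have hl := par_iter_lev T n x
        rw [hxv] at hl
        rw [m_trap hq]
        have hw : w T v = (q : ℝ) ^ n * w T x := by
          unfold w
          rw [hl, zpow_add₀ hq0, zpow_natCast, mul_comm]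
        have hmx : m T {x} = w T x := by simp [m]
        rw [hmx, hw, ← mul_assoc]
        apply mul_le_mul_of_nonneg_right _ (w_pos hq T x).le
        unfold DD
        apply mul_le_mul _ (pow_le_pow_right₀ hq1 (by omega)) (by positivity) (by norm_num)
        exact_mod_cast (by omega : b - 1 ≤ 7)
    by_cases hb : b + 7 ≤ 8 * a
    · refine Good.split _ ((children T v).image (fun u => trap T u (a - 1) (b - 1))) hE ?_ ?_ ?_ ?_
      · intro R hR
        obtain ⟨u, _, rfl⟩ := Finset.mem_image.1 hR
        exact ih u _ _ (by omega) (by omega) (by omega) (by omega)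
      · intro R hR S hS hne
        obtain ⟨x, hx, rfl⟩ := Finset.mem_image.1 hR
        obtain ⟨y, hy, rfl⟩ := Finset.mem_image.1 hS
        rw [mem_children] at hx hy
        apply disj_trap
        · rintro rfl; exact hne rfl
        · have h3 := par_lev T x
          have h4 := par_lev T y
          rw [hx] at h3
          rw [hy] at h4
          omega
      · intro x
        simp only [Finset.mem_image, mem_trap, mem_children]
        constructor
        · rintro ⟨n, hn, hx⟩
          obtain ⟨k, rfl⟩ : ∃ k, n = k + 1 := ⟨n - 1, by omega⟩
          rw [Function.iterate_succ_apply'] at hx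
          exact ⟨_, ⟨(par T)^[k] x, hx, rfl⟩, (mem_trap _ _ _ _ _).2 ⟨k, by omega, rfl⟩⟩
        · rintro ⟨R, ⟨u, hu, rfl⟩, hx⟩
          obtain ⟨k, hk, hx⟩ := (mem_trap _ _ _ _ _).1 hx
          exact ⟨k + 1, by omega, by rw [Function.iterate_succ_apply', hx, hu]⟩
      · intro R hR
        obtain ⟨u, hu, rfl⟩ := Finset.mem_image.1 hR
        rw [mem_children] at hu
        rw [m_trap hq, m_trap hq]
        have hw : w T v = q * w T u := by
          unfold w
          rw [← hu, par_lev, zpow_add_one₀ hq0, mul_comm]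
        rw [hw, show b - 1 - (a - 1) = b - a by omega]
        have hu0 := w_pos hq T u
        have h5 : (0 : ℝ) ≤ ((b - a : ℕ) : ℝ) * w T u := by positivity
        have h6 := mul_le_mul_of_nonneg_right (DD_ge' hq) h5
        linarith
    · refine Good.split _ {trap T v a (2 * a), trap T v (2 * a) b} hE ?_ ?_ ?_ ?_
      · intro R hR
        simp only [Finset.mem_insert, Finset.mem_singleton] at hR
        rcases hR with rfl | rfl
        · exact ih v _ _ (by omega) (by omega) (by omega) (by omega)
        · exact ih v _ _ (by omega) (by omega) (by omega) (by omega)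
      · have key : Disjoint (trap T v a (2 * a)) (trap T v (2 * a) b) := by
          rw [Finset.disjoint_left]
          intro x hx hy
          rw [mem_trap] at hx hy
          obtain ⟨n, _, hn⟩ := hx
          obtain ⟨k, _, hk⟩ := hy
          have h1 := par_iter_lev T n x
          have h2 := par_iter_lev T k x
          rw [hn] at h1
          rw [hk] at h2
          omega
        intro R hR S hS hne
        simp only [Finset.mem_insert, Finset.mem_singleton] at hR hS
        rcases hR with rfl | rfl <;> rcases hS with rfl | rfl
        · exact absurd rfl hne
        · exact key
        · exact key.symm
        · exact absurd rfl hne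
      · intro x
        simp only [Finset.mem_insert, Finset.mem_singleton, exists_eq_or_imp, exists_eq_left,
          mem_trap]
        constructor
        · rintro ⟨n, hn, hx⟩
          by_cases h : n < 2 * a
          · exact Or.inl ⟨n, by omega, hx⟩
          · exact Or.inr ⟨n, by omega, hx⟩
        · rintro (⟨n, hn, hx⟩ | ⟨n, hn, hx⟩)
          · exact ⟨n, by omega, hx⟩
          · exact ⟨n, by omega, hx⟩
      · have key : ∀ i j : ℕ, b - a ≤ 7 * (j - i) →
            m T (trap T v a b) ≤ DD q * m T (trap T v i j) := by
          intro i j hij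
          rw [m_trap hq, m_trap hq, ← mul_assoc]
          apply mul_le_mul_of_nonneg_right _ hv.le
          have h3 : ((b - a : ℕ) : ℝ) ≤ 7 * ((j - i : ℕ) : ℝ) := by exact_mod_cast hij
          have h4 := DD_ge hq
          have h5 : (0 : ℝ) ≤ ((j - i : ℕ) : ℝ) := by positivity
          nlinarith
        intro R hR
        simp only [Finset.mem_insert, Finset.mem_singleton] at hR
        rcases hR with rfl | rfl
        · exact key _ _ (by omega)
        · exact key _ _ (by omega)

theorem envelope_good (hq : 2 ≤ q) (T : HomTree q) (R : T.Trapezoid) :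
    ∃ S : Finset T.V, R.envelope = (S : Set T.V) ∧ Good T (DD q) S ∧ S.Nonempty := by
  cases hR : R.degenerate with
  | true => exact ⟨{R.root}, by simp [Trapezoid.envelope, hR], Good.single _, by simp⟩
  | false =>
    have hh := R.height_pos
    refine ⟨_, envelope_nondeg T R hR, good_trap hq T _ _ _ _ le_rfl (by omega) (by omega)
      (by omega), ?_⟩
    rw [Finset.nonempty_iff_ne_empty]
    intro h
    have h1 := m_trap hq T R.root ((R.height + 1) / 2) (4 * R.height)
    rw [h] at h1
    have h2 := w_pos hq T R.root
    have h3 : (0 : ℝ) < ((4 * R.height - (R.height + 1) / 2 : ℕ) : ℝ) := by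
      exact_mod_cast (by omega)
    simp only [m, Finset.sum_empty] at h1
    nlinarith [mul_pos h3 h2]

theorem ofReal_w (hq : 2 ≤ q) (T : HomTree q) (x : T.V) :
    ENNReal.ofReal (w T x) = (q : ℝ≥0∞) ^ (T.lev x) := by
  unfold w
  have hq0 : (0 : ℝ) < q := by positivity
  cases T.lev x with
  | ofNat n =>
    rw [Int.ofNat_eq_natCast, zpow_natCast, zpow_natCast, ENNReal.ofReal_pow hq0.le,
      ENNReal.ofReal_natCast]
  | negSucc n =>
    rw [zpow_negSucc, zpow_negSucc, ENNReal.ofReal_inv_of_pos (by positivity),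
      ENNReal.ofReal_pow hq0.le, ENNReal.ofReal_natCast]

theorem mu_finset (hq : 2 ≤ q) (T : HomTree q) (S : Finset T.V) :
    T.mu (S : Set T.V) = ENNReal.ofReal (m T S) := by
  unfold HomTree.mu m
  rw [ENNReal.ofReal_sum_of_nonneg (fun x _ => (w_pos hq T x).le)]
  have := Finset.tsum_subtype S (fun x => (q : ℝ≥0∞) ^ (T.lev x))
  simp only [ofReal_w hq]
  exact this

theorem m_pos (hq : 2 ≤ q) (T : HomTree q) {S : Finset T.V} (hS : S.Nonempty) : 0 < m T S :=
  Finset.sum_pos (fun x _ => w_pos hq T x) hS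

theorem m_nonneg (hq : 2 ≤ q) (T : HomTree q) (S : Finset T.V) : 0 ≤ m T S :=
  Finset.sum_nonneg (fun x _ => (w_pos hq T x).le)

theorem m_single (T : HomTree q) (x : T.V) : m T {x} = w T x := by simp [m]

theorem m_mono (hq : 2 ≤ q) (T : HomTree q) {S R : Finset T.V} (h : S ⊆ R) : m T S ≤ m T R :=
  Finset.sum_le_sum_of_subset_of_nonneg h (fun x _ _ => (w_pos hq T x).le)

theorem w_cast (T : HomTree q) (x : T.V) : ((w T x : ℝ) : ℂ) = (q : ℂ) ^ (T.lev x) := by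
  unfold w; push_cast; rfl

theorem int_eq (T : HomTree q) (f : T.V → ℂ) (S : Finset T.V) (h : ∀ x, x ∉ S → f x = 0) :
    ∑' x : T.V, f x * (q : ℂ) ^ (T.lev x) = ∑ x ∈ S, f x * (w T x : ℂ) := by
  rw [tsum_eq_sum (s := S) (fun x hx => by rw [h x hx, zero_mul])]
  exact Finset.sum_congr rfl (fun x _ => by rw [w_cast])

theorem lpPow_eq (hq : 2 ≤ q) (T : HomTree q) (p : ℝ) (hp : 1 < p) (f : T.V → ℂ) (S : Finset T.V)
    (h : ∀ x, x ∉ S → f x = 0) :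
    T.lpPow f p = ENNReal.ofReal (∑ x ∈ S, ‖f x‖ ^ p * w T x) := by
  unfold HomTree.lpPow
  have hp0 : 0 < p := by linarith
  rw [tsum_eq_sum (s := S) (fun x hx => by
    rw [h x hx, nnnorm_zero, ENNReal.coe_zero, ENNReal.zero_rpow_of_pos hp0, zero_mul])]
  rw [ENNReal.ofReal_sum_of_nonneg
    (fun x _ => mul_nonneg (Real.rpow_nonneg (norm_nonneg _) _) (w_pos hq T x).le)]
  refine Finset.sum_congr rfl (fun x _ => ?_)
  rw [ENNReal.ofReal_mul (Real.rpow_nonneg (norm_nonneg _) _), ofReal_w hq,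
    ← ENNReal.ofReal_rpow_of_nonneg (norm_nonneg _) hp0.le, ofReal_norm]
  rfl

theorem atom_bound (hq : 2 ≤ q) (T : HomTree q) {a : T.V → ℂ} (ha : T.IsInftyAtom a) (x : T.V) :
    ‖a x‖ ≤ (w T x)⁻¹ := by
  have hw := w_pos hq T x
  by_cases hx : a x = 0
  · rw [hx, norm_zero]; positivity
  obtain ⟨R, h1, h2, -⟩ := ha
  obtain ⟨S, hS, -, hne⟩ := envelope_good hq T R
  have hxS : x ∈ S := by
    have := h1 (Function.mem_support.2 hx)
    rw [hS] at this
    exact this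
  have h3 := h2 x
  have hm : 0 < m T S := m_pos hq T hne
  rw [hS, mu_finset hq, ← ENNReal.ofReal_inv_of_pos hm] at h3
  have h4 : ENNReal.ofReal ‖a x‖ ≤ ENNReal.ofReal (m T S)⁻¹ := by
    rw [ofReal_norm]; exact h3
  rw [ENNReal.ofReal_le_ofReal_iff (by positivity)] at h4
  refine h4.trans (inv_anti₀ hw ?_)
  rw [← m_single]
  exact m_mono hq T (by simpa using hxS)

/-- `h` has an atomic decomposition of size at most `s`. -/
def Dec (T : HomTree q) (h : T.V → ℂ) (s : ℝ) : Prop :=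
  ∃ (c : ℕ → ℂ) (a : ℕ → T.V → ℂ), (∀ n, T.IsInftyAtom (a n)) ∧
    Summable (fun n => ‖c n‖) ∧ ∑' n, ‖c n‖ ≤ s ∧ ∀ x, HasSum (fun n => c n * a n x) (h x)

theorem zero_atom (T : HomTree q) : T.IsInftyAtom (fun _ => 0) := by
  refine ⟨⟨T.geo 0, 1, true, le_rfl, fun _ => rfl⟩, ?_, ?_, ?_⟩ <;> simp

theorem Dec.mono {T : HomTree q} {h : T.V → ℂ} {s t : ℝ} (H : Dec T h s) (hst : s ≤ t) :
    Dec T h t := by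
  obtain ⟨c, a, h1, h2, h3, h4⟩ := H
  exact ⟨c, a, h1, h2, h3.trans hst, h4⟩

theorem Dec.zero (T : HomTree q) : Dec T (fun _ => 0) 0 :=
  ⟨fun _ => 0, fun _ _ => 0, fun _ => zero_atom T, by simpa using summable_zero, by simp,
    fun x => by simpa using hasSum_zero⟩

theorem Dec.smul {T : HomTree q} {h : T.V → ℂ} {s : ℝ} (H : Dec T h s) (b : ℂ) :
    Dec T (fun x => b * h x) (‖b‖ * s) := by
  obtain ⟨c, a, h1, h2, h3, h4⟩ := H
  refine ⟨fun n => b * c n, a, h1, ?_, ?_, fun x => ?_⟩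
  · simpa using h2.mul_left ‖b‖
  · simp only [norm_mul]
    rw [tsum_mul_left]
    exact mul_le_mul_of_nonneg_left h3 (norm_nonneg _)
  · simpa [mul_assoc] using (h4 x).mul_left b

theorem Dec.atom {T : HomTree q} {a : T.V → ℂ} (ha : T.IsInftyAtom a) : Dec T a 1 := by
  refine ⟨fun n => if n = 0 then 1 else 0, fun _ => a, fun _ => ha, ?_, ?_, fun x => ?_⟩
  · apply summable_of_ne_finset_zero (s := {0})
    intro n hn
    simp at hn
    simp [hn]
  · rw [tsum_eq_single 0]
    · simp
    · intro n hn; simp [hn]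
  · have := hasSum_single (f := fun n : ℕ => (if n = 0 then (1 : ℂ) else 0) * a x) 0
      (fun n hn => by simp [hn])
    simpa using this

theorem Dec.sum_nat (hq : 2 ≤ q) {T : HomTree q} {f : ℕ → T.V → ℂ} {s : ℕ → ℝ} {h : T.V → ℂ}
    (H : ∀ n, Dec T (f n) (s n)) (hs : Summable s) (hh : ∀ x, HasSum (fun n => f n x) (h x)) :
    Dec T h (∑' n, s n) := by
  choose c a h1 h2 h3 h4 using H
  have hS1 : Summable (fun n => ∑' k, ‖c n k‖) :=
    Summable.of_nonneg_of_le (fun n => tsum_nonneg (fun k => norm_nonneg _)) h3 hs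
  have hS : Summable (fun z : ℕ × ℕ => ‖c z.1 z.2‖) :=
    (summable_prod_of_nonneg (fun z => norm_nonneg _)).2 ⟨h2, hS1⟩
  obtain ⟨e⟩ : Nonempty (ℕ ≃ ℕ × ℕ) := ⟨Nat.pairEquiv.symm⟩
  refine ⟨fun n => c (e n).1 (e n).2, fun n => a (e n).1 (e n).2, fun n => h1 _ _,
    e.summable_iff.2 hS, ?_, fun x => ?_⟩
  · rw [e.tsum_eq (fun z : ℕ × ℕ => ‖c z.1 z.2‖), hS.tsum_prod]
    exact hS1.tsum_le_tsum h3 hs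
  · have hS2 : Summable (fun z : ℕ × ℕ => c z.1 z.2 * a z.1 z.2 x) := by
      apply Summable.of_norm_bounded (hS.mul_right (w T x)⁻¹)
      intro z
      rw [norm_mul]
      exact mul_le_mul_of_nonneg_left (atom_bound hq T (h1 _ _) x) (norm_nonneg _)
    have h5 := hS2.hasSum.prod_fiberwise (fun n => h4 n x)
    have h6 := hS2.hasSum
    rw [h5.unique (hh x)] at h6
    exact e.hasSum_iff.2 h6

theorem Dec.add (hq : 2 ≤ q) {T : HomTree q} {f g : T.V → ℂ} {s t : ℝ}
    (hf : Dec T f s) (hg : Dec T g t) : Dec T (fun x => f x + g x) (s + t) := by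
  have h := Dec.sum_nat hq (T := T)
    (f := fun n => if n = 0 then f else if n = 1 then g else fun _ => 0)
    (s := fun n => if n = 0 then s else if n = 1 then t else 0) (h := fun x => f x + g x) ?_ ?_ ?_
  · rw [tsum_eq_sum (s := Finset.range 2)] at h
    · simpa [Finset.sum_range_succ] using h
    · intro n hn
      simp at hn
      rw [if_neg (by omega), if_neg (by omega)]
  · intro n
    split_ifs
    · exact hf
    · exact hg
    · exact Dec.zero T
  · apply summable_of_ne_finset_zero (s := Finset.range 2)
    intro n hn
    simp at hn
    rw [if_neg (by omega), if_neg (by omega)]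
  · intro x
    have hz : ∀ n ∉ Finset.range 2,
        (if n = 0 then f else if n = 1 then g else fun _ => 0) x = 0 := by
      intro n hn
      simp at hn
      rw [if_neg (by omega), if_neg (by omega)]
    have h5 : HasSum (fun n : ℕ => (if n = 0 then f else if n = 1 then g else fun _ => 0) x) _ :=
      hasSum_sum_of_ne_finset_zero hz
    simpa [Finset.sum_range_succ] using h5

theorem Dec.sum (hq : 2 ≤ q) {T : HomTree q} {ι : Type*} (P : Finset ι) {f : ι → T.V → ℂ}
    {s : ι → ℝ} (H : ∀ i ∈ P, Dec T (f i) (s i)) :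
    Dec T (fun x => ∑ i ∈ P, f i x) (∑ i ∈ P, s i) := by
  induction P using Finset.induction_on with
  | empty => simpa using Dec.zero T
  | insert i P hi ih =>
    simp only [Finset.sum_insert hi]
    exact Dec.add hq (H i (by simp)) (ih (fun j hj => H j (by simp [hj])))

/-- A bounded function with vanishing integral on a good set. -/
theorem Dec.bounded (hq : 2 ≤ q) {T : HomTree q} {D : ℝ} {Q : Finset T.V}
    (hE : Env T D Q) (g : T.V → ℂ) (hg : ∀ x, x ∉ Q → g x = 0) {B : ℝ} (hB : 0 < B)
    (hgB : ∀ x, ‖g x‖ ≤ B) (h0 : ∑ x ∈ Q, g x * (w T x : ℂ) = 0) (hQ : Q.Nonempty) :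
    Dec T g (B * (D * m T Q)) := by
  obtain ⟨R, S, hR, hQS, hm⟩ := hE
  have hS : 0 < m T S := m_pos hq T (hQ.mono hQS)
  have hne : ((B * m T S : ℝ) : ℂ) ≠ 0 := by
    exact_mod_cast (mul_pos hB hS).ne'
  have hat : T.IsInftyAtom (fun x => ((B * m T S : ℝ) : ℂ)⁻¹ * g x) := by
    refine ⟨R, ?_, ?_, ?_⟩
    · intro x hx
      rw [hR]
      by_contra hxS
      exact hx (by simp [hg x (fun h => hxS (hQS h))])
    · intro x
      rw [hR, mu_finset hq, ← ENNReal.ofReal_inv_of_pos hS]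
      change ‖((B * m T S : ℝ) : ℂ)⁻¹ * g x‖ₑ ≤ _
      rw [← ofReal_norm]
      apply ENNReal.ofReal_le_ofReal
      rw [norm_mul, norm_inv, Complex.norm_real, Real.norm_of_nonneg (by positivity)]
      rw [mul_inv, mul_comm B⁻¹, mul_assoc]
      apply mul_le_of_le_one_right (by positivity)
      rw [inv_mul_le_iff₀ hB, mul_one]
      exact hgB x
    · rw [int_eq T _ Q (fun x hx => by simp [hg x hx])]
      simp only [mul_assoc, ← Finset.mul_sum]
      rw [h0, mul_zero]
  have h := (Dec.atom hat).smul ((B * m T S : ℝ) : ℂ)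
  simp only [mul_inv_cancel_left₀ hne, mul_one] at h
  apply h.mono
  rw [Complex.norm_real, Real.norm_of_nonneg (by positivity)]
  exact mul_le_mul_of_nonneg_left hm hB.le

/-- The stopping family. -/
theorem stopping (T : HomTree q) {D : ℝ} (hq : 2 ≤ q) (u : T.V → ℝ) (hu : ∀ x, 0 ≤ u x) {lam : ℝ}
    {Q : Finset T.V} (hQ : Good T D Q) : ∑ x ∈ Q, u x * w T x ≤ lam * m T Q → 0 ≤ lam →
    ∃ P : Finset (Finset T.V), (∀ R ∈ P, ∀ S ∈ P, R ≠ S → Disjoint R S) ∧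
      (∀ R ∈ P, R ⊆ Q ∧ Good T D R ∧ lam * m T R < ∑ x ∈ R, u x * w T x ∧
        ∑ x ∈ R, u x * w T x ≤ D * lam * m T R) ∧
      ∀ x ∈ Q, (∀ R ∈ P, x ∉ R) → u x ≤ lam := by
  induction hQ with
  | single x =>
    intro h hl
    refine ⟨∅, by simp, by simp, ?_⟩
    intro y hy _
    rw [Finset.mem_singleton] at hy
    subst hy
    rw [m_single, Finset.sum_singleton] at h
    exact le_of_mul_le_mul_right h (w_pos hq T y)
  | split Q P hE hG hd hU hm ih =>
    intro h hl
    have hsub : ∀ R ∈ P, R ⊆ Q := fun R hR x hx => (hU x).2 ⟨R, hR, hx⟩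
    have key : ∀ R ∈ P, ∃ P' : Finset (Finset T.V), (∀ R ∈ P', ∀ S ∈ P', R ≠ S → Disjoint R S) ∧
      (∀ S ∈ P', S ⊆ R ∧ Good T D S ∧ lam * m T S < ∑ x ∈ S, u x * w T x ∧
        ∑ x ∈ S, u x * w T x ≤ D * lam * m T S) ∧
      ∀ x ∈ R, (∀ S ∈ P', x ∉ S) → u x ≤ lam := by
      intro R hR
      by_cases hc : ∑ x ∈ R, u x * w T x ≤ lam * m T R
      · exact ih R hR hc hl
      · refine ⟨{R}, ?_, ?_, ?_⟩
        · intro A hA B hB hne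
          rw [Finset.mem_singleton] at hA hB
          exact absurd (hA.trans hB.symm) hne
        · intro S hS
          rw [Finset.mem_singleton] at hS
          subst hS
          refine ⟨subset_rfl, hG S hR, not_le.1 hc, ?_⟩
          calc ∑ x ∈ S, u x * w T x ≤ ∑ x ∈ Q, u x * w T x :=
                Finset.sum_le_sum_of_subset_of_nonneg (hsub S hR)
                  (fun x _ _ => mul_nonneg (hu x) (w_pos hq T x).le)
            _ ≤ lam * m T Q := h
            _ ≤ lam * (D * m T S) := mul_le_mul_of_nonneg_left (hm S hR) hl
            _ = D * lam * m T S := by ring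
        · intro x hx hn
          exact absurd hx (hn R (by simp))
    choose! N h1 h2 h3 using key
    refine ⟨P.biUnion N, ?_, ?_, ?_⟩
    · intro A hA B hB hne
      obtain ⟨R, hR, hAR⟩ := Finset.mem_biUnion.1 hA
      obtain ⟨S, hS, hBS⟩ := Finset.mem_biUnion.1 hB
      by_cases hRS : R = S
      · subst hRS
        exact h1 R hR A hAR B hBS hne
      · exact Finset.disjoint_of_subset_left (h2 R hR A hAR).1
          (Finset.disjoint_of_subset_right (h2 S hS B hBS).1 (hd R hR S hS hRS))
    · intro A hA
      obtain ⟨R, hR, hAR⟩ := Finset.mem_biUnion.1 hA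
      obtain ⟨a1, a2⟩ := h2 R hR A hAR
      exact ⟨a1.trans (hsub R hR), a2⟩
    · intro x hx hn
      obtain ⟨R, hR, hxR⟩ := (hU x).1 hx
      exact h3 R hR x hxR (fun S hS => hn S (Finset.mem_biUnion.2 ⟨R, hR, hS⟩))

theorem mean_bound (hq : 2 ≤ q) (T : HomTree q) {p : ℝ} (hp : 1 < p) (f : T.V → ℂ)
    {R : Finset T.V} (hR : R.Nonempty) :
    ‖(∑ x ∈ R, f x * (w T x : ℂ)) / (m T R : ℂ)‖ ^ p * m T R ≤ ∑ x ∈ R, ‖f x‖ ^ p * w T x := by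
  have hm : 0 < m T R := m_pos hq T hR
  have h1 := Real.rpow_arith_mean_le_arith_mean_rpow R (fun x => w T x / m T R) (fun x => ‖f x‖)
    (fun x _ => div_nonneg (w_pos hq T x).le hm.le)
    (by rw [← Finset.sum_div]; exact div_self hm.ne') (fun x _ => norm_nonneg _) hp.le
  have h2 : ‖(∑ x ∈ R, f x * (w T x : ℂ)) / (m T R : ℂ)‖ ≤ ∑ x ∈ R, w T x / m T R * ‖f x‖ := by
    rw [norm_div, Complex.norm_real, Real.norm_of_nonneg hm.le, div_le_iff₀ hm, Finset.sum_mul]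
    refine (norm_sum_le _ _).trans (Finset.sum_le_sum (fun x _ => le_of_eq ?_))
    rw [norm_mul, Complex.norm_real, Real.norm_of_nonneg (w_pos hq T x).le]
    field_simp
  have h3 := (Real.rpow_le_rpow (norm_nonneg _) h2 (by linarith : 0 ≤ p)).trans h1
  calc _ ≤ (∑ x ∈ R, w T x / m T R * ‖f x‖ ^ p) * m T R :=
        mul_le_mul_of_nonneg_right h3 hm.le
    _ = _ := by
      rw [Finset.sum_mul]
      refine Finset.sum_congr rfl (fun x _ => ?_)
      field_simp

theorem rpow_sub_le {p : ℝ} (hp : 1 < p) (a c : ℂ) :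
    ‖a - c‖ ^ p ≤ 2 ^ p * (‖a‖ ^ p + ‖c‖ ^ p) := by
  have hp0 : 0 ≤ p := by linarith
  have ha := Real.rpow_nonneg (norm_nonneg a) p
  have hc := Real.rpow_nonneg (norm_nonneg c) p
  have h2 : (0 : ℝ) ≤ 2 ^ p := by positivity
  have h := norm_sub_le a c
  rcases le_total ‖a‖ ‖c‖ with h' | h'
  · calc ‖a - c‖ ^ p ≤ (2 * ‖c‖) ^ p := Real.rpow_le_rpow (norm_nonneg _) (by linarith) hp0
      _ = 2 ^ p * ‖c‖ ^ p := Real.mul_rpow (by norm_num) (norm_nonneg _)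
      _ ≤ _ := mul_le_mul_of_nonneg_left (by linarith) h2
  · calc ‖a - c‖ ^ p ≤ (2 * ‖a‖) ^ p := Real.rpow_le_rpow (norm_nonneg _) (by linarith) hp0
      _ = 2 ^ p * ‖a‖ ^ p := Real.mul_rpow (by norm_num) (norm_nonneg _)
      _ ≤ _ := mul_le_mul_of_nonneg_left (by linarith) h2

theorem main_dec (hq : 2 ≤ q) (T : HomTree q) {p : ℝ} (hp : 1 < p) {D α : ℝ} (hD : 1 ≤ D)
    (hα : 1 ≤ α) (hαD : 8 * D * α ≤ α ^ p) (n : ℕ) :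
    ∀ (Q : Finset T.V), Q.card ≤ n → Good T D Q → ∀ (f : T.V → ℂ) (t : ℝ), 0 < t →
      (∀ x, x ∉ Q → f x = 0) → ∑ x ∈ Q, f x * (w T x : ℂ) = 0 →
      ∑ x ∈ Q, ‖f x‖ ^ p * w T x ≤ t ^ p * m T Q →
      Dec T f (2 * D ^ 2 * α * (t * m T Q)) := by
  have hp0 : 0 < p := by linarith
  have hDp : D ≤ D ^ p := by
    simpa using Real.rpow_le_rpow_of_exponent_le hD hp.le
  have h2p : (2 : ℝ) ≤ 2 ^ p := by
    simpa using Real.rpow_le_rpow_of_exponent_le (by norm_num : (1 : ℝ) ≤ 2) hp.le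
  induction n with
  | zero =>
    intro Q hQn _ f t ht hf _ _
    have hQ : Q = ∅ := by simpa using hQn
    subst hQ
    have : f = fun _ => 0 := funext (fun x => hf x (by simp))
    rw [this]
    exact (Dec.zero T).mono (by simp [m])
  | succ n ih =>
    intro Q hQn hG f t ht hf h0 hF
    by_cases hQ : Q.Nonempty
    swap
    · have hQ : Q = ∅ := Finset.not_nonempty_iff_eq_empty.1 hQ
      exact ih Q (by simp [hQ]) hG f t ht hf h0 hF
    have hmQ := m_pos hq T hQ
    have hαt : 0 < α * t := by positivity
    have htp : 0 < t ^ p := Real.rpow_pos_of_pos ht p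
    have hαp : 1 ≤ α ^ p := Real.one_le_rpow hα hp0.le
    have hlam : (α * t) ^ p = α ^ p * t ^ p := Real.mul_rpow (by linarith) ht.le
    have hlp : 0 < (α * t) ^ p := Real.rpow_pos_of_pos hαt p
    have htl : t ^ p ≤ (α * t) ^ p := by rw [hlam]; nlinarith
    obtain ⟨P, hPd, hP, hPoff⟩ := stopping T hq (fun x => ‖f x‖ ^ p)
      (fun x => Real.rpow_nonneg (norm_nonneg _) p) (lam := (α * t) ^ p) hG
      (hF.trans (mul_le_mul_of_nonneg_right htl hmQ.le)) hlp.le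
    have hne : ∀ R ∈ P, R.Nonempty := by
      intro R hR
      rw [Finset.nonempty_iff_ne_empty]
      rintro rfl
      have := (hP _ hR).2.2.1
      simp [m] at this
    let c : Finset T.V → ℂ := fun R => (∑ x ∈ R, f x * (w T x : ℂ)) / (m T R : ℂ)
    let b : Finset T.V → T.V → ℂ := fun R x => if x ∈ R then f x - c R else 0
    have hbn : ∀ R x, x ∉ R → b R x = 0 := fun R x hx => if_neg hx
    have hbi : ∀ R x, x ∈ R → b R x = f x - c R := fun R x hx => if_pos hx
    have hb0 : ∀ R ∈ P, ∑ x ∈ R, b R x * (w T x : ℂ) = 0 := by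
      intro R hR
      have hm : (m T R : ℂ) ≠ 0 := by exact_mod_cast (m_pos hq T (hne R hR)).ne'
      have : ∑ x ∈ R, b R x * (w T x : ℂ) = ∑ x ∈ R, (f x * (w T x : ℂ) - c R * (w T x : ℂ)) :=
        Finset.sum_congr rfl (fun x hx => by rw [hbi R x hx, sub_mul])
      rw [this, Finset.sum_sub_distrib, ← Finset.mul_sum]
      have h5 : ∑ x ∈ R, (w T x : ℂ) = (m T R : ℂ) := by unfold m; push_cast; rfl
      rw [h5]
      simp only [c]
      rw [div_mul_cancel₀ _ hm, sub_self]
    have hcm : ∀ R ∈ P, ‖c R‖ ^ p * m T R ≤ D * (α * t) ^ p * m T R := fun R hR =>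
      (mean_bound hq T hp f (hne R hR)).trans (hP R hR).2.2.2
    have hbF : ∀ R ∈ P, ∑ x ∈ R, ‖b R x‖ ^ p * w T x ≤ (4 * D * (α * t)) ^ p * m T R := by
      intro R hR
      have hmR := m_pos hq T (hne R hR)
      calc ∑ x ∈ R, ‖b R x‖ ^ p * w T x
          ≤ ∑ x ∈ R, 2 ^ p * (‖f x‖ ^ p * w T x + ‖c R‖ ^ p * w T x) := by
            refine Finset.sum_le_sum (fun x hx => ?_)
            rw [hbi R x hx, ← add_mul, ← mul_assoc]
            exact mul_le_mul_of_nonneg_right (rpow_sub_le hp _ _) (w_pos hq T x).le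
        _ = 2 ^ p * (∑ x ∈ R, ‖f x‖ ^ p * w T x + ‖c R‖ ^ p * m T R) := by
            rw [← Finset.mul_sum, Finset.sum_add_distrib, ← Finset.mul_sum]; rfl
        _ ≤ 2 ^ p * (D * (α * t) ^ p * m T R + D * (α * t) ^ p * m T R) := by
            apply mul_le_mul_of_nonneg_left _ (by linarith)
            exact add_le_add (hP R hR).2.2.2 (hcm R hR)
        _ = 2 ^ p * (2 * (D * ((α * t) ^ p * m T R))) := by ring
        _ ≤ 2 ^ p * (2 ^ p * (D ^ p * ((α * t) ^ p * m T R))) := by gcongr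
        _ = (4 * D * (α * t)) ^ p * m T R := by
            have hD0 : 0 ≤ D := by linarith
            have e1 : (4 * D * (α * t)) ^ p = (4 * D) ^ p * (α * t) ^ p :=
              Real.mul_rpow (by positivity) hαt.le
            have e2 : (4 * D) ^ p = 4 ^ p * D ^ p := Real.mul_rpow (by norm_num) hD0
            have e3 : (4 : ℝ) ^ p = 2 ^ p * 2 ^ p := by
              rw [← Real.mul_rpow (by norm_num) (by norm_num)]; norm_num
            rw [e1, e2, e3]
            ring
    have hbD : ∀ R ∈ P, Dec T (b R) (2 * D ^ 2 * α * (4 * D * (α * t) * m T R)) := by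
      intro R hR
      refine ih R ?_ (hP R hR).2.1 (b R) _ (by positivity) (hbn R) (hb0 R hR) (hbF R hR)
      have hss : R ⊂ Q := by
        refine (hP R hR).1.ssubset_of_ne ?_
        rintro rfl
        have h6 := (hP R hR).2.2.1
        have h7 := mul_le_mul_of_nonneg_right htl hmQ.le
        exact absurd (hF.trans h7) (not_le.2 h6)
      have := Finset.card_lt_card hss
      omega
    have hsumb := Dec.sum hq P hbD
    -- total mass of the stopping sets
    have hdis : (P : Set (Finset T.V)).PairwiseDisjoint id := fun R hR S hS hne =>
      hPd R hR S hS hne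
    have hmass : α ^ p * ∑ R ∈ P, m T R ≤ m T Q := by
      have h1 : (α * t) ^ p * ∑ R ∈ P, m T R ≤ ∑ x ∈ Q, ‖f x‖ ^ p * w T x := by
        rw [Finset.mul_sum]
        calc ∑ R ∈ P, (α * t) ^ p * m T R ≤ ∑ R ∈ P, ∑ x ∈ R, ‖f x‖ ^ p * w T x :=
              Finset.sum_le_sum (fun R hR => (hP R hR).2.2.1.le)
          _ = ∑ x ∈ P.biUnion id, ‖f x‖ ^ p * w T x := (Finset.sum_biUnion hdis).symm
          _ ≤ ∑ x ∈ Q, ‖f x‖ ^ p * w T x := by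
            apply Finset.sum_le_sum_of_subset_of_nonneg
            · intro x hx
              obtain ⟨R, hR, hxR⟩ := Finset.mem_biUnion.1 hx
              exact (hP R hR).1 hxR
            · exact fun x _ _ => mul_nonneg (Real.rpow_nonneg (norm_nonneg _) p) (w_pos hq T x).le
      have h2 := h1.trans hF
      rw [hlam, mul_comm (α ^ p), mul_assoc] at h2
      exact le_of_mul_le_mul_left h2 htp
    -- the good part
    let g : T.V → ℂ := fun x => f x - ∑ R ∈ P, b R x
    have hgin : ∀ R ∈ P, ∀ x ∈ R, g x = c R := by
      intro R hR x hx
      simp only [g]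
      rw [Finset.sum_eq_single R, hbi R x hx, sub_sub_cancel]
      · intro S hS hSR
        exact hbn S x (Finset.disjoint_left.1 (hPd R hR S hS hSR.symm) hx)
      · exact fun h => absurd hR h
    have hgout : ∀ x, (∀ R ∈ P, x ∉ R) → g x = f x := by
      intro x hx
      simp only [g]
      rw [Finset.sum_eq_zero (fun R hR => hbn R x (hx R hR)), sub_zero]
    have hgQ : ∀ x, x ∉ Q → g x = 0 := by
      intro x hx
      rw [hgout x (fun R hR h => hx ((hP R hR).1 h)), hf x hx]
    have hDαt : 0 < D * (α * t) := by positivity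
    have hgB : ∀ x, ‖g x‖ ≤ D * (α * t) := by
      intro x
      by_cases hxP : ∃ R ∈ P, x ∈ R
      · obtain ⟨R, hR, hx⟩ := hxP
        rw [hgin R hR x hx]
        have h1 := le_of_mul_le_mul_right (hcm R hR) (m_pos hq T (hne R hR))
        rw [← Real.rpow_le_rpow_iff (norm_nonneg _) hDαt.le hp0]
        refine h1.trans ?_
        rw [Real.mul_rpow (by linarith) hαt.le]
        exact mul_le_mul_of_nonneg_right hDp hlp.le
      · push Not at hxP
        rw [hgout x hxP]
        by_cases hxQ : x ∈ Q
        · have h1 := hPoff x hxQ hxP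
          rw [Real.rpow_le_rpow_iff (norm_nonneg _) hαt.le hp0] at h1
          nlinarith
        · rw [hf x hxQ, norm_zero]; exact hDαt.le
    have hg0 : ∑ x ∈ Q, g x * (w T x : ℂ) = 0 := by
      simp only [g, sub_mul, Finset.sum_sub_distrib, h0, Finset.sum_mul]
      rw [Finset.sum_comm, zero_sub, neg_eq_zero]
      refine Finset.sum_eq_zero (fun R hR => ?_)
      rw [← hb0 R hR]
      symm
      exact Finset.sum_subset (hP R hR).1 (fun x _ hx => by rw [hbn R x hx, zero_mul])
    have hgD := Dec.bounded hq (hG.env hD hq) g hgQ hDαt hgB hg0 hQ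
    have hfin := Dec.add hq hgD hsumb
    have hfe : (fun x => g x + ∑ R ∈ P, b R x) = f := by
      funext x
      simp only [g, sub_add_cancel]
    rw [hfe] at hfin
    apply hfin.mono
    have hM : 0 ≤ ∑ R ∈ P, m T R := Finset.sum_nonneg (fun R _ => m_nonneg hq T R)
    have hM2 : 8 * D * α * ∑ R ∈ P, m T R ≤ m T Q :=
      (mul_le_mul_of_nonneg_right hαD hM).trans hmass
    have he : ∑ R ∈ P, 2 * D ^ 2 * α * (4 * D * (α * t) * m T R)
        = D ^ 2 * α * t * (8 * D * α * ∑ R ∈ P, m T R) := by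
      rw [← Finset.mul_sum, ← Finset.mul_sum]; ring
    rw [he]
    have h9 : D ^ 2 * α * t * (8 * D * α * ∑ R ∈ P, m T R) ≤ D ^ 2 * α * t * m T Q :=
      mul_le_mul_of_nonneg_left hM2 (by positivity)
    nlinarith

theorem patom_dec (hq : 2 ≤ q) (T : HomTree q) {p : ℝ} (hp : 1 < p) {α : ℝ}
    (hα : 1 ≤ α) (hαD : 8 * DD q * α ≤ α ^ p) {a : T.V → ℂ} (ha : T.IspAtom p a) :
    Dec T a (2 * DD q ^ 2 * α) := by
  obtain ⟨R, h1, h2, h3⟩ := ha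
  obtain ⟨S, hS, hG, hne⟩ := envelope_good hq T R
  have hm := m_pos hq T hne
  have hz : ∀ x, x ∉ S → a x = 0 := by
    intro x hx
    by_contra h
    have := h1 (Function.mem_support.2 h)
    rw [hS] at this
    exact hx this
  rw [int_eq T a S hz] at h3
  rw [lpPow_eq hq T p hp a S hz, hS, mu_finset hq, ENNReal.ofReal_rpow_of_pos hm,
    ENNReal.ofReal_le_ofReal_iff (by positivity)] at h2
  have h := main_dec hq T hp (by have := DD_ge hq; linarith) hα hαD _ S le_rfl hG a (m T S)⁻¹
    (by positivity) hz h3 (by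
      refine h2.trans (le_of_eq ?_)
      rw [Real.inv_rpow hm.le, Real.rpow_sub hm, Real.rpow_one]
      field_simp)
  rw [inv_mul_cancel₀ hm.ne', mul_one] at h
  exact h

theorem infty_is_p (hq : 2 ≤ q) (T : HomTree q) {p : ℝ} (hp : 1 < p) {a : T.V → ℂ}
    (ha : T.IsInftyAtom a) : T.IspAtom p a := by
  obtain ⟨R, h1, h2, h3⟩ := ha
  obtain ⟨S, hS, hG, hne⟩ := envelope_good hq T R
  have hm := m_pos hq T hne
  have hz : ∀ x, x ∉ S → a x = 0 := by
    intro x hx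
    by_contra h
    have := h1 (Function.mem_support.2 h)
    rw [hS] at this
    exact hx this
  refine ⟨R, h1, ?_, h3⟩
  rw [lpPow_eq hq T p hp a S hz, hS, mu_finset hq, ENNReal.ofReal_rpow_of_pos hm,
    ENNReal.ofReal_le_ofReal_iff (by positivity)]
  have hb : ∀ x, ‖a x‖ ≤ (m T S)⁻¹ := by
    intro x
    have h4 : ENNReal.ofReal ‖a x‖ ≤ ENNReal.ofReal (m T S)⁻¹ := by
      rw [ofReal_norm, ENNReal.ofReal_inv_of_pos hm, ← mu_finset hq, ← hS]; exact h2 x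
    rwa [ENNReal.ofReal_le_ofReal_iff (by positivity)] at h4
  calc ∑ x ∈ S, ‖a x‖ ^ p * w T x ≤ ∑ x ∈ S, ((m T S)⁻¹) ^ p * w T x := by
        refine Finset.sum_le_sum (fun x _ => ?_)
        exact mul_le_mul_of_nonneg_right
          (Real.rpow_le_rpow (norm_nonneg _) (hb x) (by linarith)) (w_pos hq T x).le
    _ = ((m T S)⁻¹) ^ p * m T S := by rw [← Finset.mul_sum]; rfl
    _ = (m T S) ^ (1 - p) := by
      rw [Real.inv_rpow hm.le, Real.rpow_sub hm, Real.rpow_one]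
      field_simp

theorem dec_of_p (hq : 2 ≤ q) (T : HomTree q) {p : ℝ} {K : ℝ}
    (hK : ∀ a, T.IspAtom p a → Dec T a K) {h : T.V → ℂ} {c : ℕ → ℂ} {a : ℕ → T.V → ℂ}
    (ha : ∀ n, T.IspAtom p (a n)) (hc : Summable (fun n => ‖c n‖))
    (hh : ∀ x, HasSum (fun n => c n * a n x) (h x)) : Dec T h ((∑' n, ‖c n‖) * K) := by
  rw [← tsum_mul_right]
  exact Dec.sum_nat hq (fun n => (hK _ (ha n)).smul (c n)) (hc.mul_right K) hh

theorem tsum_nn {c : ℕ → ℂ} (hc : Summable (fun n => ‖c n‖)) :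
    ∑' n, (‖c n‖₊ : ℝ≥0∞) = ENNReal.ofReal (∑' n, ‖c n‖) := by
  rw [ENNReal.ofReal_tsum_of_nonneg (fun n => norm_nonneg _) hc]
  exact tsum_congr (fun n => (ofReal_norm (c n)).symm)

end

end HTP

/-- for every `p ∈ (1,∞)`, the spaces `H^{1,p}(μ)` and `H^{1,∞}(μ)`
coincide and their norms are equivalent. -/
theorem H1p_eq_H1infty {q : ℕ} (hq : 2 ≤ q) (p : ℝ) (hp : 1 < p) :
    ∃ C : ℝ≥0, 0 < C ∧ ∀ (T : HomTree q) (h : T.V → ℂ),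
      (T.InH1p p h ↔ T.InH1 h) ∧
      T.H1Norm h ≤ (C : ℝ≥0∞) * T.H1pNorm p h ∧
      T.H1pNorm p h ≤ (C : ℝ≥0∞) * T.H1Norm h := by
  set α : ℝ := (8 * HTP.DD q) ^ (1 / (p - 1)) with hαdef
  have hDD := HTP.DD_ge hq
  have hp1 : 0 < p - 1 := by linarith
  have hα : 1 ≤ α := Real.one_le_rpow (by linarith) (by positivity)
  have hαD : 8 * HTP.DD q * α ≤ α ^ p := by
    have h1 : α ^ (p - 1) = 8 * HTP.DD q := by
      rw [hαdef, ← Real.rpow_mul (by linarith), one_div, inv_mul_cancel₀ hp1.ne', Real.rpow_one]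
    rw [← h1, ← Real.rpow_add_one (by linarith), sub_add_cancel]
  set K : ℝ := 2 * HTP.DD q ^ 2 * α with hKdef
  have hK1 : 1 ≤ K := by rw [hKdef]; nlinarith
  refine ⟨K.toNNReal, by rw [Real.toNNReal_pos]; linarith, fun T h => ?_⟩
  have hC : ((K.toNNReal : ℝ≥0) : ℝ≥0∞) = ENNReal.ofReal K := rfl
  have hKa : ∀ a, T.IspAtom p a → HTP.Dec T a K := fun a ha => HTP.patom_dec hq T hp hα hαD ha
  refine ⟨⟨?_, ?_⟩, ?_, ?_⟩
  · rintro ⟨c, a, ha, hc, hh⟩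
    obtain ⟨c', a', ha', hc', -, hh'⟩ := HTP.dec_of_p hq T hKa ha hc hh
    exact ⟨c', a', ha', hc', hh'⟩
  · rintro ⟨c, a, ha, hc, hh⟩
    exact ⟨c, a, fun n => HTP.infty_is_p hq T hp (ha n), hc, hh⟩
  · rw [hC]
    have hK0 : ENNReal.ofReal K ≠ 0 := by
      rw [Ne, ENNReal.ofReal_eq_zero]; linarith
    unfold HomTree.H1pNorm
    rw [ENNReal.mul_iInf_of_ne hK0 ENNReal.ofReal_ne_top]
    refine le_iInf fun c => ?_
    rw [ENNReal.mul_iInf_of_ne hK0 ENNReal.ofReal_ne_top]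
    refine le_iInf fun a => ?_
    rw [ENNReal.mul_iInf_of_ne hK0 ENNReal.ofReal_ne_top]
    refine le_iInf fun ⟨ha, hh⟩ => ?_
    by_cases htop : ∑' n, (‖c n‖₊ : ℝ≥0∞) = ⊤
    · rw [htop, ENNReal.mul_top hK0]; exact le_top
    have hc : Summable (fun n => ‖c n‖) := by
      have := ENNReal.tsum_coe_ne_top_iff_summable.1 htop
      exact NNReal.summable_coe.2 this
    obtain ⟨c', a', ha', hc', hs', hh'⟩ := HTP.dec_of_p hq T hKa ha hc hh
    refine iInf_le_of_le c' (iInf_le_of_le a' (iInf_le_of_le ⟨ha', hh'⟩ ?_))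
    rw [HTP.tsum_nn hc, HTP.tsum_nn hc', ← ENNReal.ofReal_mul (by linarith), mul_comm K]
    exact ENNReal.ofReal_le_ofReal hs'
  · have h1 : T.H1pNorm p h ≤ T.H1Norm h := by
      refine le_iInf fun c => le_iInf fun a => le_iInf fun ⟨ha, hh⟩ => ?_
      exact iInf_le_of_le c (iInf_le_of_le a (iInf_le_of_le
        ⟨fun n => HTP.infty_is_p hq T hp (ha n), hh⟩ le_rfl))
    refine h1.trans (le_mul_of_one_le_left zero_le ?_)
    rw [hC]
    simpa using ENNReal.ofReal_le_ofReal hK1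
end

section
/- Let 1 < p < p₁ ≤ ∞ and f ∈ L^p(μ) on the weighted homogeneous tree. For every λ > 0 there is a decomposition f = g^λ + b^λ with g^λ ∈ L^{p₁}(μ), b^λ ∈ H¹(μ), ‖g^λ‖_{L^∞} ≤ Cλ, ‖g^λ‖_{L^{p₁}}^{p₁} ≤ C λ^{p₁-p} ‖f‖_{L^p}^p (when p₁ < ∞), and ‖b^λ‖_{H¹} ≤ C λ^{1-p} ‖f‖_{L^p}^p, where C depends only on p, p₁, q. -/
open scoped ENNReal NNReal
open MeasureTheory Filter

open HomTree

namespace CZ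

/-- An abstract regular dyadic system of finite sets on a weighted discrete space. -/
structure DySys (V : Type) (w : V → ℝ) (K : ℝ) where
  Q : ℕ → V → Finset V
  mem : ∀ n x, x ∈ Q n x
  eqv : ∀ n x y, y ∈ Q n x → Q n y = Q n x
  anti : ∀ n x, Q (n + 1) x ⊆ Q n x
  single : ∀ x, ∃ n, Q n x = {x}
  dbl : ∀ n x, ∑ y ∈ Q n x, w y ≤ K * ∑ y ∈ Q (n + 1) x, w y

noncomputable def avR {V : Type} (w F : V → ℝ) (S : Finset V) : ℝ :=
  (∑ y ∈ S, F y * w y) / ∑ y ∈ S, w y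

noncomputable def avC {V : Type} (w : V → ℝ) (f : V → ℂ) (S : Finset V) : ℂ :=
  (∑ y ∈ S, f y * (w y : ℂ)) / ((∑ y ∈ S, w y : ℝ) : ℂ)

section abstract_part

variable {V : Type} {w : V → ℝ} {K : ℝ} (D : DySys V w K) (F : V → ℝ)

lemma Q_anti {m n : ℕ} (h : m ≤ n) (x : V) : D.Q n x ⊆ D.Q m x := by
  induction n, h using Nat.le_induction with
  | base => exact subset_rfl
  | succ n _ ih => exact (D.anti n x).trans ih

lemma Q_eq {m n : ℕ} (h : m ≤ n) {x y : V} (hy : y ∈ D.Q n x) : D.Q m y = D.Q m x :=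
  D.eqv m x y (Q_anti D h x hy)

lemma halt_ex (s : ℝ) (x : V) : ∃ n, s < avR w F (D.Q n x) ∨ D.Q n x = {x} := by
  obtain ⟨n, hn⟩ := D.single x
  exact ⟨n, Or.inr hn⟩

open Classical in
/-- The stopping time. -/
noncomputable def tau (s : ℝ) (x : V) : ℕ := Nat.find (halt_ex D F s x)

/-- The stopping set containing `x`. -/
noncomputable def P (s : ℝ) (x : V) : Finset V := D.Q (tau D F s x) x

lemma P_spec (s : ℝ) (x : V) : s < avR w F (P D F s x) ∨ P D F s x = {x} := by
  classical
  exact Nat.find_spec (halt_ex D F s x)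

lemma tau_min {s : ℝ} {x : V} {m : ℕ} (h : m < tau D F s x) :
    ¬ (s < avR w F (D.Q m x) ∨ D.Q m x = {x}) := by
  classical
  exact Nat.find_min (halt_ex D F s x) h

lemma tau_le {s : ℝ} {x : V} {m : ℕ} (h : s < avR w F (D.Q m x) ∨ D.Q m x = {x}) :
    tau D F s x ≤ m := by
  classical
  exact Nat.find_min' (halt_ex D F s x) h

lemma mem_P (s : ℝ) (x : V) : x ∈ P D F s x := D.mem _ x

lemma tau_eq {s : ℝ} {x y : V} (hy : y ∈ P D F s x) : tau D F s y = tau D F s x := by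
  apply le_antisymm
  · apply tau_le
    have h := D.eqv _ x y hy
    rcases P_spec D F s x with h1 | h1
    · left; rw [h]; exact h1
    · right
      rw [h1, Finset.mem_singleton] at hy
      subst hy; exact h1
  · by_contra hlt
    push Not at hlt
    have h := Q_eq D hlt.le hy
    have h2 := tau_min D F hlt
    apply h2
    rcases P_spec D F s y with h1 | h1
    · left; rw [← h]; exact h1
    · right
      have hx : x ∈ D.Q (tau D F s y) x := D.mem _ x
      rw [← h] at hx ⊢
      change x ∈ P D F s y at hx
      change P D F s y = _
      rw [h1, Finset.mem_singleton] at hx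
      subst hx
      exact h1

lemma P_eq {s : ℝ} {x y : V} (hy : y ∈ P D F s x) : P D F s y = P D F s x := by
  unfold P
  rw [tau_eq D F hy]
  exact D.eqv _ x y hy

lemma P_anti {s t : ℝ} (h : s ≤ t) (x : V) : P D F t x ⊆ P D F s x := by
  apply Q_anti
  apply tau_le
  rcases P_spec D F t x with h1 | h1
  · left; exact h.trans_lt h1
  · right; exact h1

variable (hw : ∀ x, 0 < w x)
include hw

lemma W_pos {S : Finset V} {x : V} (hx : x ∈ S) : 0 < ∑ y ∈ S, w y :=
  Finset.sum_pos (fun y _ => hw y) ⟨x, hx⟩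

lemma avR_nonneg (hF : ∀ x, 0 ≤ F x) (S : Finset V) : 0 ≤ avR w F S :=
  div_nonneg (Finset.sum_nonneg fun y _ => mul_nonneg (hF y) (hw y).le)
    (Finset.sum_nonneg fun y _ => (hw y).le)

lemma P_bound (hF : ∀ x, 0 ≤ F x) (hK : 1 ≤ K) {s : ℝ} (hs : 0 ≤ s) (x : V)
    (h0 : avR w F (D.Q 0 x) ≤ s) : avR w F (P D F s x) ≤ K * s := by
  unfold P
  rcases h : tau D F s x with _ | n
  · nlinarith
  · have h1 := tau_min D F (s := s) (x := x) (m := n) (by omega)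
    push Not at h1
    have h2 := h1.1
    unfold avR at h2 ⊢
    have p1 := W_pos hw (D.mem n x)
    have p2 := W_pos hw (D.mem (n+1) x)
    rw [div_le_iff₀ p1] at h2
    rw [div_le_iff₀ p2]
    calc ∑ y ∈ D.Q (n+1) x, F y * w y ≤ ∑ y ∈ D.Q n x, F y * w y :=
          Finset.sum_le_sum_of_subset_of_nonneg (D.anti n x)
            (fun y _ _ => mul_nonneg (hF y) (hw y).le)
      _ ≤ s * ∑ y ∈ D.Q n x, w y := h2
      _ ≤ s * (K * ∑ y ∈ D.Q (n+1) x, w y) := by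
          have := D.dbl n x
          gcongr
      _ = _ := by ring

lemma P_event (hF : ∀ x, 0 ≤ F x) (x : V) : ∃ s0 : ℝ, ∀ s, s0 ≤ s → P D F s x = {x} := by
  obtain ⟨N, hN⟩ := D.single x
  refine ⟨∑ n ∈ Finset.range (N+1), avR w F (D.Q n x), fun s hs => ?_⟩
  rcases P_spec D F s x with h | h
  · exfalso
    have hle : tau D F s x ≤ N := tau_le D F (Or.inr hN)
    have := Finset.single_le_sum (f := fun n => avR w F (D.Q n x))
      (fun n _ => avR_nonneg F hw hF _) (Finset.mem_range.2 (Nat.lt_succ_of_le hle))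
    unfold P at h
    linarith
  · exact h

omit D in
lemma avC_single (f : V → ℂ) (x : V) : avC w f {x} = f x := by
  unfold avC
  simp only [Finset.sum_singleton]
  have : (w x : ℂ) ≠ 0 := by exact_mod_cast (hw x).ne'
  field_simp

omit D in
lemma norm_avC (f : V → ℂ) (S : Finset V) : ‖avC w f S‖ ≤ avR w (fun x => ‖f x‖) S := by
  unfold avC avR
  rw [norm_div, Complex.norm_real, Real.norm_of_nonneg (Finset.sum_nonneg fun y _ => (hw y).le)]
  have h0 : 0 ≤ ∑ y ∈ S, w y := Finset.sum_nonneg fun y _ => (hw y).le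
  gcongr
  refine (norm_sum_le _ _).trans (Finset.sum_le_sum fun y _ => ?_)
  rw [norm_mul, Complex.norm_real, Real.norm_of_nonneg (hw y).le]

omit D in
lemma sum_avC (f : V → ℂ) (R : V → Finset V) (hR : ∀ x, x ∈ R x)
    (hRe : ∀ x y, y ∈ R x → R y = R x) (S : Finset V) (hS : ∀ x ∈ S, R x ⊆ S) :
    ∑ y ∈ S, avC w f (R y) * (w y : ℂ) = ∑ y ∈ S, f y * (w y : ℂ) := by
  classical
  have key : ∀ y ∈ S, avC w f (R y) * (w y : ℂ) =
      ∑ z ∈ S, if z ∈ R y then f z * (w z : ℂ) * ((w y : ℂ) / ((∑ u ∈ R y, w u : ℝ) : ℂ)) else 0 := by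
    intro y hy
    rw [← Finset.sum_filter, Finset.filter_mem_eq_inter, Finset.inter_eq_right.2 (hS y hy),
      ← Finset.sum_mul]
    unfold avC
    ring
  rw [Finset.sum_congr rfl key, Finset.sum_comm]
  apply Finset.sum_congr rfl
  intro z hz
  have h2 : ∀ y ∈ S, (if z ∈ R y then f z * (w z : ℂ) * ((w y : ℂ) / ((∑ u ∈ R y, w u : ℝ) : ℂ)) else 0)
      = if y ∈ R z then f z * (w z : ℂ) / ((∑ u ∈ R z, w u : ℝ) : ℂ) * (w y : ℂ) else 0 := by
    intro y _
    by_cases h : z ∈ R y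
    · have h3 := hRe y z h
      have h4 : y ∈ R z := by rw [h3]; exact hR y
      rw [if_pos h, if_pos h4, h3]; ring
    · have h4 : y ∉ R z := fun h4 => h (by rw [hRe z y h4]; exact hR z)
      rw [if_neg h, if_neg h4]
  rw [Finset.sum_congr rfl h2, ← Finset.sum_filter, Finset.filter_mem_eq_inter,
    Finset.inter_eq_right.2 (hS z hz), ← Finset.mul_sum]
  have hne : ((∑ u ∈ R z, w u : ℝ) : ℂ) ≠ 0 := by
    exact_mod_cast (W_pos hw (hR z)).ne'
  push_cast at hne ⊢
  field_simp

/-- mean zero of the difference of two stopped averages on a stopping set -/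
lemma diff_mean_zero (f : V → ℂ) {s t : ℝ} (h : s ≤ t) (x : V) :
    ∑ y ∈ P D F s x, (avC w f (P D F t y) - avC w f (P D F s y)) * (w y : ℂ) = 0 := by
  simp only [sub_mul, Finset.sum_sub_distrib]
  rw [sum_avC hw f (P D F t) (mem_P D F t) (fun x y hy => P_eq D F hy),
    sum_avC hw f (P D F s) (mem_P D F s) (fun x y hy => P_eq D F hy), sub_self]
  · intro y hy; rw [P_eq D F hy]
  · intro y hy; rw [← P_eq D F hy]; exact P_anti D F h y

/-- `S` is a stopping set at height `s`. -/
def Bad (s : ℝ) (S : Finset V) : Prop := ∃ x, S = P D F s x ∧ s < avR w F S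

omit hw in
lemma Bad_mem {s : ℝ} {S : Finset V} {y : V} (h : Bad D F s S) (hy : y ∈ S) :
    S = P D F s y ∧ s < avR w F (P D F s y) := by
  obtain ⟨x, rfl, h2⟩ := h
  rw [P_eq D F hy]
  exact ⟨rfl, h2⟩

open Classical in
lemma bad_sum (hF : ∀ x, 0 ≤ F x) {s : ℝ} (hs : 0 < s) :
    (∑' S : Finset V, if Bad D F s S then ENNReal.ofReal (∑ y ∈ S, w y) else 0) ≤
      ENNReal.ofReal (2 / s) * ∑' y, if s / 2 < F y then ENNReal.ofReal (F y * w y) else 0 := by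
  set G : V → ℝ≥0∞ := fun y => if s / 2 < F y then ENNReal.ofReal (F y * w y) else 0 with hG
  have h1 : ∀ S : Finset V, (if Bad D F s S then ENNReal.ofReal (∑ y ∈ S, w y) else 0) ≤
      ENNReal.ofReal (2 / s) * ∑' y, (if Bad D F s S ∧ y ∈ S then G y else 0) := by
    intro S
    by_cases hb : Bad D F s S
    · simp only [hb, if_true, true_and]
      have e1 : (∑' y, if y ∈ S then G y else 0) =
          ENNReal.ofReal (∑ y ∈ S, if s / 2 < F y then F y * w y else 0) := by
        rw [tsum_eq_sum (s := S) (fun y hy => if_neg hy), ENNReal.ofReal_sum_of_nonneg]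
        · apply Finset.sum_congr rfl
          intro y hy
          rw [if_pos hy, hG]
          dsimp only
          split_ifs <;> simp
        · intro y _
          have := mul_nonneg (hF y) (hw y).le
          split_ifs <;> simp [this]
      rw [e1, ← ENNReal.ofReal_mul (by positivity)]
      apply ENNReal.ofReal_le_ofReal
      obtain ⟨x, hx, h2⟩ := hb
      have hpos : 0 < ∑ y ∈ S, w y := W_pos hw (x := x) (by rw [hx]; exact mem_P D F s x)
      unfold avR at h2
      rw [lt_div_iff₀ hpos] at h2
      have h3 : ∑ y ∈ S, F y * w y ≤
          ∑ y ∈ S, (s / 2 * w y + if s / 2 < F y then F y * w y else 0) := by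
        apply Finset.sum_le_sum
        intro y _
        have := (hw y)
        split_ifs with h
        · have : 0 ≤ s / 2 * w y := by positivity
          linarith
        · push Not at h
          nlinarith
      rw [Finset.sum_add_distrib, ← Finset.mul_sum] at h3
      rw [div_mul_eq_mul_div, le_div_iff₀ hs]
      linarith
    · simp [if_neg hb]
  refine (ENNReal.tsum_le_tsum h1).trans ?_
  rw [ENNReal.tsum_mul_left, ENNReal.tsum_comm]
  gcongr with y
  rw [tsum_eq_single (P D F s y)]
  · split_ifs
    · exact le_rfl
    · exact zero_le
  · intro S hS
    rw [if_neg]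
    rintro ⟨hb, hy⟩
    exact hS (Bad_mem D F hb hy).1

open Classical in
lemma bad_cover {s : ℝ} :
    (∑' x, if s < avR w F (P D F s x) then ENNReal.ofReal (w x) else 0) ≤
      ∑' S : Finset V, if Bad D F s S then ENNReal.ofReal (∑ y ∈ S, w y) else 0 := by
  have h1 : ∀ S : Finset V, (if Bad D F s S then ENNReal.ofReal (∑ y ∈ S, w y) else 0) =
      ∑' y, (if Bad D F s S ∧ y ∈ S then ENNReal.ofReal (w y) else 0) := by
    intro S
    by_cases hb : Bad D F s S
    · simp only [hb, if_true, true_and]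
      rw [tsum_eq_sum (s := S) (fun y hy => if_neg hy),
        ENNReal.ofReal_sum_of_nonneg (fun y _ => (hw y).le)]
      exact Finset.sum_congr rfl fun y hy => (if_pos hy).symm
    · simp [hb]
  simp only [h1]
  rw [ENNReal.tsum_comm]
  gcongr with x
  split_ifs with h
  · refine le_trans ?_ (ENNReal.le_tsum (P D F s x))
    rw [if_pos ⟨⟨x, rfl, h⟩, mem_P D F s x⟩]
  · exact zero_le

end abstract_part
end CZ
namespace CZ
section tree_part

variable {q : ℕ} (T : HomTree q)

/-- The vertex directly above. -/
noncomputable def up (x : T.V) : T.V := (T.unique_above x).choose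

lemma up_adj (x : T.V) : T.G.Adj x (up T x) := (T.unique_above x).choose_spec.1.1
lemma up_lev (x : T.V) : T.lev (up T x) = T.lev x + 1 := (T.unique_above x).choose_spec.1.2
lemma up_uniq {x y : T.V} (h : T.G.Adj x y) (hl : T.lev y = T.lev x + 1) : y = up T x :=
  (T.unique_above x).choose_spec.2 y ⟨h, hl⟩

lemma lev_iter (n : ℕ) (x : T.V) : T.lev ((up T)^[n] x) = T.lev x + n := by
  induction n with
  | zero => simp
  | succ n ih => rw [Function.iterate_succ_apply', up_lev, ih]; push_cast; ring

lemma adj_iff (x y : T.V) : T.G.Adj x y ↔ y = up T x ∨ up T y = x := by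
  constructor
  · intro h
    rcases T.lev_adj x y h with h1 | h1
    · left; exact up_uniq T h h1
    · right; exact (up_uniq T h.symm (by omega)).symm
  · rintro (rfl | rfl)
    · exact up_adj T x
    · exact (up_adj T y).symm

lemma children_ncard (x : T.V) : {y | up T y = x}.Finite ∧ {y | up T y = x}.ncard = q := by
  have h1 : T.G.neighborSet x = insert (up T x) {y | up T y = x} := by
    ext y; simp [adj_iff]
  have h2 := T.degree x
  have hfin : (T.G.neighborSet x).Finite := Set.finite_of_ncard_ne_zero (by omega)
  have hf : {y | up T y = x}.Finite := hfin.subset (by rw [h1]; exact Set.subset_insert _ _)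
  refine ⟨hf, ?_⟩
  rw [h1, Set.ncard_insert_of_notMem ?_ hf] at h2
  · omega
  · intro h
    have h3 := congrArg T.lev (show up T (up T x) = x from h)
    rw [up_lev, up_lev] at h3
    omega

lemma des_fin (r : T.V) (n : ℕ) : {y | (up T)^[n] y = r}.Finite := by
  induction n generalizing r with
  | zero => simp
  | succ n ih =>
    have : {y | (up T)^[n+1] y = r} = ⋃ c ∈ {c | up T c = r}, {y | (up T)^[n] y = c} := by
      ext y; simp [Function.iterate_succ_apply']
    rw [this]
    exact (children_ncard T r).1.biUnion fun c _ => ih c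

noncomputable def Des (r : T.V) (n : ℕ) : Finset T.V := (des_fin T r n).toFinset

lemma mem_Des {r y : T.V} {n : ℕ} : y ∈ Des T r n ↔ (up T)^[n] y = r := by simp [Des]

noncomputable def wt (x : T.V) : ℝ := (q : ℝ) ^ (T.lev x)

lemma Des_W (hq : 2 ≤ q) (r : T.V) (n : ℕ) : ∑ y ∈ Des T r n, wt T y = wt T r := by
  classical
  induction n generalizing r with
  | zero =>
    have : Des T r 0 = {r} := by ext y; simp [mem_Des]
    simp [this]
  | succ n ih =>
    have : Des T r (n+1) = (Des T r 1).biUnion fun c => Des T c n := by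
      ext y; simp [mem_Des, Function.iterate_succ_apply']
    rw [this, Finset.sum_biUnion]
    · simp only [ih]
      have hc : ∀ c ∈ Des T r 1, wt T c = (q:ℝ)^(T.lev r - 1) := by
        intro c hc
        rw [mem_Des] at hc
        have := lev_iter T 1 c
        rw [hc] at this
        unfold wt
        congr 1; push_cast at this; omega
      rw [Finset.sum_congr rfl hc, Finset.sum_const]
      have hcard : (Des T r 1).card = q := by
        rw [Des, ← Set.ncard_eq_toFinset_card _ (des_fin T r 1)]
        exact (children_ncard T r).2
      have hq0 : (q:ℝ) ≠ 0 := by positivity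
      rw [hcard, nsmul_eq_mul, wt, zpow_sub_one₀ hq0]
      field_simp
    · intro c _ c' _ hne
      rw [Function.onFun, Finset.disjoint_left]
      intro y hy hy'
      rw [mem_Des] at hy hy'
      exact hne (hy.symm.trans hy')

open Classical in
/-- vertices at depth in `[a,b)` below `r` -/
noncomputable def Tr (r : T.V) (a b : ℕ) : Finset T.V := (Finset.Ico a b).biUnion (Des T r)

lemma mem_Tr {r y : T.V} {a b : ℕ} : y ∈ Tr T r a b ↔ ∃ e, a ≤ e ∧ e < b ∧ (up T)^[e] y = r := by
  simp [Tr, mem_Des, and_assoc]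

lemma Tr_W (hq : 2 ≤ q) (r : T.V) (a b : ℕ) :
    ∑ y ∈ Tr T r a b, wt T y = ((b - a : ℕ) : ℝ) * wt T r := by
  classical
  rw [Tr, Finset.sum_biUnion]
  · simp [Des_W T hq]
  · intro c _ c' _ hne
    rw [Function.onFun, Finset.disjoint_left]
    intro y hy hy'
    rw [mem_Des] at hy hy'
    have h1 := lev_iter T c y
    have h2 := lev_iter T c' y
    rw [hy] at h1; rw [hy'] at h2
    apply hne; omega

lemma wt_pos (hq : 2 ≤ q) (x : T.V) : 0 < wt T x := by
  have : (0:ℝ) < q := by positivity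
  exact zpow_pos this _

/-- dyadic splitting of the state `(d,a,b)` -/
def step (s : ℕ × ℕ × ℕ) : ℕ × ℕ × ℕ :=
  if 3 * s.2.1 ≤ s.2.2 then
    (if s.1 < 2 * s.2.1 then (s.1, s.2.1, 2 * s.2.1) else (s.1, 2 * s.2.1, s.2.2))
  else (s.1 - 1, s.2.1 - 1, s.2.2 - 1)

def Inv (s : ℕ × ℕ × ℕ) : Prop :=
  s.2.1 ≤ s.1 ∧ s.1 < s.2.2 ∧ ((s.2.1 = 0 ∧ s.2.2 = 1) ∨
    (1 ≤ s.2.1 ∧ 3 * s.2.1 ≤ 2 * s.2.2 ∧ s.2.2 ≤ 4 * s.2.1))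

lemma Inv_step {s : ℕ × ℕ × ℕ} (h : Inv s) : Inv (step s) := by
  obtain ⟨d, a, b⟩ := s
  unfold Inv at h
  unfold step Inv
  dsimp only at h ⊢
  split_ifs <;> dsimp only <;> omega

noncomputable def startState (L : ℤ) (x : T.V) : ℕ × ℕ × ℕ :=
  if T.lev x < L then
    ((L - T.lev x).toNat, 2 ^ Nat.log 2 (L - T.lev x).toNat, 2 * 2 ^ Nat.log 2 (L - T.lev x).toNat)
  else (0, 0, 1)

lemma Inv_start (L : ℤ) (x : T.V) : Inv (startState T L x) := by
  unfold startState
  split_ifs with h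
  · have h0 : (L - T.lev x).toNat ≠ 0 := by omega
    have h1 := Nat.pow_log_le_self 2 h0
    have h2 := Nat.lt_pow_succ_log_self (b := 2) (by norm_num) (L - T.lev x).toNat
    have h3 : 0 < 2 ^ Nat.log 2 (L - T.lev x).toNat := by positivity
    rw [pow_succ] at h2
    unfold Inv
    dsimp only
    omega
  · unfold Inv; dsimp only; omega

noncomputable def st (L : ℤ) (n : ℕ) (x : T.V) : ℕ × ℕ × ℕ := step^[n] (startState T L x)

lemma st_succ (L : ℤ) (n : ℕ) (x : T.V) : st T L (n+1) x = step (st T L n x) := by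
  unfold st; rw [Function.iterate_succ_apply']

lemma Inv_st (L : ℤ) (n : ℕ) (x : T.V) : Inv (st T L n x) := by
  induction n with
  | zero => exact Inv_start T L x
  | succ n ih => rw [st_succ]; exact Inv_step ih

noncomputable def node (x : T.V) (s : ℕ × ℕ × ℕ) : Finset T.V := Tr T ((up T)^[s.1] x) s.2.1 s.2.2

lemma node_step (x : T.V) {s : ℕ × ℕ × ℕ} (h : Inv s) : node T x (step s) ⊆ node T x s := by
  obtain ⟨d, a, b⟩ := s
  intro y hy
  unfold Inv at h
  unfold node at *
  unfold step at hy
  dsimp only at h hy ⊢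
  rw [mem_Tr]
  split_ifs at hy with h1 h2
  · rw [mem_Tr] at hy
    obtain ⟨e, h3, h4, h5⟩ := hy
    dsimp only at *
    exact ⟨e, by omega, by omega, h5⟩
  · rw [mem_Tr] at hy
    obtain ⟨e, h3, h4, h5⟩ := hy
    dsimp only at *
    exact ⟨e, by omega, by omega, h5⟩
  · rw [mem_Tr] at hy
    obtain ⟨e, h3, h4, h5⟩ := hy
    dsimp only at *
    refine ⟨e+1, by omega, by omega, ?_⟩
    obtain ⟨d, rfl⟩ : ∃ d', d = d' + 1 := ⟨d - 1, by omega⟩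
    rw [Function.iterate_succ_apply', Function.iterate_succ_apply', h5]
    rfl

lemma st_eq (L : ℤ) (n : ℕ) {x y : T.V} (hy : y ∈ node T x (st T L n x)) :
    (st T L n y).2 = (st T L n x).2 ∧
      (up T)^[(st T L n y).1] y = (up T)^[(st T L n x).1] x := by
  induction n with
  | zero =>
    unfold node at hy
    rw [mem_Tr] at hy
    obtain ⟨e, h1, h2, h3⟩ := hy
    have h4 := lev_iter T e y
    rw [h3, lev_iter] at h4
    change _ ≤ _ at h1
    simp only [st, Function.iterate_zero, id_eq] at *
    unfold startState at *
    by_cases h : T.lev x < L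
    · simp only [if_pos h] at *
      have hpos : 0 < 2 ^ Nat.log 2 (L - T.lev x).toNat := by positivity
      have hyL : T.lev y < L := by omega
      have he : (L - T.lev y).toNat = e := by omega
      simp only [if_pos hyL, he]
      have : Nat.log 2 e = Nat.log 2 (L - T.lev x).toNat := by
        apply Nat.log_eq_of_pow_le_of_lt_pow h1
        rw [pow_succ]; omega
      rw [this]
      exact ⟨rfl, h3⟩
    · simp only [if_neg h] at *
      have : e = 0 := by omega
      subst this
      have : y = x := by simpa using h3
      subst this
      simp [h]
  | succ n ih =>
    have hI := Inv_st T L n x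
    rw [st_succ] at hy
    obtain ⟨e1, e2⟩ := ih (node_step T x hI hy)
    have hIy := Inv_st T L n y
    rw [st_succ, st_succ]
    generalize st T L n x = s at *
    generalize st T L n y = t at *
    obtain ⟨d, a, b⟩ := s
    obtain ⟨d', a', b'⟩ := t
    simp only [Prod.mk.injEq] at e1 e2
    obtain ⟨rfl, rfl⟩ := e1
    have hl := lev_iter T d' y
    rw [e2, lev_iter] at hl
    unfold node at hy
    rw [mem_Tr] at hy
    obtain ⟨e, h1, h2, h3⟩ := hy
    have h4 := lev_iter T e y
    rw [h3, lev_iter] at h4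
    unfold Inv at hI hIy
    unfold step at *
    dsimp only at *
    by_cases c1 : 3 * a' ≤ b'
    · simp only [if_pos c1] at *
      by_cases c2 : d < 2 * a'
      · simp only [if_pos c2] at *
        have c3 : d' < 2 * a' := by omega
        simp only [if_pos c3]
        exact ⟨trivial, e2⟩
      · simp only [if_neg c2] at *
        have c3 : ¬ d' < 2 * a' := by omega
        simp only [if_neg c3]
        exact ⟨trivial, e2⟩
    · simp only [if_neg c1] at *
      have : d' - 1 = e := by omega
      rw [this]
      exact ⟨trivial, h3⟩

lemma node_dbl (hq : 2 ≤ q) (x : T.V) {s : ℕ × ℕ × ℕ} (h : Inv s) :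
    ∑ y ∈ node T x s, wt T y ≤ ((q:ℝ) + 3) * ∑ y ∈ node T x (step s), wt T y := by
  obtain ⟨d, a, b⟩ := s
  unfold Inv at h
  unfold node
  rw [Tr_W T hq, Tr_W T hq]
  unfold step
  dsimp only at h ⊢
  have hq' : (2:ℝ) ≤ q := by exact_mod_cast hq
  split_ifs with h1 h2
  · dsimp only
    have hp := wt_pos T hq ((up T)^[d] x)
    have : ((b - a : ℕ):ℝ) ≤ 3 * ((2 * a - a : ℕ) : ℝ) := by
      exact_mod_cast (by omega : b - a ≤ 3 * (2 * a - a))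
    have h0 : (0:ℝ) ≤ ((2 * a - a : ℕ) : ℝ) := by positivity
    rw [← mul_assoc]
    gcongr
    nlinarith
  · dsimp only
    have hp := wt_pos T hq ((up T)^[d] x)
    have : ((b - a : ℕ):ℝ) ≤ 3 * ((b - 2 * a : ℕ) : ℝ) := by
      exact_mod_cast (by omega : b - a ≤ 3 * (b - 2 * a))
    have h0 : (0:ℝ) ≤ ((b - 2 * a : ℕ) : ℝ) := by positivity
    rw [← mul_assoc]
    gcongr
    nlinarith
  · dsimp only
    obtain ⟨d, rfl⟩ : ∃ d', d = d' + 1 := ⟨d - 1, by omega⟩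
    have hp := wt_pos T hq ((up T)^[d] x)
    have e1 : b - 1 - (a - 1) = b - a := by omega
    have e2 : wt T ((up T)^[d+1] x) = q * wt T ((up T)^[d] x) := by
      rw [Function.iterate_succ_apply']
      unfold wt
      rw [up_lev, zpow_add_one₀ (by positivity)]; ring
    rw [e1, e2, Nat.add_sub_cancel]
    have h0 : (0:ℝ) ≤ ((b - a : ℕ) : ℝ) := by positivity
    have := mul_nonneg h0 hp.le
    nlinarith

lemma node_single (x : T.V) {s : ℕ × ℕ × ℕ} (h : s = (0,0,1)) : node T x s = {x} := by
  subst h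
  ext y
  unfold node
  rw [mem_Tr]
  simp only [Function.iterate_zero, id_eq, Finset.mem_singleton]
  constructor
  · rintro ⟨e, _, h2, h3⟩
    have : e = 0 := by omega
    subst this; simpa using h3
  · rintro rfl; exact ⟨0, le_rfl, by norm_num, rfl⟩

lemma st_term (L : ℤ) (x : T.V) : ∃ n, st T L n x = (0,0,1) := by
  by_contra hne
  push Not at hne
  have key : ∀ n, 2 * (st T L n x).2.2 - (st T L n x).2.1 + n ≤
      2 * (st T L 0 x).2.2 - (st T L 0 x).2.1 := by
    intro n
    induction n with
    | zero => omega
    | succ n ih =>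
      have h1 := hne n
      have hI := Inv_st T L n x
      rw [st_succ]
      generalize 2 * (st T L 0 x).2.2 - (st T L 0 x).2.1 = M at *
      generalize st T L n x = s at *
      obtain ⟨d, a, b⟩ := s
      have ha : 1 ≤ a := by
        unfold Inv at hI
        dsimp only at hI
        by_contra ha
        apply h1
        have : d = 0 := by omega
        have : a = 0 := by omega
        have : b = 1 := by omega
        subst_vars; rfl
      unfold Inv at hI
      unfold step
      dsimp only at *
      split_ifs <;> dsimp only <;> omega
  have := key (2 * (st T L 0 x).2.2 - (st T L 0 x).2.1 + 1)
  omega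

/-- The dyadic system on the tree. -/
noncomputable def sys (hq : 2 ≤ q) (L : ℤ) : DySys T.V (wt T) ((q:ℝ) + 3) where
  Q n x := node T x (st T L n x)
  mem n x := by
    have h := Inv_st T L n x
    unfold node; rw [mem_Tr]
    exact ⟨_, h.1, h.2.1, rfl⟩
  eqv n x y hy := by
    obtain ⟨h1, h2⟩ := st_eq T L n hy
    unfold node
    rw [h1, h2]
  anti n x := by
    rw [st_succ]; exact node_step T x (Inv_st T L n x)
  single x := by
    obtain ⟨n, hn⟩ := st_term T L x
    exact ⟨n, node_single T x hn⟩
  dbl n x := by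
    rw [st_succ]; exact node_dbl T hq x (Inv_st T L n x)

lemma sys_big (hq : 2 ≤ q) (L : ℤ) (x : T.V) :
    (q:ℝ) ^ L ≤ ∑ y ∈ (sys T hq L).Q 0 x, wt T y := by
  change _ ≤ ∑ y ∈ node T x (st T L 0 x), wt T y
  unfold node
  rw [Tr_W T hq, wt, lev_iter]
  simp only [st, Function.iterate_zero, id_eq]
  unfold startState
  have hq1 : (1:ℝ) ≤ q := by exact_mod_cast (by omega : 1 ≤ q)
  split_ifs with h
  · dsimp only
    have e : T.lev x + ((L - T.lev x).toNat : ℤ) = L := by omega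
    rw [e]
    have hpos : 0 < 2 ^ Nat.log 2 (L - T.lev x).toNat := by positivity
    have : (1:ℝ) ≤ ((2 * 2 ^ Nat.log 2 (L - T.lev x).toNat - 2 ^ Nat.log 2 (L - T.lev x).toNat : ℕ) : ℝ) := by
      exact_mod_cast (by omega : 1 ≤ _)
    have : 0 < (q:ℝ)^L := by positivity
    nlinarith
  · simp only [Nat.sub_zero, Nat.cast_one, one_mul, Nat.cast_zero, add_zero]
    exact zpow_le_zpow_right₀ hq1 (by omega)

lemma lev_dist (x y : T.V) : T.lev y ≤ T.lev x + T.dist x y := by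
  obtain ⟨p, hp⟩ := T.conn.exists_walk_length_eq_dist x y
  unfold HomTree.dist
  rw [← hp]
  clear hp
  induction p with
  | nil => simp
  | cons h p ih =>
    have := T.lev_adj _ _ h
    simp only [SimpleGraph.Walk.length_cons]
    push_cast
    omega

lemma dist_iter (n : ℕ) (x : T.V) : T.dist x ((up T)^[n] x) ≤ n := by
  induction n generalizing x with
  | zero => simp [HomTree.dist]
  | succ n ih =>
    rw [Function.iterate_succ_apply]
    have h1 := T.conn.dist_triangle (u := x) (v := up T x) (w := (up T)^[n] (up T x))
    have h2 := ih (up T x)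
    have h3 := SimpleGraph.dist_eq_one_iff_adj.2 (up_adj T x)
    unfold HomTree.dist at *
    omega

lemma below_iter (n : ℕ) (x : T.V) : T.below x ((up T)^[n] x) := by
  have h1 := dist_iter T n x
  have h2 := lev_dist T x ((up T)^[n] x)
  have h3 := lev_iter T n x
  unfold HomTree.below
  omega

lemma iter_of_below (n : ℕ) (x y : T.V) (h : T.below x y) (hn : T.dist x y = n) :
    (up T)^[n] x = y := by
  induction n generalizing x with
  | zero =>
    unfold HomTree.dist at hn
    exact (T.conn.dist_eq_zero_iff).1 hn
  | succ n ih =>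
    obtain ⟨p, hp⟩ := T.conn.exists_walk_length_eq_dist x y
    unfold HomTree.below at h
    rw [hn] at h
    have hn' := hn
    unfold HomTree.dist at hn'
    rw [hn'] at hp
    cases p with
    | nil => simp at hp
    | @cons _ z _ hadj p =>
      simp only [SimpleGraph.Walk.length_cons, Nat.add_right_cancel_iff] at hp
      have h1 : T.dist z y ≤ n := by
        rw [← hp]; exact SimpleGraph.dist_le p
      have h2 := lev_dist T z y
      have h3 := T.lev_adj _ _ hadj
      push_cast at h
      have hz : z = up T x := up_uniq T hadj (by omega)
      rw [Function.iterate_succ_apply, ← hz]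
      apply ih
      · unfold HomTree.below; omega
      · omega

lemma qcast (hq : 2 ≤ q) (x : T.V) : (q : ℝ≥0∞) ^ (T.lev x) = ENNReal.ofReal (wt T x) := by
  unfold wt
  have hq0 : (q : ℝ≥0) ≠ 0 := by
    have : q ≠ 0 := by omega
    exact_mod_cast this
  have h1 : ((q : ℝ) ^ (T.lev x)) = (((q : ℝ≥0) ^ (T.lev x) : ℝ≥0) : ℝ) := by push_cast; rfl
  rw [h1, ENNReal.ofReal_coe_nnreal, ENNReal.coe_zpow hq0]
  simp

lemma mu_le (hq : 2 ≤ q) (A : Set T.V) (S : Finset T.V) (h : A ⊆ S) :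
    T.mu A ≤ ENNReal.ofReal (∑ y ∈ S, wt T y) := by
  unfold HomTree.mu
  simp only [qcast T hq]
  calc _ ≤ ∑' y : (S : Set T.V), ENNReal.ofReal (wt T y.1) :=
        ENNReal.tsum_mono_subtype (fun y => ENNReal.ofReal (wt T y)) h
    _ = _ := by
      rw [ENNReal.ofReal_sum_of_nonneg (fun y _ => (wt_pos T hq y).le)]
      exact Finset.tsum_subtype S (fun y => ENNReal.ofReal (wt T y))

lemma sys_env (hq : 2 ≤ q) (L : ℤ) (n : ℕ) (x : T.V) :
    ∃ R : T.Trapezoid, ((sys T hq L).Q n x : Set T.V) ⊆ R.envelope ∧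
      T.mu R.envelope ≤ ENNReal.ofReal (8 * ∑ y ∈ (sys T hq L).Q n x, wt T y) := by
  change ∃ R : T.Trapezoid, (node T x (st T L n x) : Set T.V) ⊆ R.envelope ∧
      T.mu R.envelope ≤ ENNReal.ofReal (8 * ∑ y ∈ node T x (st T L n x), wt T y)
  have hI := Inv_st T L n x
  generalize st T L n x = s at *
  obtain ⟨d, a, b⟩ := s
  unfold Inv at hI
  dsimp only at hI
  rcases hI with ⟨h1, h2, ⟨rfl, rfl⟩ | ⟨h3, h4, h5⟩⟩
  · have : d = 0 := by omega
    subst this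
    rw [node_single T x rfl]
    refine ⟨⟨x, 1, true, le_rfl, fun _ => rfl⟩, ?_, ?_⟩
    · simp [HomTree.Trapezoid.envelope]
    · refine (mu_le T hq _ {x} (by simp [HomTree.Trapezoid.envelope])).trans ?_
      apply ENNReal.ofReal_le_ofReal
      have := wt_pos T hq x
      simp only [Finset.sum_singleton]
      linarith
  · refine ⟨⟨(up T)^[d] x, a, false, h3, by simp⟩, ?_, ?_⟩
    · intro y hy
      unfold node at hy
      rw [Finset.mem_coe, mem_Tr] at hy
      obtain ⟨e, e1, e2, e3⟩ := hy
      have e4 := lev_iter T e y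
      have e5 := below_iter T e y
      dsimp only at *
      rw [e3] at e4 e5
      simp only [HomTree.Trapezoid.envelope, Bool.false_eq_true, if_false, Set.mem_ofPred_eq]
      exact ⟨e5, by omega, by omega⟩
    · refine (mu_le T hq _ (Tr T ((up T)^[d] x) 0 (4 * a)) ?_).trans ?_
      · intro y hy
        simp only [HomTree.Trapezoid.envelope, Bool.false_eq_true, if_false, Set.mem_ofPred_eq] at hy
        obtain ⟨y1, y2, y3⟩ := hy
        rw [Finset.mem_coe, mem_Tr]
        refine ⟨_, Nat.zero_le _, ?_, iter_of_below T _ y _ y1 rfl⟩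
        unfold HomTree.below at y1
        omega
      · apply ENNReal.ofReal_le_ofReal
        unfold node
        rw [Tr_W T hq, Tr_W T hq, ← mul_assoc]
        have := wt_pos T hq ((up T)^[d] x)
        gcongr
        exact_mod_cast (by omega : 4 * a - 0 ≤ 8 * (b - a))

lemma V_countable : Countable T.V := by
  let x₀ := T.geo 0
  have h1 : {y | ∃ m n : ℕ, (up T)^[m] y = (up T)^[n] x₀}.Countable := by
    have : {y | ∃ m n : ℕ, (up T)^[m] y = (up T)^[n] x₀} =
        ⋃ m : ℕ, ⋃ n : ℕ, {y | (up T)^[m] y = (up T)^[n] x₀} := by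
      ext y; simp
    rw [this]
    exact Set.countable_iUnion fun m => Set.countable_iUnion fun n => (des_fin T _ m).countable
  have h2 : {y | ∃ m n : ℕ, (up T)^[m] y = (up T)^[n] x₀} = Set.univ := by
    rw [Set.eq_univ_iff_forall]
    intro y
    obtain ⟨p⟩ := T.conn.preconnected y x₀
    generalize hz : x₀ = z at p
    rw [← hz]
    change ∃ m n : ℕ, (up T)^[m] y = (up T)^[n] x₀
    induction p with
    | nil => exact ⟨0, 0, by simp [hz]⟩
    | @cons u v _ hadj p ih =>
      obtain ⟨m, n, hmn⟩ := ih hz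
      rcases (adj_iff T u v).1 hadj with h | h
      · exact ⟨m+1, n, by rw [Function.iterate_succ_apply, ← h, hmn]⟩
      · refine ⟨m, n+1, ?_⟩
        rw [Function.iterate_succ_apply', ← hmn, ← h, ← Function.iterate_succ_apply,
          Function.iterate_succ_apply']
  rw [h2] at h1
  exact Set.countable_univ_iff.1 h1

end tree_part
end CZ
namespace CZ
section final_part

variable {q : ℕ} (T : HomTree q)

lemma zero_atom : T.IsInftyAtom 0 :=
  ⟨⟨T.geo 0, 1, true, le_rfl, fun _ => rfl⟩, by simp, by simp, by simp⟩

lemma H1_le {ι : Type} [Countable ι] (c : ι → ℂ) (a : ι → T.V → ℂ) (ha : ∀ i, T.IsInftyAtom (a i))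
    (h : T.V → ℂ) (hs : ∀ x, HasSum (fun i => c i * a i x) (h x)) :
    T.H1Norm h ≤ ∑' i, (‖c i‖₊ : ℝ≥0∞) := by
  obtain ⟨e, he⟩ := exists_injective_nat ι
  unfold HomTree.H1Norm
  have h1 : (∀ n, T.IsInftyAtom (Function.extend e a 0 n)) ∧
      ∀ x, HasSum (fun n => Function.extend e c 0 n * Function.extend e a 0 n x) (h x) := by
    constructor
    · intro n
      by_cases hn : ∃ i, e i = n
      · obtain ⟨i, rfl⟩ := hn
        rw [he.extend_apply]; exact ha i
      · rw [Function.extend_apply' _ _ _ hn]; exact zero_atom T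
    · intro x
      rw [← he.hasSum_iff]
      · convert hs x using 2 with i
        simp [he.extend_apply]
      · intro n hn
        rw [Function.extend_apply' _ _ _ (by simpa using hn)]
        simp
  refine iInf_le_of_le (Function.extend e c 0) ?_
  refine iInf_le_of_le (Function.extend e a 0) ?_
  refine iInf_le_of_le h1 ?_
  rw [← he.tsum_eq]
  · simp [he.extend_apply]
  · intro n hn
    by_contra hn'
    apply hn
    simp only
    rw [Function.extend_apply' _ _ _ (by simpa using hn')]
    simp

lemma lpPow_eq (hq : 2 ≤ q) (f : T.V → ℂ) {p : ℝ} (hp : 0 ≤ p) :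
    T.lpPow f p = ∑' x, ENNReal.ofReal (‖f x‖ ^ p * wt T x) := by
  unfold HomTree.lpPow
  congr 1
  ext x
  rw [qcast T hq, ENNReal.ofReal_mul (by positivity),
    ← ENNReal.ofReal_rpow_of_nonneg (norm_nonneg _) hp, ofReal_norm]
  rfl

lemma le_rpow {t F p : ℝ} (ht : 0 < t) (h : t ≤ F) (hp : 1 < p) : F ≤ t ^ (1 - p) * F ^ p := by
  have hF : 0 < F := ht.trans_le h
  calc F = F ^ (1 - p) * F ^ p := by rw [← Real.rpow_add hF]; simp
    _ ≤ _ := by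
      have := Real.rpow_le_rpow_of_nonpos ht h (by linarith : 1 - p ≤ 0)
      gcongr

/-- averages on the starting sets are at most `2 * lam` -/
lemma avg_start (hq : 2 ≤ q) (f : T.V → ℂ) {p lam : ℝ} (hp : 1 < p) (hl : 0 < lam)
    (hf : T.lpPow f p ≠ ⊤) (S : Finset T.V) {x : T.V} (hx : x ∈ S)
    (hS : (T.lpPow f p).toReal ≤ lam ^ p * ∑ y ∈ S, wt T y) :
    avR (wt T) (fun x => ‖f x‖) S ≤ 2 * lam := by
  have hpos := W_pos (wt_pos T hq) hx
  unfold avR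
  rw [div_le_iff₀ hpos]
  have h1 : ∑ y ∈ S, ‖f y‖ ^ p * wt T y ≤ (T.lpPow f p).toReal := by
    rw [← ENNReal.ofReal_le_iff_le_toReal hf, lpPow_eq T hq f (by linarith),
      ENNReal.ofReal_sum_of_nonneg]
    · exact ENNReal.sum_le_tsum S
    · intro y _
      have := wt_pos T hq y
      positivity
  have h2 : ∑ y ∈ S, ‖f y‖ * wt T y ≤
      ∑ y ∈ S, (lam * wt T y + lam ^ (1 - p) * (‖f y‖ ^ p * wt T y)) := by
    apply Finset.sum_le_sum
    intro y _
    have hw := wt_pos T hq y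
    rcases le_total ‖f y‖ lam with h | h
    · have : 0 ≤ lam ^ (1 - p) * (‖f y‖ ^ p * wt T y) := by positivity
      nlinarith
    · have := le_rpow hl h hp
      have h3 : 0 ≤ lam * wt T y := by positivity
      nlinarith
  rw [Finset.sum_add_distrib, ← Finset.mul_sum, ← Finset.mul_sum] at h2
  have h3 : lam ^ (1 - p) * ∑ y ∈ S, ‖f y‖ ^ p * wt T y ≤ lam * ∑ y ∈ S, wt T y := by
    calc _ ≤ lam ^ (1 - p) * (lam ^ p * ∑ y ∈ S, wt T y) := by
          have := h1.trans hS
          gcongr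
      _ = (lam ^ (1 - p) * lam ^ p) * ∑ y ∈ S, wt T y := by ring
      _ = _ := by rw [← Real.rpow_add hl]; simp
  linarith

lemma exists_L (hq : 2 ≤ q) (A : ℝ) : ∃ L : ℤ, A ≤ (q:ℝ) ^ L := by
  have hq1 : (1:ℝ) < q := by exact_mod_cast (by omega : 1 < q)
  obtain ⟨n, hn⟩ := pow_unbounded_of_one_lt A hq1
  exact ⟨n, by simpa using hn.le⟩

open Classical in
/-- The tail of `f` above height `t`. -/
noncomputable def tail (f : T.V → ℂ) (t : ℝ) (y : T.V) : ℝ≥0∞ :=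
  if t < ‖f y‖ then ENNReal.ofReal (‖f y‖ * wt T y) else 0

lemma tail_le (hq : 2 ≤ q) (f : T.V → ℂ) {p t : ℝ} (hp : 1 < p) (ht : 0 < t) (y : T.V) :
    tail T f t y ≤ ENNReal.ofReal (t ^ (1 - p)) * ENNReal.ofReal (‖f y‖ ^ p * wt T y) := by
  unfold tail
  split_ifs with h
  · rw [← ENNReal.ofReal_mul (by positivity)]
    apply ENNReal.ofReal_le_ofReal
    have := le_rpow ht h.le hp
    have hw := wt_pos T hq y
    nlinarith
  · exact zero_le

lemma tail_sum (hq : 2 ≤ q) (f : T.V → ℂ) {p t : ℝ} (hp : 1 < p) (ht : 0 < t) :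
    ∑' y, tail T f t y ≤ ENNReal.ofReal (t ^ (1 - p)) * T.lpPow f p := by
  rw [lpPow_eq T hq f (by linarith), ← ENNReal.tsum_mul_left]
  exact ENNReal.tsum_le_tsum (tail_le T hq f hp ht)

lemma tail_sum_sum (hq : 2 ≤ q) (f : T.V → ℂ) {p t : ℝ} (hp : 1 < p) (ht : 0 < t) :
    ∑' k : ℕ, ∑' y, tail T f (2 ^ k * t) y ≤
      ENNReal.ofReal ((1 - 2 ^ (1 - p))⁻¹) * (ENNReal.ofReal (t ^ (1 - p)) * T.lpPow f p) := by
  have hr0 : (0:ℝ) ≤ 2 ^ (1 - p) := by positivity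
  have hr1 : (2:ℝ) ^ (1 - p) < 1 := Real.rpow_lt_one_of_one_lt_of_neg (by norm_num) (by linarith)
  have h1 : ∀ k : ℕ, ∑' y, tail T f (2 ^ k * t) y ≤
      ENNReal.ofReal (((2:ℝ) ^ (1 - p)) ^ k) * (ENNReal.ofReal (t ^ (1 - p)) * T.lpPow f p) := by
    intro k
    refine (tail_sum T hq f hp (by positivity)).trans (le_of_eq ?_)
    rw [Real.mul_rpow (by positivity) ht.le, ENNReal.ofReal_mul (by positivity), mul_assoc]
    congr 2
    rw [← Real.rpow_natCast, ← Real.rpow_natCast, ← Real.rpow_mul (by norm_num),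
      ← Real.rpow_mul (by norm_num), mul_comm]
  refine (ENNReal.tsum_le_tsum h1).trans ?_
  rw [ENNReal.tsum_mul_right, ← tsum_geometric_of_lt_one hr0 hr1,
    ENNReal.ofReal_tsum_of_nonneg (fun n => by positivity) (summable_geometric_of_lt_one hr0 hr1)]

section decomposition
variable {K : ℝ} (D : DySys T.V (wt T) K) (f : T.V → ℂ) (lam : ℝ)

/-- stopped averages at height `2 ^ k * (2 * lam)` -/
noncomputable def E (k : ℕ) (x : T.V) : ℂ :=
  avC (wt T) f (P D (fun x => ‖f x‖) (2 ^ k * (2 * lam)) x)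

variable (hq : 2 ≤ q) (hl : 0 < lam) (hK : 1 ≤ K)
  (h0 : ∀ x, avR (wt T) (fun x => ‖f x‖) (D.Q 0 x) ≤ 2 * lam)
include hq hl

include h0 hK in
lemma E_norm (k : ℕ) (x : T.V) : ‖E T D f lam k x‖ ≤ K * (2 ^ k * (2 * lam)) := by
  refine (norm_avC (wt_pos T hq) f _).trans ?_
  refine P_bound D (fun x => ‖f x‖) (wt_pos T hq) (fun x => norm_nonneg _) hK (by positivity) x ?_
  · refine (h0 x).trans ?_
    have : (1:ℝ) ≤ 2 ^ k := one_le_pow₀ (by norm_num)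
    nlinarith

lemma height_mono (k : ℕ) : (2:ℝ) ^ k * (2 * lam) ≤ 2 ^ (k+1) * (2 * lam) := by
  rw [pow_succ]
  have : (0:ℝ) < 2 ^ k * (2 * lam) := by positivity
  linarith

lemma E_good (k : ℕ) (x : T.V) (h : P D (fun x => ‖f x‖) (2 ^ k * (2 * lam)) x = {x}) :
    E T D f lam k x = f x := by
  unfold E
  rw [h, avC_single (wt_pos T hq)]

lemma E_good' (k : ℕ) (x : T.V) (h : P D (fun x => ‖f x‖) (2 ^ k * (2 * lam)) x = {x}) :
    E T D f lam (k+1) x = f x := by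
  apply E_good T D f lam hq hl
  have h1 := P_anti D (fun x => ‖f x‖) (height_mono lam hq hl k) x
  rw [h] at h1
  exact Finset.Subset.antisymm h1 (by simpa using mem_P D _ _ x)

lemma E_event (x : T.V) : ∃ N : ℕ, ∀ k, N ≤ k → E T D f lam k x = f x := by
  obtain ⟨s0, hs0⟩ := P_event D (fun x => ‖f x‖) (wt_pos T hq) (fun x => norm_nonneg _) x
  obtain ⟨N, hN⟩ := pow_unbounded_of_one_lt (s0 / (2 * lam)) (by norm_num : (1:ℝ) < 2)
  refine ⟨N, fun k hk => E_good T D f lam hq hl k x (hs0 _ ?_)⟩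
  rw [div_lt_iff₀ (by positivity)] at hN
  have : (2:ℝ) ^ N ≤ 2 ^ k := pow_le_pow_right₀ (by norm_num) hk
  nlinarith

open Classical in
include h0 hK in
lemma H1_bound (hR : ∀ n x, ∃ R : T.Trapezoid, (D.Q n x : Set T.V) ⊆ R.envelope ∧
      T.mu R.envelope ≤ ENNReal.ofReal (8 * ∑ y ∈ D.Q n x, wt T y)) :
    T.H1Norm (fun x => f x - E T D f lam 0 x) ≤
      ENNReal.ofReal (48 * K) * ∑' k : ℕ, ∑' y, tail T f (2 ^ k * lam) y := by
  have := V_countable T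
  set F : T.V → ℝ := fun x => ‖f x‖ with hF
  set s : ℕ → ℝ := fun k => 2 ^ k * (2 * lam) with hs
  have hspos : ∀ k, 0 < s k := fun k => by simp only [hs]; positivity
  have hKpos : 0 < K := by linarith
  set W : Finset T.V → ℝ := fun S => ∑ y ∈ S, wt T y with hW
  let m : ℕ → Finset T.V → ℝ := fun k S => 3 * K * s k * (8 * W S)
  let c : ℕ × Finset T.V → ℂ := fun i => if Bad D F (s i.1) i.2 then ((m i.1 i.2 : ℝ) : ℂ) else 0
  let a : ℕ × Finset T.V → T.V → ℂ := fun i x => if Bad D F (s i.1) i.2 ∧ x ∈ i.2 then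
    (E T D f lam (i.1+1) x - E T D f lam i.1 x) / ((m i.1 i.2 : ℝ) : ℂ) else 0
  have hWpos : ∀ k S, Bad D F (s k) S → 0 < W S := by
    rintro k S ⟨x, rfl, -⟩
    exact W_pos (wt_pos T hq) (mem_P D F (s k) x)
  have hmpos : ∀ k S, Bad D F (s k) S → 0 < m k S := by
    intro k S h
    have h1 := hWpos k S h
    have h2 := hspos k
    simp only [m]; positivity
  have hΔ : ∀ k x, ‖E T D f lam (k+1) x - E T D f lam k x‖ ≤ 3 * K * s k := by
    intro k x
    refine (norm_sub_le _ _).trans ?_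
    have h1 := E_norm T D f lam hq hl hK h0 k x
    have h2 := E_norm T D f lam hq hl hK h0 (k+1) x
    rw [pow_succ] at h2
    simp only [hs]
    nlinarith
  have hatom : ∀ i, T.IsInftyAtom (a i) := by
    rintro ⟨k, S⟩
    by_cases hb : Bad D F (s k) S
    · obtain ⟨x0, hx0, hav⟩ := id hb
      obtain ⟨R, hR1, hR2⟩ := hR (tau D F (s k) x0) x0
      change (P D F (s k) x0 : Set T.V) ⊆ _ at hR1
      change _ ≤ ENNReal.ofReal (8 * W (P D F (s k) x0)) at hR2
      rw [← hx0] at hR1 hR2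
      refine ⟨R, ?_, ?_, ?_⟩
      · intro x hx
        apply hR1
        by_contra hxS
        apply hx
        simp only [a]
        rw [if_neg]
        rintro ⟨-, h⟩; exact hxS h
      · intro x
        have hWp := hWpos k S hb
        have hmp := hmpos k S hb
        refine le_trans ?_ (ENNReal.inv_le_inv.2 hR2)
        rw [← ENNReal.ofReal_inv_of_pos (by positivity)]
        change ‖a (k, S) x‖ₑ ≤ _
        rw [← ofReal_norm]
        apply ENNReal.ofReal_le_ofReal
        simp only [a]
        split_ifs
        · rw [norm_div, Complex.norm_real, Real.norm_of_nonneg hmp.le, div_le_iff₀ hmp]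
          refine (hΔ k x).trans (le_of_eq ?_)
          simp only [m]
          field_simp
        · simp only [norm_zero]; positivity
      · rw [tsum_eq_sum (s := S)]
        · have := diff_mean_zero D F (wt_pos T hq) f (height_mono lam hq hl k) x0
          change ∑ y ∈ P D F (s k) x0, (E T D f lam (k+1) y - E T D f lam k y) * (wt T y : ℂ) = 0 at this
          rw [← hx0] at this
          calc _ = ∑ y ∈ S, ((E T D f lam (k+1) y - E T D f lam k y) * (wt T y : ℂ)) / ((m k S : ℝ) : ℂ) := by
                apply Finset.sum_congr rfl
                intro y hy
                simp only [a]
                rw [if_pos ⟨hb, hy⟩]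
                unfold wt
                push_cast
                ring
            _ = 0 := by rw [← Finset.sum_div, this, zero_div]
        · intro y hy
          simp only [a]
          rw [if_neg (fun h => hy h.2), zero_mul]
    · have : a (k, S) = 0 := by
        ext x
        simp only [a]
        rw [if_neg (fun h => hb h.1)]; rfl
      rw [this]; exact zero_atom T
  have hterm : ∀ i x, c i * a i x = if Bad D F (s i.1) i.2 ∧ x ∈ i.2 then
      (E T D f lam (i.1+1) x - E T D f lam i.1 x) else 0 := by
    rintro ⟨k, S⟩ x
    simp only [c, a]
    by_cases hb : Bad D F (s k) S
    · have : ((m k S : ℝ) : ℂ) ≠ 0 := by exact_mod_cast (hmpos k S hb).ne'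
      simp only [hb, if_true, true_and]
      split_ifs
      · field_simp
      · simp
    · simp [hb]
  have hsum : ∀ x, HasSum (fun i => c i * a i x) (f x - E T D f lam 0 x) := by
    intro x
    obtain ⟨N, hN⟩ := E_event T D f lam hq hl x
    let I : Finset (ℕ × Finset T.V) := (Finset.range N).image fun k => (k, P D F (s k) x)
    have e1 : f x - E T D f lam 0 x = ∑ i ∈ I, c i * a i x := by
      rw [Finset.sum_image (fun k _ k' _ h => by simpa using congrArg Prod.fst h), ← hN N le_rfl,
        ← Finset.sum_range_sub (fun k => E T D f lam k x)]
      apply Finset.sum_congr rfl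
      intro k _
      rw [hterm]
      split_ifs with h
      · rfl
      · rcases P_spec D F (s k) x with h1 | h1
        · exact absurd ⟨⟨x, rfl, h1⟩, mem_P D F (s k) x⟩ h
        · rw [E_good T D f lam hq hl k x h1, E_good' T D f lam hq hl k x h1, sub_self]
    rw [e1]
    apply hasSum_sum_of_ne_finset_zero
    rintro ⟨k, S⟩ hi
    rw [hterm]
    split_ifs with h
    · dsimp only at h ⊢
      by_cases hk : k < N
      · exfalso
        apply hi
        simp only [I, Finset.mem_image, Finset.mem_range]
        exact ⟨k, hk, by rw [← (Bad_mem D F h.1 h.2).1]⟩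
      · rw [hN k (by omega), hN (k+1) (by omega), sub_self]
    · rfl
  refine (H1_le T c a hatom _ hsum).trans ?_
  rw [ENNReal.tsum_prod (f := fun k S => (‖c (k, S)‖₊ : ℝ≥0∞)), ← ENNReal.tsum_mul_left]
  apply ENNReal.tsum_le_tsum
  intro k
  have e2 : ∀ S : Finset T.V, (‖c (k, S)‖₊ : ℝ≥0∞) = ENNReal.ofReal (24 * K * s k) *
      (if Bad D F (s k) S then ENNReal.ofReal (∑ y ∈ S, wt T y) else 0) := by
    intro S
    change ‖c (k, S)‖ₑ = _
    rw [← ofReal_norm]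
    simp only [c]
    have h2 := hspos k
    split_ifs with h
    · rw [Complex.norm_real, Real.norm_of_nonneg (hmpos k S h).le, ← ENNReal.ofReal_mul (by positivity)]
      congr 1
      simp only [m, hW]
      ring
    · simp
  simp only [e2]
  rw [ENNReal.tsum_mul_left]
  have h3 := bad_sum D F (wt_pos T hq) (fun x => norm_nonneg _) (hspos k)
  have h2 := hspos k
  calc _ ≤ ENNReal.ofReal (24 * K * s k) * (ENNReal.ofReal (2 / s k) *
        ∑' y, if s k / 2 < F y then ENNReal.ofReal (F y * wt T y) else 0) := by gcongr
    _ = ENNReal.ofReal (48 * K) * ∑' y, tail T f (2 ^ k * lam) y := by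
      rw [← mul_assoc, ← ENNReal.ofReal_mul (by positivity)]
      have e3 : 24 * K * s k * (2 / s k) = 48 * K := by field_simp; norm_num
      have e4 : s k / 2 = 2 ^ k * lam := by simp only [hs]; ring
      rw [e3, e4]
      rfl

open Classical in
include h0 hK in
lemma g_bound {p p₁ : ℝ} (hp : 1 < p) (hpp : p < p₁) :
    T.lpPow (E T D f lam 0) p₁ ≤
      ENNReal.ofReal ((2 ^ (p₁ - p) + (2 * K) ^ p₁) * lam ^ (p₁ - p)) * T.lpPow f p := by
  set F : T.V → ℝ := fun x => ‖f x‖ with hF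
  have hKpos : 0 < K := by linarith
  have hE0 : ∀ x, E T D f lam 0 x = avC (wt T) f (P D F (2 * lam) x) := by
    intro x; unfold E; simp [hF]
  have hpt : ∀ x, ENNReal.ofReal (‖E T D f lam 0 x‖ ^ p₁ * wt T x) ≤
      ENNReal.ofReal ((2 * lam) ^ (p₁ - p)) * ENNReal.ofReal (‖f x‖ ^ p * wt T x) +
      ENNReal.ofReal ((2 * K * lam) ^ p₁) *
        (if 2 * lam < avR (wt T) F (P D F (2 * lam) x) then ENNReal.ofReal (wt T x) else 0) := by
    intro x
    have hw := wt_pos T hq x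
    by_cases h : 2 * lam < avR (wt T) F (P D F (2 * lam) x)
    · refine le_trans ?_ le_add_self
      rw [if_pos h, ← ENNReal.ofReal_mul (by positivity)]
      apply ENNReal.ofReal_le_ofReal
      have h1 := E_norm T D f lam hq hl hK h0 0 x
      have h2 : ‖E T D f lam 0 x‖ ≤ 2 * K * lam := by
        rw [pow_zero] at h1; linarith
      gcongr
      linarith
    · refine le_trans ?_ le_self_add
      rw [← ENNReal.ofReal_mul (by positivity)]
      apply ENNReal.ofReal_le_ofReal
      have h1 : P D F (2 * lam) x = {x} := (P_spec D F (2 * lam) x).resolve_left h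
      rw [hE0, h1, avC_single (wt_pos T hq), ← mul_assoc]
      have h2 : ‖f x‖ ≤ 2 * lam := by
        rw [h1] at h
        push Not at h
        unfold avR at h
        simp only [Finset.sum_singleton] at h
        rwa [mul_div_assoc, div_self hw.ne', mul_one] at h
      gcongr
      rcases (norm_nonneg (f x)).eq_or_lt with h3 | h3
      · rw [← h3, Real.zero_rpow (by linarith), Real.zero_rpow (by linarith)]; simp
      · have : ‖f x‖ ^ p₁ = ‖f x‖ ^ (p₁ - p) * ‖f x‖ ^ p := by
          rw [← Real.rpow_add h3]; simp
        rw [this]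
        gcongr
  rw [lpPow_eq T hq _ (by linarith : 0 ≤ p₁)]
  refine (ENNReal.tsum_le_tsum hpt).trans ?_
  rw [ENNReal.tsum_add, ENNReal.tsum_mul_left, ENNReal.tsum_mul_left,
    ← lpPow_eq T hq f (by linarith : 0 ≤ p)]
  have hb : (∑' x, if 2 * lam < avR (wt T) F (P D F (2 * lam) x) then
      ENNReal.ofReal (wt T x) else 0) ≤
      ENNReal.ofReal (2 / (2 * lam)) * (ENNReal.ofReal (lam ^ (1 - p)) * T.lpPow f p) := by
    refine (bad_cover D F (wt_pos T hq)).trans ?_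
    refine (bad_sum D F (wt_pos T hq) (fun x => norm_nonneg _) (by positivity)).trans ?_
    gcongr
    have e : 2 * lam / 2 = lam := by ring
    rw [e]
    exact tail_sum T hq f hp hl
  calc _ ≤ ENNReal.ofReal ((2 * lam) ^ (p₁ - p)) * T.lpPow f p + ENNReal.ofReal ((2 * K * lam) ^ p₁) *
        (ENNReal.ofReal (2 / (2 * lam)) * (ENNReal.ofReal (lam ^ (1 - p)) * T.lpPow f p)) := by gcongr
    _ = _ := by
      rw [← mul_assoc, ← mul_assoc, ← ENNReal.ofReal_mul (by positivity),
        ← ENNReal.ofReal_mul (by positivity), ← add_mul, ← ENNReal.ofReal_add (by positivity) (by positivity)]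
      congr 2
      rw [Real.mul_rpow (by positivity) hl.le, Real.mul_rpow (by positivity) hl.le, add_mul]
      congr 1
      have e1 : 2 / (2 * lam) = lam ^ (-1:ℝ) := by
        rw [Real.rpow_neg_one]; field_simp
      rw [e1, mul_assoc, mul_assoc, ← Real.rpow_add hl, ← Real.rpow_add hl]
      ring_nf

end decomposition
end final_part
end CZ

/-- Calderón–Zygmund decomposition at height `λ`: for `1 < p < p₁ ≤ ∞`
and `f ∈ L^p(μ)`, every `λ > 0` yields `f = g^λ + b^λ` with `‖g^λ‖_{L^∞} ≤ Cλ`,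
`‖g^λ‖_{L^{p₁}}^{p₁} ≤ C λ^{p₁-p} ‖f‖_{L^p}^p` when `p₁ < ∞`, and
`‖b^λ‖_{H¹} ≤ C λ^{1-p} ‖f‖_{L^p}^p`, with `C = C(p,p₁,q)`. -/
theorem cz_decomposition {q : ℕ} (hq : 2 ≤ q) (p : ℝ) (p₁ : ℝ≥0∞) (hp : 1 < p)
    (hpp₁ : ENNReal.ofReal p < p₁) :
    ∃ C : ℝ≥0, 0 < C ∧ ∀ (T : HomTree q) (f : T.V → ℂ), T.lpPow f p ≠ ⊤ →
      ∀ lam : ℝ≥0, 0 < lam →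
        ∃ g b : T.V → ℂ, (∀ x, f x = g x + b x) ∧
          (⨆ x, (‖g x‖₊ : ℝ≥0∞)) ≤ (C : ℝ≥0∞) * lam ∧
          (p₁ ≠ ⊤ → T.lpPow g p₁.toReal ≤
            (C : ℝ≥0∞) * (lam : ℝ≥0∞) ^ (p₁.toReal - p) * T.lpPow f p) ∧
          T.H1Norm b ≤ (C : ℝ≥0∞) * (lam : ℝ≥0∞) ^ (1 - p) * T.lpPow f p := by
  have hq0 : (0:ℝ) < (q:ℝ) + 3 := by positivity
  have hr1 : (2:ℝ) ^ (1 - p) < 1 := Real.rpow_lt_one_of_one_lt_of_neg (by norm_num) (by linarith)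
  have hr2 : 0 < (1 - (2:ℝ) ^ (1 - p))⁻¹ := inv_pos.2 (by linarith)
  set C1 : ℝ := 48 * ((q:ℝ) + 3) * (1 - (2:ℝ) ^ (1 - p))⁻¹ with hC1
  set C2 : ℝ := 2 ^ (p₁.toReal - p) + (2 * ((q:ℝ) + 3)) ^ p₁.toReal with hC2
  set C3 : ℝ := 2 * ((q:ℝ) + 3) with hC3
  have p1 : 0 < C1 := by positivity
  have p2 : 0 < C2 := by positivity
  have p3 : 0 < C3 := by positivity
  have hK1 : (1:ℝ) ≤ (q:ℝ) + 3 := by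
    have : (0:ℝ) ≤ q := by positivity
    linarith
  refine ⟨Real.toNNReal (C1 + C2 + C3), Real.toNNReal_pos.2 (by positivity), ?_⟩
  intro T f hf lam hlam
  have hl : 0 < (lam : ℝ) := hlam
  have hlamE : ∀ r : ℝ, (lam : ℝ≥0∞) ^ r = ENNReal.ofReal ((lam : ℝ) ^ r) := by
    intro r
    rw [← ENNReal.ofReal_rpow_of_pos hl, ENNReal.ofReal_coe_nnreal]
  obtain ⟨L, hL⟩ := CZ.exists_L hq ((T.lpPow f p).toReal / (lam : ℝ) ^ p)
  have hlp : 0 < (lam : ℝ) ^ p := by positivity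
  have h0 : ∀ x, CZ.avR (CZ.wt T) (fun x => ‖f x‖) ((CZ.sys T hq L).Q 0 x) ≤ 2 * (lam : ℝ) := by
    intro x
    refine CZ.avg_start T hq f hp hl hf _ ((CZ.sys T hq L).mem 0 x) ?_
    have h1 := hL.trans (CZ.sys_big T hq L x)
    rw [div_le_iff₀ hlp] at h1
    linarith
  refine ⟨CZ.E T (CZ.sys T hq L) f lam 0, fun x => f x - CZ.E T (CZ.sys T hq L) f lam 0 x,
    fun x => by ring, ?_, ?_, ?_⟩
  · apply iSup_le
    intro x
    change ‖CZ.E T (CZ.sys T hq L) f lam 0 x‖ₑ ≤ ENNReal.ofReal (C1 + C2 + C3) * lam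
    rw [← ofReal_norm, ← ENNReal.ofReal_coe_nnreal, ← ENNReal.ofReal_mul (by positivity)]
    apply ENNReal.ofReal_le_ofReal
    have h1 := CZ.E_norm T (CZ.sys T hq L) f lam hq hl hK1 h0 0 x
    rw [pow_zero] at h1
    nlinarith
  · intro htop
    have hpp : p < p₁.toReal := (ENNReal.ofReal_lt_iff_lt_toReal (by linarith) htop).1 hpp₁
    refine (CZ.g_bound T (CZ.sys T hq L) f lam hq hl hK1 h0 hp hpp).trans ?_
    rw [hlamE, ENNReal.ofReal_mul p2.le]
    gcongr
    change _ ≤ ENNReal.ofReal (C1 + C2 + C3)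
    apply ENNReal.ofReal_le_ofReal
    linarith
  · refine (CZ.H1_bound T (CZ.sys T hq L) f lam hq hl hK1 h0 (CZ.sys_env T hq L)).trans ?_
    have h1 := CZ.tail_sum_sum T hq f hp hl
    calc _ ≤ ENNReal.ofReal (48 * ((q:ℝ) + 3)) * (ENNReal.ofReal ((1 - 2 ^ (1 - p))⁻¹) *
          (ENNReal.ofReal ((lam : ℝ) ^ (1 - p)) * T.lpPow f p)) := by gcongr
      _ = ENNReal.ofReal C1 * ENNReal.ofReal ((lam : ℝ) ^ (1 - p)) * T.lpPow f p := by
        rw [hC1, ENNReal.ofReal_mul (p := 48 * ((q:ℝ) + 3)) (by positivity)]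
        simp only [mul_assoc]
      _ ≤ _ := by
        rw [hlamE]
        gcongr
        change _ ≤ ENNReal.ofReal (C1 + C2 + C3)
        apply ENNReal.ofReal_le_ofReal
        linarith
end
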